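/- arXiv:math/0006221 — 4 statements merged into one kernel-verified Lean document; each statement's English description precedes it below -/
import Mathlib

section
/- Let N ≥ 2, k ≥ 1, 0 ≤ l ≤ k, 0 ≤ r ≤ k be integers. The images in D_N(k,l,r) of the monomials e_1^{a_1}⋯e_N^{a_N} with integer exponents satisfying a_1 ≤ l, a_N ≤ r, and a_i + a_{i+1} ≤ k for all 1 ≤ i < N form a ℂ-vector-space basis of D_N(k,l,r). -/
/-!
STATEMENT 0: For N ≥ 2, k ≥ 1, 0 ≤ l ≤ k, 0 ≤ r ≤ k, the images in
D_N(k,l,r) = ℂ[e_1,…,e_N]/I_N(k,l,r) of the monomials e_1^{a_1}⋯e_N^{a_N} with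
a_1 ≤ l, a_N ≤ r and a_i + a_{i+1} ≤ k (1 ≤ i < N) form a ℂ-basis.
Here the variable `e_i` is `X j` with `j : Fin N`, `i = j.1 + 1`.
-/

open MvPolynomial

noncomputable section

/-- Generators of the ideal `I_N(k,l,r)`: `e_1^{l+1}`, `e_N^{r+1}`, and for each
`k+1 ≤ i ≤ N(k+1)` the sum of `e_{α_1}⋯e_{α_{k+1}}` over tuples with `∑ α_j = i`. -/
def genSet (N k l r : ℕ) : Set (MvPolynomial (Fin N) ℂ) :=
  {p | ∃ h : 0 < N, p = X (⟨0, h⟩ : Fin N) ^ (l + 1)} ∪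
  {p | ∃ h : 0 < N, p = X (⟨N - 1, Nat.sub_lt h Nat.one_pos⟩ : Fin N) ^ (r + 1)} ∪
  {p | ∃ i : ℕ, k + 1 ≤ i ∧ i ≤ N * (k + 1) ∧
      p = ∑ α ∈ Finset.univ.filter
            (fun α : Fin (k + 1) → Fin N => (∑ j, ((α j).1 + 1)) = i),
          ∏ j, X (α j)}

/-- The ideal `I_N(k,l,r)`. -/
def IdealN (N k l r : ℕ) : Ideal (MvPolynomial (Fin N) ℂ) := Ideal.span (genSet N k l r)

/-- The space `D_N(k,l,r)`. -/
abbrev Dspace (N k l r : ℕ) := MvPolynomial (Fin N) ℂ ⧸ IdealN N k l r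

/-- Admissible exponent vectors: `a_1 ≤ l`, `a_N ≤ r`, `a_i + a_{i+1} ≤ k`. -/
def BSet (N k l r : ℕ) : Set (Fin N → ℕ) :=
  {a | (∀ h : 0 < N, a ⟨0, h⟩ ≤ l) ∧
       (∀ h : 0 < N, a ⟨N - 1, Nat.sub_lt h Nat.one_pos⟩ ≤ r) ∧
       (∀ (t : Fin N) (h : t.1 + 1 < N), a t + a ⟨t.1 + 1, h⟩ ≤ k)}

/-- The family of images in `D_N(k,l,r)` of the admissible monomials. -/
def monFam (N k l r : ℕ) : BSet N k l r → Dspace N k l r :=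
  fun a => Ideal.Quotient.mk (IdealN N k l r) (∏ t : Fin N, X t ^ (a : Fin N → ℕ) t)

section Pairing

variable {J κ : Type*} [Fintype J] [DecidableEq J]

/-- The signed number of pairs of bijections `σ τ : W ≃ J` that agree in colour and satisfy
`⌊t (σ m) / 2⌋ + ⌈t (τ m) / 2⌉ = w m` for all `m`. With a single colour this is the coefficient
of `z ^ w` in the product of the alternants with exponents `⌊t / 2⌋` and `⌈t / 2⌉`. -/
def alternantCoeff [DecidableEq κ] (col : J → κ) (t : J → ℕ) {W : Type*} [Fintype W] [DecidableEq W]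
    (w : W → ℕ) : ℤ :=
  ∑ x : (W ≃ J) × (W ≃ J),
    if ∀ m, col (x.1 m) = col (x.2 m) ∧ t (x.1 m) / 2 + (t (x.2 m) + 1) / 2 = w m then
      ((Equiv.Perm.sign (x.1.symm.trans x.2) : ℤˣ) : ℤ) else 0

theorem alternantCoeff_comp_equiv [DecidableEq κ] (col : J → κ) (t : J → ℕ) {W W' : Type*} [Fintype W]
    [DecidableEq W] [Fintype W'] [DecidableEq W'] (e : W ≃ W') (w : W' → ℕ) :
    alternantCoeff col t (w ∘ e) = alternantCoeff col t w := by
  unfold alternantCoeff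
  refine Fintype.sum_equiv ((e.equivCongr (Equiv.refl J)).prodCongr
    (e.equivCongr (Equiv.refl J))) _ _ fun x => ?_
  have hs : (((e.equivCongr (Equiv.refl J)) x.1).symm.trans ((e.equivCongr (Equiv.refl J)) x.2))
      = x.1.symm.trans x.2 := by
    ext j; simp [Equiv.equivCongr]
  simp only [Equiv.prodCongr_apply, Prod.map_fst, Prod.map_snd, hs]
  refine if_congr ?_ rfl rfl
  rw [← e.forall_congr_right]
  simp [Equiv.equivCongr]

theorem exists_of_alternantCoeff_ne_zero [DecidableEq κ] {col : J → κ} {t : J → ℕ} {W : Type*} [Fintype W]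
    [DecidableEq W] {w : W → ℕ} (h : alternantCoeff col t w ≠ 0) :
    ∃ σ τ : W ≃ J, ∀ m, col (σ m) = col (τ m) ∧ t (σ m) / 2 + (t (τ m) + 1) / 2 = w m := by
  obtain ⟨x, -, hx⟩ := Finset.exists_ne_zero_of_sum_ne_zero h
  exact ⟨x.1, x.2, by by_contra h; exact hx (if_neg h)⟩

/-- Elements of equal colour have values at distance at least two. -/
def ColourSeparated (col : J → κ) (t : J → ℕ) : Prop :=
  ∀ i j, col i = col j → i ≠ j → t i + 2 ≤ t j ∨ t j + 2 ≤ t i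

/-- The strict rearrangement inequality, colour by colour. -/
theorem sum_half_mul_half_perm_lt {col : J → κ} {t : J → ℕ} (hsep : ColourSeparated col t)
    (π : Equiv.Perm J) (hcol : ∀ j, col (π j) = col j) (hπ : π ≠ 1) :
    ∑ j, t j / 2 * ((t (π j) + 1) / 2) < ∑ j, t j / 2 * ((t j + 1) / 2) := by
  induction hn : π.support.card using Nat.strong_induction_on generalizing π with
  | _ n ih =>
    have hne : π.support.Nonempty := by
      rwa [Finset.nonempty_iff_ne_empty, ne_eq, Equiv.Perm.support_eq_empty_iff]
    obtain ⟨j, hj, hmin⟩ := π.support.exists_min_image t hne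
    rw [Equiv.Perm.mem_support] at hj
    obtain ⟨i, rfl⟩ := π.surjective j
    have hi : π i ≠ i := fun h => hj (congrArg π h)
    have h1 := hmin (π (π i)) (by simpa using hj)
    have h2 := hmin i (by simpa using hi)
    have h1' := hsep (π (π i)) (π i) (hcol _) hj
    have h2' := hsep (π i) i (hcol _) hi
    have hlt : t i / 2 * ((t (π i) + 1) / 2) + t (π i) / 2 * ((t (π (π i)) + 1) / 2) <
        t i / 2 * ((t (π (π i)) + 1) / 2) + t (π i) / 2 * ((t (π i) + 1) / 2) := by
      have ha : t (π i) / 2 < t i / 2 := by omega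
      have hb : (t (π i) + 1) / 2 < (t (π (π i)) + 1) / 2 := by omega
      nlinarith
    set ρ := π * Equiv.swap i (π i) with hρ
    have hρi : ρ i = π (π i) := by simp [hρ]
    have hρj : ρ (π i) = π i := by simp [hρ]
    have hρo : ∀ x, x ≠ i → x ≠ π i → ρ x = π x := fun x hx hx' => by
      simp [hρ, Equiv.swap_apply_of_ne_of_ne hx hx']
    have hρcol : ∀ x, col (ρ x) = col x := fun x => by
      by_cases hx : x = i
      · subst hx; rw [hρi, hcol, hcol]
      by_cases hx' : x = π i
      · subst hx'; rw [hρj]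
      rw [hρo x hx hx', hcol]
    have hstep : ∑ x, t x / 2 * ((t (π x) + 1) / 2) < ∑ x, t x / 2 * ((t (ρ x) + 1) / 2) := by
      have hmem : π i ∈ Finset.univ.erase i := by simp [hi]
      rw [← Finset.add_sum_erase _ _ (Finset.mem_univ i), ← Finset.add_sum_erase _ _ hmem,
        ← Finset.add_sum_erase _ (fun x => t x / 2 * ((t (ρ x) + 1) / 2)) (Finset.mem_univ i),
        ← Finset.add_sum_erase _ (fun x => t x / 2 * ((t (ρ x) + 1) / 2)) hmem,
        hρi, hρj]
      have : ∑ x ∈ (Finset.univ.erase i).erase (π i), t x / 2 * ((t (ρ x) + 1) / 2) =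
          ∑ x ∈ (Finset.univ.erase i).erase (π i), t x / 2 * ((t (π x) + 1) / 2) := by
        refine Finset.sum_congr rfl fun x hx => ?_
        simp only [Finset.mem_erase] at hx
        rw [hρo x hx.2.1 hx.1]
      omega
    by_cases h1ρ : ρ = 1
    · simpa [h1ρ] using hstep
    refine hstep.trans (ih _ ?_ ρ hρcol h1ρ rfl)
    rw [← hn]
    refine Finset.card_lt_card ⟨fun x hx => ?_, fun hss => ?_⟩
    · rw [Equiv.Perm.mem_support] at hx ⊢
      by_cases hxi : x = i
      · rwa [hxi]
      by_cases hxj : x = π i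
      · rwa [hxj]
      rwa [← hρo x hxi hxj]
    · have := hss (Equiv.Perm.mem_support.2 hj)
      rw [Equiv.Perm.mem_support] at this
      exact this hρj

theorem sum_sq_lt_or_eq {col : J → κ} {t : J → ℕ} (hsep : ColourSeparated col t) {W : Type*}
    [Fintype W] {w : W → ℕ} {σ τ : W ≃ J}
    (h : ∀ m, col (σ m) = col (τ m) ∧ t (σ m) / 2 + (t (τ m) + 1) / 2 = w m) :
    ∑ m, w m ^ 2 < ∑ j, t j ^ 2 ∨ σ = τ := by
  by_cases hst : σ = τ
  · exact Or.inr hst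
  left
  have hlt := sum_half_mul_half_perm_lt hsep (σ.symm.trans τ)
    (fun j => by simpa using (h (σ.symm j)).1.symm)
    (fun h1 => hst (by
      ext m
      simpa using (congrArg (fun e : Equiv.Perm J => e (σ m)) h1).symm))
  have hw : ∑ m, w m ^ 2 = ∑ j, (t j / 2) ^ 2 + ∑ j, ((t j + 1) / 2) ^ 2 +
      2 * ∑ j, t j / 2 * ((t (σ.symm.trans τ j) + 1) / 2) := by
    rw [← Equiv.sum_comp (σ.symm.trans τ) fun j => ((t j + 1) / 2) ^ 2, Finset.mul_sum,
      ← Finset.sum_add_distrib, ← Finset.sum_add_distrib, ← Equiv.sum_comp σ]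
    refine Finset.sum_congr rfl fun m _ => ?_
    simp only [Equiv.trans_apply, Equiv.symm_apply_apply, ← (h m).2]
    ring
  have ht : ∑ j, t j ^ 2 = ∑ j, (t j / 2) ^ 2 + ∑ j, ((t j + 1) / 2) ^ 2 +
      2 * ∑ j, t j / 2 * ((t j + 1) / 2) := by
    rw [Finset.mul_sum, ← Finset.sum_add_distrib, ← Finset.sum_add_distrib]
    refine Finset.sum_congr rfl fun j _ => ?_
    have : t j = t j / 2 + (t j + 1) / 2 := by omega
    conv_lhs => rw [this]
    ring
  omega

theorem alternantCoeff_self_pos [DecidableEq κ] {col : J → κ} {t : J → ℕ} (hsep : ColourSeparated col t) :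
    0 < alternantCoeff col t t := by
  unfold alternantCoeff
  refine Finset.sum_pos' (fun x _ => ?_) ⟨(Equiv.refl J, Equiv.refl J), Finset.mem_univ _, ?_⟩
  · split_ifs with h
    · rcases sum_sq_lt_or_eq hsep h with h' | h'
      · exact absurd h' (lt_irrefl _)
      · simp [h']
    · exact le_rfl
  · rw [if_pos fun m => ⟨rfl, by dsimp; omega⟩]
    simp

theorem alternantCoeff_eq_zero_of_card_lt_zero [DecidableEq κ] {col : J → κ} {t : J → ℕ}
    (hsep : ColourSeparated col t) {W : Type*} [Fintype W] [DecidableEq W] {w : W → ℕ}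
    (h : Fintype.card {j // t j = 0} < Fintype.card {m // w m = 0}) :
    alternantCoeff col t w = 0 := by
  by_contra hne
  obtain ⟨σ, τ, hστ⟩ := exists_of_alternantCoeff_ne_zero hne
  refine h.not_ge (Fintype.card_le_of_injective
    (fun m : {m // w m = 0} => (⟨σ m, ?_⟩ : {j // t j = 0})) fun m m' hmm => ?_)
  · have h1 := hστ m
    have h2 := m.2
    by_cases hs : σ m = τ m
    · rw [← hs] at h1; omega
    · have := hsep _ _ h1.1 hs
      omega
  · exact Subtype.ext (σ.injective (congrArg Subtype.val hmm))

theorem alternantCoeff_eq_zero_of_card_lt_top [DecidableEq κ] {col : J → κ} {t : J → ℕ}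
    (hsep : ColourSeparated col t) {M : ℕ} (hM : ∀ j, t j ≤ M) {W : Type*} [Fintype W]
    [DecidableEq W] {w : W → ℕ}
    (h : Fintype.card {j // t j = M} < Fintype.card {m // w m = M}) :
    alternantCoeff col t w = 0 := by
  by_contra hne
  obtain ⟨σ, τ, hστ⟩ := exists_of_alternantCoeff_ne_zero hne
  refine h.not_ge (Fintype.card_le_of_injective
    (fun m : {m // w m = M} => (⟨σ m, ?_⟩ : {j // t j = M})) fun m m' hmm => ?_)
  · have h1 := hστ m
    have h2 := m.2
    have h3 := hM (σ m)
    have h4 := hM (τ m)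
    by_cases hs : σ m = τ m
    · rw [← hs] at h1; omega
    · have := hsep _ _ h1.1 hs
      omega
  · exact Subtype.ext (σ.injective (congrArg Subtype.val hmm))

theorem sum_alternantCoeff_eq_zero {k N : ℕ} (col : J → Fin k) {t : J → ℕ} (ht : ∀ j, t j < N)
    {V : Type*} [Fintype V] [DecidableEq V] (v : V → ℕ) (i : ℕ) :
    ∑ α ∈ Finset.univ.filter (fun α : Fin (k + 1) → Fin N => (∑ j, ((α j).1 + 1)) = i),
      alternantCoeff col t (Sum.elim v fun j => (α j).1) = 0 := by
  unfold alternantCoeff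
  rw [Finset.sum_comm]
  have heval : ∀ x : (V ⊕ Fin (k + 1) ≃ J) × (V ⊕ Fin (k + 1) ≃ J),
      (∑ α ∈ Finset.univ.filter (fun α : Fin (k + 1) → Fin N => (∑ j, ((α j).1 + 1)) = i),
        if ∀ m, col (x.1 m) = col (x.2 m) ∧
            t (x.1 m) / 2 + (t (x.2 m) + 1) / 2 = Sum.elim v (fun j => (α j).1) m then
          ((Equiv.Perm.sign (x.1.symm.trans x.2) : ℤˣ) : ℤ) else 0) =
      if (∀ m, col (x.1 m) = col (x.2 m)) ∧
          (∀ m, t (x.1 (Sum.inl m)) / 2 + (t (x.2 (Sum.inl m)) + 1) / 2 = v m) ∧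
          ∑ j, t (x.1 (Sum.inr j)) / 2 + ∑ j, ((t (x.2 (Sum.inr j)) + 1) / 2 + 1) = i then
        ((Equiv.Perm.sign (x.1.symm.trans x.2) : ℤˣ) : ℤ) else 0 := by
    intro x
    set β : Fin (k + 1) → Fin N := fun j =>
      ⟨t (x.1 (Sum.inr j)) / 2 + (t (x.2 (Sum.inr j)) + 1) / 2, by
        have h1 := ht (x.1 (Sum.inr j))
        have h2 := ht (x.2 (Sum.inr j))
        omega⟩ with hβ
    have hsum : ∑ j, t (x.1 (Sum.inr j)) / 2 + ∑ j, ((t (x.2 (Sum.inr j)) + 1) / 2 + 1) =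
        ∑ j, ((β j).1 + 1) := by
      rw [← Finset.sum_add_distrib]
      exact Finset.sum_congr rfl fun j _ => by simp [hβ, add_assoc]
    have hiff : ∀ α : Fin (k + 1) → Fin N, (∀ m, col (x.1 m) = col (x.2 m) ∧
        t (x.1 m) / 2 + (t (x.2 m) + 1) / 2 = Sum.elim v (fun j => (α j).1) m) ↔
        ((∀ m, col (x.1 m) = col (x.2 m)) ∧
          (∀ m, t (x.1 (Sum.inl m)) / 2 + (t (x.2 (Sum.inl m)) + 1) / 2 = v m)) ∧ α = β := by
      intro α
      rw [forall_and, and_assoc]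
      refine and_congr_right fun _ => ?_
      rw [Sum.forall]
      refine and_congr_right fun _ => ?_
      simp [funext_iff, hβ, Fin.ext_iff, eq_comm]
    simp only [hiff, hsum]
    by_cases hA : (∀ m, col (x.1 m) = col (x.2 m)) ∧
        (∀ m, t (x.1 (Sum.inl m)) / 2 + (t (x.2 (Sum.inl m)) + 1) / 2 = v m)
    · simp [hA]
    · rw [if_neg fun h => hA ⟨h.1, h.2.1⟩]
      exact Finset.sum_eq_zero fun α _ => if_neg fun h => hA h.1
  simp only [heval]
  have hpigeon : ∀ c : V ⊕ Fin (k + 1) → Fin k, ∃ m m' : Fin (k + 1), m ≠ m' ∧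
      c (Sum.inr m) = c (Sum.inr m') := fun c =>
    Fintype.exists_ne_map_eq_of_card_lt (fun m => c (Sum.inr m)) (by simp)
  choose f g hfg hc using hpigeon
  set s : (V ⊕ Fin (k + 1) ≃ J) → Equiv.Perm (V ⊕ Fin (k + 1)) := fun σ =>
    Equiv.swap (Sum.inr (f (col ∘ σ))) (Sum.inr (g (col ∘ σ))) with hs
  have hcs : ∀ (σ : V ⊕ Fin (k + 1) ≃ J) m, col (σ (s σ m)) = col (σ m) := by
    intro σ m
    simp only [hs, Equiv.swap_apply_def]
    split_ifs with h1 h2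
    · rw [h1]; exact (hc (col ∘ σ)).symm
    · rw [h2]; exact hc (col ∘ σ)
    · rfl
  have hss : ∀ σ : V ⊕ Fin (k + 1) ≃ J, s ((s σ).trans σ) = s σ := by
    intro σ
    have : col ∘ ((s σ).trans σ) = col ∘ σ := funext fun m => hcs σ m
    simp only [hs] at this ⊢
    rw [this]
  have hsl : ∀ σ m, s σ (Sum.inl m) = Sum.inl m := fun σ m => by
    simp [hs, Equiv.swap_apply_def]
  have hsr : ∀ σ : V ⊕ Fin (k + 1) ≃ J, ∑ j, t (σ (s σ (Sum.inr j))) / 2 = ∑ j, t (σ (Sum.inr j)) / 2 := by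
    intro σ
    rw [← Equiv.sum_comp (Equiv.swap (f (col ∘ σ)) (g (col ∘ σ)))]
    refine Finset.sum_congr rfl fun j _ => ?_
    simp only [hs, (Sum.inr_injective (α := V)).map_swap, Equiv.swap_apply_self]
  have hsign : ∀ σ τ : V ⊕ Fin (k + 1) ≃ J,
      Equiv.Perm.sign (((s σ).trans σ).symm.trans τ) = - Equiv.Perm.sign (σ.symm.trans τ) := by
    intro σ τ
    have : ((s σ).trans σ).symm.trans τ =
        (σ.symm.trans τ) * ((σ.symm.trans (s σ)).trans σ) := by
      ext j
      have hsymm : (s σ).symm = s σ := by simp only [hs, Equiv.symm_swap]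
      change τ ((s σ).symm (σ.symm j)) = τ (σ.symm (σ (s σ (σ.symm j))))
      rw [hsymm, Equiv.symm_apply_apply]
    rw [this, Equiv.Perm.sign_mul, Equiv.Perm.sign_symm_trans_trans, hs,
      Equiv.Perm.sign_swap (by simpa using hfg _)]
    simp
  refine Finset.sum_involution (fun x _ => ((s x.1).trans x.1, x.2)) ?_ ?_ ?_ ?_
  · intro x _
    simp only [Equiv.trans_apply, hcs, hsl, hsr]
    split_ifs
    · simp only [hsign]; simp
    · simp
  · intro x _ _ hx
    have h1 : (s x.1).trans x.1 = x.1 := congrArg Prod.fst hx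
    have h2 := hsign x.1 x.2
    rw [h1] at h2
    exact units_ne_neg_self _ h2
  · simp
  · intro x _
    refine Prod.ext ?_ rfl
    simp only [hss]
    ext m
    simp [hs]

end Pairing

section Functional

variable {N : ℕ}

theorem prod_X_eq_monomial {W : Type*} [Fintype W] (w : W → Fin N) :
    ∏ m, (X (w m) : MvPolynomial (Fin N) ℂ) = monomial (∑ m, Finsupp.single (w m) 1) 1 := by
  rw [monomial_sum_one]
  rfl

theorem prod_X_pow_eq_prod_sigma (b : Fin N → ℕ) :
    ∏ i, (X i : MvPolynomial (Fin N) ℂ) ^ b i = ∏ m : (Σ i, Fin (b i)), X m.1 := by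
  simp [Fintype.prod_sigma]

theorem monomial_eq_prod_X_pow (b : Fin N →₀ ℕ) :
    (monomial b 1 : MvPolynomial (Fin N) ℂ) = ∏ i, X i ^ b i := by
  rw [monomial_eq, C_1, one_mul, Finsupp.prod_fintype _ _ fun i => pow_zero _]

variable {J κ : Type*} [Fintype J] [DecidableEq J]

/-- The linear functional on polynomials whose value at `e_{w_1} ⋯ e_{w_n}` is
`alternantCoeff col t w`. -/
def alternantFunctional [DecidableEq κ] (col : J → κ) (t : J → ℕ) :
    MvPolynomial (Fin N) ℂ →ₗ[ℂ] ℂ :=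
  (basisMonomials (Fin N) ℂ).constr ℂ fun b =>
    ((alternantCoeff col t fun m : (Σ i : Fin N, Fin (b i)) => m.1.1 : ℤ) : ℂ)

theorem alternantFunctional_prod_X [DecidableEq κ] (col : J → κ) (t : J → ℕ) {W : Type*}
    [Fintype W] [DecidableEq W] (w : W → Fin N) :
    alternantFunctional col t (∏ m, X (w m)) = (alternantCoeff col t fun m => (w m).1 : ℂ) := by
  set b : Fin N →₀ ℕ := ∑ m, Finsupp.single (w m) 1 with hb
  have hcard : ∀ i, Fintype.card {m // w m = i} = b i := fun i => by
    simp [hb, Finsupp.finsetSum_apply, Finsupp.single_apply, Fintype.card_subtype]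
  let e : W ≃ Σ i, Fin (b i) := (Equiv.sigmaFiberEquiv w).symm.trans
    (Equiv.sigmaCongrRight fun i => Fintype.equivFinOfCardEq (hcard i))
  have hbm : (monomial b 1 : MvPolynomial (Fin N) ℂ) = basisMonomials (Fin N) ℂ b := by
    rw [coe_basisMonomials]
  rw [prod_X_eq_monomial, ← hb, hbm, alternantFunctional, Module.Basis.constr_basis,
    ← alternantCoeff_comp_equiv col t e]
  rfl

theorem alternantFunctional_eq_zero_of_mem {k l r : ℕ} {col : J → Fin k} {t : J → ℕ}
    (hsep : ColourSeparated col t) (ht : ∀ j, t j < N)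
    (hl : Fintype.card {j // t j = 0} ≤ l) (hr : Fintype.card {j // t j = N - 1} ≤ r)
    {p : MvPolynomial (Fin N) ℂ} (hp : p ∈ IdealN N k l r) :
    alternantFunctional col t p = 0 := by
  suffices h : ∀ q : MvPolynomial (Fin N) ℂ, alternantFunctional col t (q * p) = 0 by
    simpa using h 1
  unfold IdealN at hp
  induction hp using Submodule.span_induction with
  | zero => simp
  | add x y _ _ hx hy => intro q; rw [mul_add, map_add, hx, hy, add_zero]
  | smul a x _ hx => intro q; rw [smul_eq_mul, ← mul_assoc]; exact hx _
  | mem g hg =>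
    intro q
    induction q using MvPolynomial.induction_on' with
    | add p q hp hq => rw [add_mul, map_add, hp, hq, add_zero]
    | monomial b c =>
      have hbc : (monomial b c : MvPolynomial (Fin N) ℂ) =
          c • ∏ m : (Σ i, Fin (b i)), X m.1 := by
        rw [← prod_X_pow_eq_prod_sigma, ← monomial_eq_prod_X_pow, smul_monomial, smul_eq_mul,
          mul_one]
      rw [hbc, smul_mul_assoc, map_smul]
      refine smul_eq_zero_of_right c ?_
      have hword : ∀ {n : ℕ} (α : Fin n → Fin N),
          alternantFunctional col t ((∏ m : (Σ i, Fin (b i)), X m.1) * ∏ j, X (α j)) =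
          (alternantCoeff col t
            (Sum.elim (fun m : (Σ i, Fin (b i)) => m.1.1) fun j => (α j).1) : ℂ) := by
        intro n α
        have := alternantFunctional_prod_X col t
          (Sum.elim (fun m : (Σ i, Fin (b i)) => m.1) α)
        rw [Fintype.prod_sum_type] at this
        have hf : (fun m => (Sum.elim (fun m : (Σ i, Fin (b i)) => m.1) α m).1) =
            Sum.elim (fun m : (Σ i, Fin (b i)) => m.1.1) fun j => (α j).1 :=
          funext fun m => by rcases m with m | m <;> rfl
        rwa [hf] at this
      have hpow : ∀ {n : ℕ} (i : Fin N) (M : ℕ), i.1 = M →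
          n < Fintype.card {m : (Σ i, Fin (b i)) ⊕ Fin (n + 1) //
            Sum.elim (fun m : (Σ i, Fin (b i)) => m.1.1) (fun _ => i.1) m = M} := by
        intro n i M hi
        refine Nat.lt_of_succ_le ?_
        simpa using Fintype.card_le_of_injective
          (fun j : Fin (n + 1) => (⟨Sum.inr j, hi⟩ : {m : (Σ i, Fin (b i)) ⊕ Fin (n + 1) //
            Sum.elim (fun m : (Σ i, Fin (b i)) => m.1.1) (fun _ => i.1) m = M}))
          fun j j' h => Sum.inr_injective (congrArg Subtype.val h)
      rcases hg with (⟨h, rfl⟩ | ⟨h, rfl⟩) | ⟨i, -, -, rfl⟩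
      · rw [← Fin.prod_const, hword, alternantCoeff_eq_zero_of_card_lt_zero hsep
          (hl.trans_lt (hpow _ _ rfl)), Int.cast_zero]
      · rw [← Fin.prod_const, hword, alternantCoeff_eq_zero_of_card_lt_top hsep
          (fun j => Nat.le_sub_one_of_lt (ht j)) (hr.trans_lt (hpow _ _ rfl)), Int.cast_zero]
      · rw [Finset.mul_sum, map_sum]
        simp only [hword]
        rw [← Int.cast_sum, sum_alternantCoeff_eq_zero col ht, Int.cast_zero]

/-- The sum of the squares of the indices of the factors of a monomial. -/
def sqWeight (b : Fin N → ℕ) : ℕ := ∑ i, b i * i.1 ^ 2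

theorem sqWeight_eq_sum_sigma (b : Fin N → ℕ) :
    sqWeight b = ∑ m : (Σ i, Fin (b i)), m.1.1 ^ 2 := by
  simp [sqWeight, Fintype.sum_sigma]

theorem alternantFunctional_triangular [DecidableEq κ] {a b : Fin N → ℕ}
    {col : (Σ i, Fin (a i)) → κ} (hsep : ColourSeparated col fun j => j.1.1)
    (h : alternantFunctional col (fun j => j.1.1) (∏ i, X i ^ b i) ≠ 0) :
    sqWeight b < sqWeight a ∨ b = a := by
  rw [prod_X_pow_eq_prod_sigma, alternantFunctional_prod_X, Int.cast_ne_zero] at h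
  obtain ⟨σ, τ, hστ⟩ := exists_of_alternantCoeff_ne_zero h
  rw [sqWeight_eq_sum_sigma, sqWeight_eq_sum_sigma]
  refine (sum_sq_lt_or_eq hsep hστ).imp_right fun hEq => funext fun i => ?_
  subst hEq
  have hfst : ∀ m, m.1 = (σ m).1 := fun m => Fin.ext (by have := (hστ m).2; omega)
  have hcard : ∀ c : Fin N → ℕ, Fintype.card {m : (Σ i, Fin (c i)) // m.1 = i} = c i := fun c => by
    rw [Fintype.card_congr (Equiv.sigmaSubtype i), Fintype.card_fin]
  rw [← hcard b, ← hcard a]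
  exact Fintype.card_congr (σ.subtypeEquiv fun m => by rw [hfst m])

theorem alternantFunctional_self_ne_zero [DecidableEq κ] {a : Fin N → ℕ}
    {col : (Σ i, Fin (a i)) → κ} (hsep : ColourSeparated col fun j => j.1.1) :
    alternantFunctional col (fun j => j.1.1) (∏ i, X i ^ a i) ≠ 0 := by
  rw [prod_X_pow_eq_prod_sigma, alternantFunctional_prod_X, Int.cast_ne_zero]
  exact (alternantCoeff_self_pos hsep).ne'

end Functional

theorem exists_colourSeparated {N k l r : ℕ} (hN : 2 ≤ N) {a : Fin N → ℕ}
    (ha : a ∈ BSet N k l r) :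
    ∃ col : (Σ i, Fin (a i)) → Fin k, ColourSeparated col fun j => j.1.1 := by
  obtain ⟨-, -, hadj⟩ := ha
  have hle : ∀ i, a i ≤ k := by
    intro i
    by_cases h : i.1 + 1 < N
    · exact (Nat.le_add_right _ _).trans (hadj i h)
    · have hi := i.2
      have := hadj ⟨i.1 - 1, by omega⟩ (by dsimp; omega)
      have hi' : (⟨i.1 - 1 + 1, by omega⟩ : Fin N) = i := Fin.ext (by dsimp; omega)
      rw [hi'] at this
      omega
  have hlt : ∀ j : (Σ i, Fin (a i)), j.2.1 < k := fun j => j.2.2.trans_le (hle j.1)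
  refine ⟨fun j => ⟨if j.1.1 % 2 = 0 then j.2.1 else k - 1 - j.2.1, ?_⟩, ?_⟩
  · have := hlt j
    split_ifs <;> omega
  rintro ⟨i, u⟩ ⟨i', u'⟩ hcol hne
  have hu : u.1 < k := hlt ⟨i, u⟩
  have hu' : u'.1 < k := hlt ⟨i', u'⟩
  simp only [Fin.mk.injEq] at hcol ⊢
  by_contra hcon
  have key : ∀ (i i' : Fin N) (u : Fin (a i)) (u' : Fin (a i')), i.1 + 1 = i'.1 →
      u.1 + u'.1 + 2 ≤ k := by
    intro i i' u u' h
    have h1 := hadj i (h ▸ i'.2)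
    have h2 : (⟨i.1 + 1, h ▸ i'.2⟩ : Fin N) = i' := Fin.ext h
    rw [h2] at h1
    have := u.2
    have := u'.2
    omega
  rcases lt_trichotomy i.1 i'.1 with h | h | h
  · have h1 : i.1 + 1 = i'.1 := by omega
    have := key i i' u u' h1
    split_ifs at hcol <;> omega
  · obtain rfl := Fin.ext h
    refine hne (Sigma.ext rfl (heq_of_eq (Fin.ext ?_)))
    change u.1 = u'.1
    split_ifs at hcol <;> omega
  · have h1 : i'.1 + 1 = i.1 := by omega
    have := key i' i u' u h1
    split_ifs at hcol <;> omega

theorem linearIndependent_monFam {N k l r : ℕ} (hN : 2 ≤ N) :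
    LinearIndependent ℂ (monFam N k l r) := by
  rw [linearIndependent_iff]
  intro c hc
  by_contra hne
  obtain ⟨a, ha, hmin⟩ := c.support.exists_min_image (fun a => sqWeight (a : Fin N → ℕ))
    (Finsupp.support_nonempty_iff.2 hne)
  obtain ⟨col, hsep⟩ := exists_colourSeparated hN a.2
  have hmem : (c.sum fun b x => x • ∏ i, (X i : MvPolynomial (Fin N) ℂ) ^ (b : Fin N → ℕ) i) ∈
      IdealN N k l r := by
    rw [← Ideal.Quotient.eq_zero_iff_mem, ← hc, Finsupp.linearCombination_apply,
      Finsupp.sum, Finsupp.sum, map_sum]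
    rfl
  have hfib : ∀ (i : Fin N) (M : ℕ), i.1 = M →
      Fintype.card {j : (Σ i, Fin ((a : Fin N → ℕ) i)) // j.1.1 = M} = (a : Fin N → ℕ) i := by
    intro i M hi
    refine (Fintype.card_congr ((Equiv.subtypeEquivRight fun j => ?_).trans
      (Equiv.sigmaSubtype i))).trans (Fintype.card_fin _)
    rw [Fin.ext_iff, hi]
  have hN0 : 0 < N := by omega
  have hzero := alternantFunctional_eq_zero_of_mem hsep (fun j => j.1.2)
    ((hfib ⟨0, hN0⟩ 0 rfl).trans_le (a.2.1 hN0))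
    ((hfib ⟨N - 1, Nat.sub_lt hN0 Nat.one_pos⟩ (N - 1) rfl).trans_le (a.2.2.1 hN0)) hmem
  rw [Finsupp.sum, map_sum, Finset.sum_eq_single_of_mem a ha, map_smul, smul_eq_zero] at hzero
  · exact hzero.elim (Finsupp.mem_support_iff.1 ha) (alternantFunctional_self_ne_zero hsep)
  · intro b hb hba
    rw [map_smul]
    refine smul_eq_zero_of_right _ ?_
    by_contra hb0
    rcases alternantFunctional_triangular hsep hb0 with h | h
    · exact (hmin b hb).not_gt h
    · exact hba (Subtype.ext h)

section Spanning

theorem sum_sq_lt_or_forall_adjacent {n t : ℕ} {α β : Fin n → ℕ}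
    (hβ : ∀ j, β j = t ∨ β j = t + 1) (hsum : ∑ j, α j = ∑ j, β j) :
    ∑ j, β j ^ 2 < ∑ j, α j ^ 2 ∨ ∀ j, α j = t ∨ α j = t + 1 := by
  by_cases hα : ∀ j, α j = t ∨ α j = t + 1
  · exact Or.inr hα
  left
  push Not at hα
  obtain ⟨j₀, h0, h1⟩ := hα
  have hnonneg : ∀ x : ℕ, (0 : ℤ) ≤ ((x : ℤ) - t) * (x - t - 1) := by
    intro x
    rcases le_or_gt x t with h | h
    · exact mul_nonneg_of_nonpos_of_nonpos (by omega) (by omega)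
    · exact mul_nonneg (by omega) (by omega)
  have hpos : (0 : ℤ) < ∑ j, ((α j : ℤ) - t) * (α j - t - 1) := by
    refine Finset.sum_pos' (fun j _ => hnonneg _) ⟨j₀, Finset.mem_univ _, ?_⟩
    refine lt_of_le_of_ne (hnonneg _) (Ne.symm (mul_ne_zero ?_ ?_)) <;> omega
  have hzero : ∑ j, ((β j : ℤ) - t) * (β j - t - 1) = 0 :=
    Finset.sum_eq_zero fun j _ => by rcases hβ j with h | h <;> simp [h]
  have hexp : ∀ γ : Fin n → ℕ, ∑ j, ((γ j : ℤ) - t) * (γ j - t - 1) =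
      ((∑ j, γ j ^ 2 : ℕ) : ℤ) - (2 * t + 1) * ((∑ j, γ j : ℕ) : ℤ) + n * (t * (t + 1)) := by
    intro γ
    push_cast
    rw [Finset.mul_sum, ← Finset.sum_sub_distrib]
    have : (n : ℤ) * (t * (t + 1)) = ∑ _j : Fin n, (t : ℤ) * (t + 1) := by simp
    rw [this, ← Finset.sum_add_distrib]
    exact Finset.sum_congr rfl fun j _ => by ring
  rw [hexp] at hpos hzero
  rw [hsum] at hpos
  have : ((∑ j, β j ^ 2 : ℕ) : ℤ) < ((∑ j, α j ^ 2 : ℕ) : ℤ) := by linarith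
  exact_mod_cast this

theorem sum_single_eq_of_adjacent {N n : ℕ} {t t' : Fin N} (htt : t'.1 = t.1 + 1)
    {α β : Fin n → Fin N} (hα : ∀ j, α j = t ∨ α j = t') (hβ : ∀ j, β j = t ∨ β j = t')
    (hsum : ∑ j, (α j).1 = ∑ j, (β j).1) :
    ∑ j, Finsupp.single (α j) 1 = ∑ j, Finsupp.single (β j) (1 : ℕ) := by
  have key : ∀ γ : Fin n → Fin N, (∀ j, γ j = t ∨ γ j = t') →
      ∑ j, Finsupp.single (γ j) (1 : ℕ) =
        (∑ j, (γ j).1 - n * t.1) • Finsupp.single t' 1 +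
        (n * (t.1 + 1) - ∑ j, (γ j).1) • Finsupp.single t 1 := by
    intro γ hγ
    have h1 : ∑ j, (γ j).1 = ∑ j, ((γ j).1 - t.1) + n * t.1 := by
      have : n * t.1 = ∑ _j : Fin n, t.1 := by simp
      rw [this, ← Finset.sum_add_distrib]
      exact Finset.sum_congr rfl fun j _ => by rcases hγ j with h | h <;> rw [h] <;> omega
    have h2 : n * (t.1 + 1) = ∑ j, (t.1 + 1 - (γ j).1) + ∑ j, (γ j).1 := by
      have : n * (t.1 + 1) = ∑ _j : Fin n, (t.1 + 1) := by simp
      rw [this, ← Finset.sum_add_distrib]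
      exact Finset.sum_congr rfl fun j _ => by rcases hγ j with h | h <;> rw [h] <;> omega
    rw [h2, Nat.add_sub_cancel, h1, Nat.add_sub_cancel, Finset.sum_smul, Finset.sum_smul,
      ← Finset.sum_add_distrib]
    exact Finset.sum_congr rfl fun j _ => by rcases hγ j with h | h <;> simp [h, htt]
  rw [key α hα, key β hβ, hsum]

theorem exists_sum_single_le {N n : ℕ} (b : Fin N →₀ ℕ) {t t' : Fin N} (htt : t ≠ t')
    (hn : n ≤ b t + b t') :
    ∃ β : Fin n → Fin N, (∀ j, β j = t ∨ β j = t') ∧ ∑ j, Finsupp.single (β j) 1 ≤ b := by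
  obtain ⟨e⟩ : Nonempty (Fin n ↪ Fin (b t) ⊕ Fin (b t')) :=
    Function.Embedding.nonempty_of_card_le (by simpa using hn)
  let f : Fin (b t) ⊕ Fin (b t') → Fin N := Sum.elim (fun _ => t) fun _ => t'
  refine ⟨f ∘ e, fun j => ?_, ?_⟩
  · rcases h : e j with x | x <;> simp [f, h]
  · calc ∑ j, Finsupp.single ((f ∘ e) j) 1
        = ∑ x ∈ Finset.univ.map e, Finsupp.single (f x) 1 := by simp
      _ ≤ ∑ x, Finsupp.single (f x) 1 :=
          Finset.sum_le_sum_of_subset (Finset.subset_univ _)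
      _ ≤ b := by
        intro i
        simp only [f, Fintype.sum_sum_type, Sum.elim_inl, Sum.elim_inr, Finset.sum_const,
          Finset.card_univ, Fintype.card_fin, Finsupp.add_apply, Finsupp.smul_apply,
          Finsupp.single_apply, smul_eq_mul]
        split_ifs with h1 h2 h2
        · exact absurd (h1.trans h2.symm) htt
        · simp [h1]
        · simp [h2]
        · simp

theorem mk_monomial_mem_span_monFam {N k l r : ℕ} (b : Fin N →₀ ℕ) :
    Ideal.Quotient.mk (IdealN N k l r) (monomial b 1) ∈
      Submodule.span ℂ (Set.range (monFam N k l r)) := by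
  induction hM : Finsupp.weight (fun i : Fin N => N ^ 2 - i.1 ^ 2) b using
    Nat.strong_induction_on generalizing b with
  | _ M ih =>
  have hX : ∀ (i : Fin N) (n : ℕ), n + 1 ≤ b i →
      (X i ^ (n + 1) : MvPolynomial (Fin N) ℂ) ∈ IdealN N k l r →
      Ideal.Quotient.mk (IdealN N k l r) (monomial b 1) = 0 := by
    intro i n hn hmem
    rw [Ideal.Quotient.eq_zero_iff_mem]
    refine Ideal.mem_of_dvd _ ?_ hmem
    rw [monomial_eq_prod_X_pow]
    exact (pow_dvd_pow _ hn).trans (Finset.dvd_prod_of_mem _ (Finset.mem_univ i))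
  by_cases hb : (b : Fin N → ℕ) ∈ BSet N k l r
  · refine Submodule.subset_span ⟨⟨b, hb⟩, ?_⟩
    rw [monomial_eq_prod_X_pow]
    rfl
  by_cases hleft : ∀ h : 0 < N, b ⟨0, h⟩ ≤ l
  swap
  · push Not at hleft
    obtain ⟨h, hlt⟩ := hleft
    rw [hX _ l hlt (Ideal.subset_span (Or.inl (Or.inl ⟨h, rfl⟩)))]
    exact Submodule.zero_mem _
  by_cases hright : ∀ h : 0 < N, b ⟨N - 1, Nat.sub_lt h Nat.one_pos⟩ ≤ r
  swap
  · push Not at hright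
    obtain ⟨h, hlt⟩ := hright
    rw [hX _ r hlt (Ideal.subset_span (Or.inl (Or.inr ⟨h, rfl⟩)))]
    exact Submodule.zero_mem _
  have hadj : ∃ (t : Fin N) (h : t.1 + 1 < N), k + 1 ≤ b t + b ⟨t.1 + 1, h⟩ := by
    by_contra hcon
    push Not at hcon
    exact hb ⟨hleft, hright, fun t h => Nat.le_of_lt_succ (hcon t h)⟩
  obtain ⟨t, ht, hk⟩ := hadj
  obtain ⟨β, hβ, hβb⟩ := exists_sum_single_le b (t := t) (t' := ⟨t.1 + 1, ht⟩)
    (fun h => by simpa using congrArg Fin.val h) hk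
  obtain ⟨b', hb'⟩ := exists_add_of_le hβb
  rw [add_comm] at hb'
  set d : (Fin (k + 1) → Fin N) → (Fin N →₀ ℕ) := fun α => ∑ j, Finsupp.single (α j) 1 with hd
  change b = b' + d β at hb'
  set A := Finset.univ.filter fun α : Fin (k + 1) → Fin N =>
    (∑ j, ((α j).1 + 1)) = ∑ j, ((β j).1 + 1) with hA
  have hrel : ∑ α ∈ A, Ideal.Quotient.mk (IdealN N k l r) (monomial (b' + d α) 1) = 0 := by
    rw [← map_sum, Ideal.Quotient.eq_zero_iff_mem]
    have hgen : ∑ α ∈ A, ∏ j, (X (α j) : MvPolynomial (Fin N) ℂ) ∈ IdealN N k l r := by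
      refine Ideal.subset_span (Or.inr ⟨∑ j, ((β j).1 + 1), ?_, ?_, rfl⟩)
      · simp [Finset.sum_add_distrib]
      · calc ∑ j, ((β j).1 + 1) ≤ ∑ _j : Fin (k + 1), N := Finset.sum_le_sum fun j _ => (β j).2
          _ = N * (k + 1) := by simp [mul_comm]
    convert Ideal.mul_mem_left _ (monomial b' 1) hgen using 1
    rw [Finset.mul_sum]
    refine Finset.sum_congr rfl fun α _ => ?_
    rw [prod_X_eq_monomial, monomial_mul, one_mul]
  rw [← Finset.sum_filter_add_sum_filter_not A fun α => d α = d β] at hrel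
  have hsame : ∑ α ∈ A with d α = d β,
      Ideal.Quotient.mk (IdealN N k l r) (monomial (b' + d α) 1) =
      (((A.filter fun α => d α = d β).card : ℕ) : ℂ) •
        Ideal.Quotient.mk (IdealN N k l r) (monomial b 1) := by
    rw [Nat.cast_smul_eq_nsmul, ← Finset.sum_const]
    refine Finset.sum_congr rfl fun α hα => ?_
    rw [(Finset.mem_filter.1 hα).2, ← hb']
  have hcard : (((A.filter fun α => d α = d β).card : ℕ) : ℂ) ≠ 0 := by
    rw [Nat.cast_ne_zero, Finset.card_ne_zero]
    exact ⟨β, by simp [hA]⟩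
  rw [← Submodule.smul_mem_iff _ hcard, ← hsame, eq_neg_of_add_eq_zero_left hrel]
  refine Submodule.neg_mem _ (Submodule.sum_mem _ fun α hα => ih _ ?_ _ rfl)
  rw [Finset.mem_filter, hA, Finset.mem_filter] at hα
  obtain ⟨⟨-, hsum⟩, hne⟩ := hα
  simp only [Finset.sum_add_distrib, add_left_inj] at hsum
  rw [← hM, hb', map_add, map_add, add_lt_add_iff_left]
  have hweight : ∀ γ : Fin (k + 1) → Fin N,
      Finsupp.weight (fun i : Fin N => N ^ 2 - i.1 ^ 2) (d γ) + ∑ j, (γ j).1 ^ 2 =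
        (k + 1) * N ^ 2 := by
    intro γ
    simp only [hd, map_sum, Finsupp.weight_single, one_smul]
    rw [← Finset.sum_add_distrib]
    have : (k + 1) * N ^ 2 = ∑ _j : Fin (k + 1), N ^ 2 := by simp
    rw [this]
    exact Finset.sum_congr rfl fun j _ =>
      Nat.sub_add_cancel (Nat.pow_le_pow_left (γ j).2.le 2)
  have hα := hweight α
  have hβ' := hweight β
  rcases sum_sq_lt_or_forall_adjacent (t := t.1) (α := fun j => (α j).1) (β := fun j => (β j).1)
    (fun j => by simpa [Fin.ext_iff] using hβ j) hsum with h | h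
  · omega
  · exact absurd (sum_single_eq_of_adjacent (t := t) (t' := ⟨t.1 + 1, ht⟩) rfl
      (fun j => by simpa [Fin.ext_iff] using h j) hβ hsum) hne

end Spanning

theorem monomials_form_basis (N k l r : ℕ) (hN : 2 ≤ N) (hk : 1 ≤ k)
    (hl : l ≤ k) (hr : r ≤ k) :
    LinearIndependent ℂ (monFam N k l r) ∧
    Submodule.span ℂ (Set.range (monFam N k l r)) = ⊤ := by
  refine ⟨linearIndependent_monFam hN, eq_top_iff.2 fun x _ => ?_⟩
  obtain ⟨p, rfl⟩ := Ideal.Quotient.mk_surjective x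
  induction p using MvPolynomial.induction_on' with
  | monomial b c =>
    have h := Submodule.smul_mem _ c (mk_monomial_mem_span_monFam (k := k) (l := l) (r := r) b)
    have hc : (monomial b c : MvPolynomial (Fin N) ℂ) = c • monomial b 1 := by
      rw [smul_monomial, smul_eq_mul, mul_one]
    rw [hc]
    exact h
  | add p q hp hq =>
    rw [map_add]
    exact Submodule.add_mem _ (hp trivial) (hq trivial)

end
end

section
/- Let N ≥ 2, k ≥ 1, 0 ≤ l ≤ k, 0 ≤ r ≤ k be integers. Then dim_ℂ D_N(k,l,r) = |A_N(k,l,r)| (in particular D_N(k,l,r) is finite dimensional), and its bigraded Hilbert series satisfies d_N(k,l,r;q,z) = ∑_{a ∈ A_N(k,l,r)} q^{φ_q(a)} z^{φ_z(a)}. -/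
/-!
STATEMENT 1: For N ≥ 2, k ≥ 1, 0 ≤ l ≤ k, 0 ≤ r ≤ k, the space D_N(k,l,r) is
finite dimensional, dim_ℂ D_N(k,l,r) = |A_N(k,l,r)|, and its bigraded Hilbert
series satisfies d_N(k,l,r;q,z) = ∑_{a ∈ A_N(k,l,r)} q^{φ_q(a)} z^{φ_z(a)}.
The Hilbert series lives in ℤ[[q]][[z]] (outer variable z, inner variable q).
-/

open MvPolynomial

noncomputable section

/-- The bigraded component of `D_N(k,l,r)` of q-degree `i` and z-degree `j`:
the image of the span of the monomials of weighted degree `i` and total degree `j`. -/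
def Dcomp (N k l r i j : ℕ) : Submodule ℂ (Dspace N k l r) :=
  Submodule.span ℂ {x | ∃ a : Fin N → ℕ,
    (∑ t : Fin N, (t.1 + 1) * a t) = i ∧ (∑ t : Fin N, a t) = j ∧
    x = Ideal.Quotient.mk (IdealN N k l r) (∏ t : Fin N, X t ^ a t)}

/-- The bigraded Hilbert series `d_N(k,l,r;q,z)`, an element of `ℤ[[q]][[z]]`. -/
def hilb (N k l r : ℕ) : PowerSeries (PowerSeries ℤ) :=
  PowerSeries.mk fun j => PowerSeries.mk fun i => (Module.finrank ℂ (Dcomp N k l r i j) : ℤ)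

/-- The set `A_N(k,l,r)` of lattice points. -/
def ASet (N : ℕ) (k l r : ℤ) : Set (Fin N → ℤ) :=
  {a | (∀ i, 0 ≤ a i) ∧
       (∀ h : 0 < N, a ⟨0, h⟩ ≤ l) ∧
       (∀ h : 0 < N, a ⟨N - 1, Nat.sub_lt h Nat.one_pos⟩ ≤ r) ∧
       (∀ (t : Fin N) (h : t.1 + 1 < N), a t + a ⟨t.1 + 1, h⟩ ≤ k)}

def phiQ (N : ℕ) (a : Fin N → ℤ) : ℤ := ∑ t : Fin N, (t.1 + 1 : ℤ) * a t
def phiZ (N : ℕ) (a : Fin N → ℤ) : ℤ := ∑ t : Fin N, a t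

namespace LatticePoints

open Finset

section Words

variable {N : ℕ} {Y Z : Type*} [Fintype Y] [Fintype Z]

/-- The exponent vector of the monomial `∏ j, X (w j)`. -/
def content (w : Y → Fin N) (t : Fin N) : ℕ := #{j | w j = t}

lemma sum_mul_content (F : Fin N → ℕ) (w : Y → Fin N) :
    ∑ t, F t * content w t = ∑ j, F (w j) := by
  rw [← Finset.sum_fiberwise univ w (fun j => F (w j))]
  refine Finset.sum_congr rfl fun t _ => ?_
  rw [Finset.sum_congr rfl (g := fun _ => F t), Finset.sum_const, smul_eq_mul, mul_comm, content]
  intro j hj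
  rw [(Finset.mem_filter.1 hj).2]

lemma sum_content (w : Y → Fin N) : ∑ t, content w t = Fintype.card Y := by
  simpa using sum_mul_content (fun _ => 1) w

lemma prod_pow_content {M : Type*} [CommMonoid M] (x : Fin N → M) (w : Y → Fin N) :
    ∏ t, x t ^ content w t = ∏ j, x (w j) := by
  rw [← Finset.prod_fiberwise univ w (fun j => x (w j))]
  refine Finset.prod_congr rfl fun t _ => ?_
  rw [Finset.prod_congr rfl (g := fun _ => x t), Finset.prod_const, content]
  intro j hj
  rw [(Finset.mem_filter.1 hj).2]

lemma content_comp_equiv (w : Y → Fin N) (e : Z ≃ Y) : content (w ∘ e) = content w := by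
  funext t
  exact Finset.card_bij (fun j _ => e j) (by simp) (by simp)
    (fun j hj => ⟨e.symm j, by simpa using hj, by simp⟩)

lemma content_sumElim (v : Y → Fin N) (w : Z → Fin N) :
    content (Sum.elim v w) = content v + content w := by
  funext t
  simp only [content, Pi.add_apply, Finset.card_filter, Fintype.sum_sum_type, Sum.elim_inl,
    Sum.elim_inr]
  rfl

lemma content_sigma_fst (m : Fin N → ℕ) :
    content (fun x : Σ t : Fin N, Fin (m t) => x.1) = m := by
  funext t
  simp only [content, Finset.card_filter, Fintype.sum_sigma]
  simp [Finset.sum_ite_eq', apply_ite]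

lemma exists_perm_of_content_eq {v w : Y → Fin N} (h : content v = content w) :
    ∃ π : Equiv.Perm Y, v = w ∘ π := by
  have e : ∀ t, Nonempty ({j // v j = t} ≃ {j // w j = t}) := fun t =>
    Fintype.card_eq.1 <| by
      simpa [Fintype.card_subtype, content] using congrFun h t
  refine ⟨(Equiv.sigmaFiberEquiv v).symm.trans
    ((Equiv.sigmaCongrRight fun t => (e t).some).trans (Equiv.sigmaFiberEquiv w)), ?_⟩
  funext j
  exact ((e (v j)).some ⟨j, rfl⟩).2.symm

end Words

section Functional

variable {N : ℕ} {Y κ : Type*} [Fintype Y] [DecidableEq Y] [DecidableEq κ]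

/-- The coefficient of the word `w` in a product of alternants, one pair for each colour. -/
def wordSum (c : Y → κ) (ρ μ : Y → ℕ) (w : Y → Fin N) : ℤ :=
  ∑ s : Equiv.Perm Y × Equiv.Perm Y,
    if (∀ p, c (s.1 p) = c (s.2 p)) ∧ ∀ p, ρ (s.1 p) + μ (s.2 p) = (w p).1 + 1 then
      (Equiv.Perm.sign s.1 : ℤ) * (Equiv.Perm.sign s.2 : ℤ) else 0

variable (c : Y → κ) (ρ μ : Y → ℕ)

lemma wordSum_comp_perm (w : Y → Fin N) (π : Equiv.Perm Y) :
    wordSum c ρ μ (w ∘ π) = wordSum c ρ μ w := by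
  symm
  refine Fintype.sum_equiv ((Equiv.mulRight π).prodCongr (Equiv.mulRight π)) _ _ fun s => ?_
  have hiff : ((∀ p, c (s.1 p) = c (s.2 p)) ∧ ∀ p, ρ (s.1 p) + μ (s.2 p) = (w p).1 + 1) ↔
      ((∀ p, c (s.1 (π p)) = c (s.2 (π p))) ∧
        ∀ p, ρ (s.1 (π p)) + μ (s.2 (π p)) = (w (π p)).1 + 1) :=
    and_congr (π.forall_congr_right (q := fun p => c (s.1 p) = c (s.2 p))).symm
      (π.forall_congr_right (q := fun p => ρ (s.1 p) + μ (s.2 p) = (w p).1 + 1)).symm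
  have hsign : (Equiv.Perm.sign π : ℤ) * (Equiv.Perm.sign π : ℤ) = 1 := by
    rw [← Units.val_mul, Int.units_mul_self, Units.val_one]
  simp only [Equiv.prodCongr_apply, Prod.map, Equiv.coe_mulRight, Equiv.Perm.coe_mul,
    Function.comp_apply, map_mul, Units.val_mul]
  refine if_ctx_congr hiff (fun _ => ?_) fun _ => rfl
  linear_combination -(Equiv.Perm.sign s.1 : ℤ) * (Equiv.Perm.sign s.2 : ℤ) * hsign

open Classical in
/-- `wordSum` as a function of the exponent vector of the word. -/
def monSum (a : Fin N → ℕ) : ℤ :=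
  if h : ∃ w : Y → Fin N, content w = a then wordSum c ρ μ h.choose else 0

lemma monSum_content (w : Y → Fin N) : monSum c ρ μ (content w) = wordSum c ρ μ w := by
  have h : ∃ v : Y → Fin N, content v = content w := ⟨w, rfl⟩
  obtain ⟨π, hπ⟩ := exists_perm_of_content_eq h.choose_spec
  rw [monSum, dif_pos h, hπ, wordSum_comp_perm]

lemma exists_of_monSum_ne_zero {a : Fin N → ℕ} (h : monSum c ρ μ a ≠ 0) :
    ∃ (w : Y → Fin N) (σ τ : Equiv.Perm Y), content w = a ∧
      (∀ p, c (σ p) = c (τ p)) ∧ ∀ p, ρ (σ p) + μ (τ p) = (w p).1 + 1 := by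
  unfold monSum at h
  split_ifs at h with hw
  · obtain ⟨s, -, hs⟩ := Finset.exists_ne_zero_of_sum_ne_zero h
    split_ifs at hs with h'
    · exact ⟨_, s.1, s.2, hw.choose_spec, h'⟩
    · exact absurd rfl hs
  · exact absurd rfl h

variable {c ρ μ}

lemma sum_wordSum_eq_zero {k : ℕ} {Z : Type*} [Fintype Z] [Fintype κ]
    (hκ : Fintype.card κ < k + 1)
    (hpos : ∀ x y, c x = c y → 1 ≤ ρ x + μ y ∧ ρ x + μ y ≤ N)
    (e : Z ⊕ Fin (k + 1) ≃ Y) (v : Z → Fin N) (i : ℕ) :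
    ∑ α : Fin (k + 1) → Fin N with ∑ j, ((α j).1 + 1) = i,
      wordSum c ρ μ (Sum.elim v α ∘ e.symm) = 0 := by
  classical
  unfold wordSum
  rw [Finset.sum_comm]
  have hcollapse : ∀ s : Equiv.Perm Y × Equiv.Perm Y,
      (∑ α : Fin (k + 1) → Fin N with ∑ j, ((α j).1 + 1) = i,
        if (∀ p, c (s.1 p) = c (s.2 p)) ∧
          ∀ p, ρ (s.1 p) + μ (s.2 p) = ((Sum.elim v α ∘ e.symm) p).1 + 1 then
        (Equiv.Perm.sign s.1 : ℤ) * (Equiv.Perm.sign s.2 : ℤ) else 0) =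
      if (∀ p, c (s.1 p) = c (s.2 p)) ∧
        (∀ z, ρ (s.1 (e (.inl z))) + μ (s.2 (e (.inl z))) = (v z).1 + 1) ∧
        ∑ j, (ρ (s.1 (e (.inr j))) + μ (s.2 (e (.inr j)))) = i then
      (Equiv.Perm.sign s.1 : ℤ) * (Equiv.Perm.sign s.2 : ℤ) else 0 := by
    rintro ⟨σ, τ⟩
    have hsplit : ∀ α : Fin (k + 1) → Fin N,
        (∀ p, ρ (σ p) + μ (τ p) = ((Sum.elim v α ∘ e.symm) p).1 + 1) ↔
        (∀ z, ρ (σ (e (.inl z))) + μ (τ (e (.inl z))) = (v z).1 + 1) ∧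
        ∀ j, ρ (σ (e (.inr j))) + μ (τ (e (.inr j))) = (α j).1 + 1 := by
      intro α
      rw [← e.forall_congr_right]
      simp [Sum.forall]
    simp only [hsplit]
    by_cases h : (∀ p, c (σ p) = c (τ p)) ∧
        (∀ z, ρ (σ (e (.inl z))) + μ (τ (e (.inl z))) = (v z).1 + 1) ∧
        ∑ j, (ρ (σ (e (.inr j))) + μ (τ (e (.inr j)))) = i
    · rw [if_pos h]
      obtain ⟨hc, hv, hi⟩ := h
      have hb := fun j => hpos _ _ (hc (e (.inr j)))
      let α₀ : Fin (k + 1) → Fin N := fun j =>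
        ⟨ρ (σ (e (.inr j))) + μ (τ (e (.inr j))) - 1, by have := hb j; omega⟩
      have hα₀ : ∀ j, ρ (σ (e (.inr j))) + μ (τ (e (.inr j))) = (α₀ j).1 + 1 := fun j => by
        have := hb j
        simp only [α₀]
        omega
      rw [Finset.sum_eq_single α₀, if_pos ⟨hc, hv, hα₀⟩]
      · intro α _ hne
        refine if_neg fun h => hne (funext fun j => Fin.ext ?_)
        have h1 := h.2.2 j
        have h2 := hα₀ j
        omega
      · intro h
        refine absurd ?_ h
        rw [Finset.mem_filter]
        exact ⟨Finset.mem_univ _, by rw [← hi]; exact Finset.sum_congr rfl fun j _ => (hα₀ j).symm⟩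
    · rw [if_neg h]
      refine Finset.sum_eq_zero fun α hα => if_neg fun h' => h ⟨h'.1, h'.2.1, ?_⟩
      rw [← (Finset.mem_filter.1 hα).2]
      exact Finset.sum_congr rfl fun j _ => h'.2.2 j
  simp only [hcollapse]
  rw [← Finset.sum_filter]
  have hpigeon : ∀ σ : Equiv.Perm Y, ∃ j j' : Fin (k + 1), j ≠ j' ∧
      c (σ (e (.inr j))) = c (σ (e (.inr j'))) := fun σ =>
    Fintype.exists_ne_map_eq_of_card_lt (fun j => c (σ (e (.inr j)))) (by simpa using hκ)
  choose J J' hJ hJc using hpigeon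
  have hinj : Function.Injective fun j => e (Sum.inr j : Z ⊕ Fin (k + 1)) :=
    e.injective.comp Sum.inr_injective
  have hne : ∀ σ, e (.inr (J σ)) ≠ e (.inr (J' σ)) := fun σ h => hJ σ (hinj h)
  refine Finset.sum_involution
    (fun s _ => (s.1, s.2 * Equiv.swap (e (.inr (J s.1))) (e (.inr (J' s.1))))) ?_ ?_ ?_ ?_
  · rintro ⟨σ, τ⟩ -
    simp [Equiv.Perm.sign_swap (hne σ)]
  · rintro ⟨σ, τ⟩ - - h
    have h1 := congrArg Prod.snd h
    simp only [mul_eq_left] at h1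
    exact hne σ (Equiv.swap_eq_one_iff.1 h1)
  · rintro ⟨σ, τ⟩ hs
    simp only [Finset.mem_filter, Finset.mem_univ, true_and] at hs ⊢
    obtain ⟨hc, hv, hi⟩ := hs
    refine ⟨fun p => ?_, fun z => ?_, ?_⟩
    · rw [Equiv.Perm.mul_apply]
      rw [← hc, Equiv.swap_apply_def]
      split_ifs with h1 h2
      · rw [h1, hJc]
      · rw [h2, hJc]
      · rfl
    · rw [Equiv.Perm.mul_apply, Equiv.swap_apply_of_ne_of_ne, hv z] <;> simp
    · rw [← hi, Finset.sum_add_distrib, Finset.sum_add_distrib]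
      congr 1
      rw [← Equiv.sum_comp (Equiv.swap (J σ) (J' σ)) fun j => μ (τ (e (.inr j)))]
      refine Finset.sum_congr rfl fun j _ => ?_
      rw [Equiv.Perm.mul_apply, hinj.swap_apply]
  · rintro ⟨σ, τ⟩ -
    simp [mul_assoc]

variable (c ρ μ) in
/-- The linear functional on polynomials given by `monSum` on monomials. -/
def functional (N : ℕ) : MvPolynomial (Fin N) ℂ →ₗ[ℂ] ℂ :=
  (basisMonomials (Fin N) ℂ).constr ℂ fun a => (monSum c ρ μ (a : Fin N → ℕ) : ℂ)

lemma functional_prod (a : Fin N → ℕ) :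
    functional c ρ μ N (∏ t, X t ^ a t) = (monSum c ρ μ a : ℂ) := by
  have h : (∏ t, X t ^ a t : MvPolynomial (Fin N) ℂ) =
      basisMonomials (Fin N) ℂ (Finsupp.equivFunOnFinite.symm a) := by
    rw [coe_basisMonomials]
    beta_reduce
    rw [monomial_eq, Finsupp.prod_fintype _ _ fun _ => pow_zero _]
    simp
  rw [h, functional, Module.Basis.constr_basis]
  simp

lemma sum_monSum_eq_zero {k : ℕ} [Fintype κ] (hκ : Fintype.card κ < k + 1)
    (hpos : ∀ x y, c x = c y → 1 ≤ ρ x + μ y ∧ ρ x + μ y ≤ N) (m : Fin N → ℕ) (i : ℕ) :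
    ∑ α : Fin (k + 1) → Fin N with ∑ j, ((α j).1 + 1) = i, monSum c ρ μ (m + content α) = 0 := by
  by_cases hcard : Fintype.card ((Σ t : Fin N, Fin (m t)) ⊕ Fin (k + 1)) = Fintype.card Y
  · obtain ⟨e⟩ := Fintype.card_eq.1 hcard
    rw [← sum_wordSum_eq_zero hκ hpos e (fun x => x.1) i]
    refine Finset.sum_congr rfl fun α _ => ?_
    rw [← monSum_content, content_comp_equiv, content_sumElim, content_sigma_fst]
  · refine Finset.sum_eq_zero fun α _ => ?_
    by_contra h
    obtain ⟨w, -, -, hw, -⟩ := exists_of_monSum_ne_zero c ρ μ h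
    apply hcard
    rw [← sum_content w, hw]
    simp [Finset.sum_add_distrib, sum_content]

/-- A linear functional killing all products of monomials with generators kills the ideal. -/
lemma functional_eq_zero_of_mem_span {S : Set (MvPolynomial (Fin N) ℂ)}
    (φ : MvPolynomial (Fin N) ℂ →ₗ[ℂ] ℂ)
    (h : ∀ g ∈ S, ∀ m : Fin N → ℕ, φ ((∏ t, X t ^ m t) * g) = 0)
    {p : MvPolynomial (Fin N) ℂ} (hp : p ∈ Ideal.span S) : φ p = 0 := by
  suffices ∀ f, φ (f * p) = 0 by simpa using this 1
  induction hp using Submodule.span_induction with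
  | mem g hg =>
    intro f
    induction f using MvPolynomial.induction_on' with
    | monomial u a =>
      rw [monomial_eq, Finsupp.prod_fintype _ _ fun _ => pow_zero _, mul_assoc, ← smul_eq_C_mul,
        map_smul, h g hg, smul_zero]
    | add p q hp hq => rw [add_mul, map_add, hp, hq, add_zero]
  | zero => simp
  | add x y _ _ hx hy => intro f; rw [mul_add, map_add, hx, hy, add_zero]
  | smul g x _ hx => intro f; rw [smul_eq_mul, ← mul_assoc]; exact hx _

end Functional
section Energy

variable {Y κ : Type*} [Fintype Y]

lemma sum_sq_add_sum_eq {ρ μ : Y → ℤ} (h : ∀ x, (μ x - ρ x) ^ 2 = μ x - ρ x)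
    (σ τ : Equiv.Perm Y) :
    ∑ p, (ρ (σ p) + μ (τ p)) ^ 2 +
      ∑ p, ((μ (τ p) - ρ (σ p)) ^ 2 - (μ (τ p) - ρ (σ p))) = ∑ p, (ρ p + μ p) ^ 2 := by
  calc _ = ∑ p, (2 * ρ (σ p) ^ 2 + ρ (σ p)) + ∑ p, (2 * μ (τ p) ^ 2 - μ (τ p)) := by
        rw [← Finset.sum_add_distrib, ← Finset.sum_add_distrib]
        exact Finset.sum_congr rfl fun p _ => by ring
    _ = ∑ p, (2 * ρ p ^ 2 + ρ p) + ∑ p, (2 * μ p ^ 2 - μ p) := by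
        rw [Equiv.sum_comp σ fun p => 2 * ρ p ^ 2 + ρ p,
          Equiv.sum_comp τ fun p => 2 * μ p ^ 2 - μ p]
    _ = _ := by
        rw [← Finset.sum_add_distrib]
        exact Finset.sum_congr rfl fun p _ => by linear_combination h p

variable {c : Y → κ} {pos : Y → ℕ}

/-- Splitting positions into halves and recombining them within colours decreases the energy,
strictly unless nothing moves. -/
lemma eq_or_sum_sq_lt (hpos : ∀ x, 1 ≤ pos x)
    (hgap : ∀ x y, c x = c y → x = y ∨ pos x + 2 ≤ pos y ∨ pos y + 2 ≤ pos x)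
    {σ τ : Equiv.Perm Y} (hc : ∀ p, c (σ p) = c (τ p)) :
    σ = τ ∨ ∑ p, (pos (σ p) / 2 + (pos (τ p) + 1) / 2) ^ 2 < ∑ p, pos p ^ 2 := by
  let ρ : Y → ℤ := fun x => (pos x / 2 : ℕ)
  let μ : Y → ℤ := fun x => ((pos x + 1) / 2 : ℕ)
  have hd : ∀ x, μ x - ρ x = 0 ∨ μ x - ρ x = 1 := fun x => by simp only [ρ, μ]; omega
  have hsum : ∀ x, ρ x + μ x = pos x := fun x => by simp only [ρ, μ]; omega
  have key := sum_sq_add_sum_eq (ρ := ρ) (μ := μ)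
    (fun x => by rcases hd x with h | h <;> simp [h]) σ τ
  simp only [hsum] at key
  have hnonneg : ∀ p, 0 ≤ (μ (τ p) - ρ (σ p)) ^ 2 - (μ (τ p) - ρ (σ p)) := fun p => by
    rcases le_or_gt (μ (τ p) - ρ (σ p)) 0 with h | h <;> nlinarith
  rcases (Finset.sum_nonneg fun p (_ : p ∈ univ) => hnonneg p).eq_or_lt with h0 | h0
  · left
    have hz := (Finset.sum_eq_zero_iff_of_nonneg fun p _ => hnonneg p).1 h0.symm
    let f : Y → ℤ := fun x => if pos x % 2 = 0 then pos x else -pos x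
    have hd' : ∀ p, μ (τ p) - ρ (σ p) = 0 ∨ μ (τ p) - ρ (σ p) = 1 := fun p => by
      have h := hz p (Finset.mem_univ p)
      have h' : (μ (τ p) - ρ (σ p)) * (μ (τ p) - ρ (σ p) - 1) = 0 := by linear_combination h
      rcases mul_eq_zero.1 h' with h | h <;> omega
    have hle : ∀ p, f (σ p) ≤ f (τ p) := fun p => by
      rcases hgap _ _ (hc p) with h | h
      · rw [h]
      · have := hd' p
        simp only [f, ρ, μ] at this ⊢
        split_ifs <;> omega
    have heq := (Finset.sum_eq_sum_iff_of_le fun p _ => hle p).1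
      ((Equiv.sum_comp σ f).trans (Equiv.sum_comp τ f).symm)
    refine Equiv.ext fun p => (hgap _ _ (hc p)).resolve_right fun h => ?_
    have h1 := heq p (Finset.mem_univ p)
    have h2 := hpos (σ p)
    have h3 := hpos (τ p)
    simp only [f] at h1
    split_ifs at h1 <;> omega
  · right
    zify
    simp only [ρ, μ] at key h0
    push_cast at key h0
    linarith

end Energy

section Spanning

variable {N : ℕ}

/-- The weighted degree of a monomial. -/
def weight (a : Fin N → ℕ) : ℕ := ∑ t : Fin N, (t.1 + 1) * a t

/-- The sum of the squares of the indices of the factors of a monomial. -/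
def energy (a : Fin N → ℕ) : ℕ := ∑ t : Fin N, (t.1 + 1) ^ 2 * a t

lemma eq_or_energy_lt {t t' : Fin N} (ht : t'.1 = t.1 + 1) (p q : ℕ) {v : Fin N → ℕ}
    (hlen : ∑ s, v s = ∑ s, (Pi.single t p + Pi.single t' q : Fin N → ℕ) s)
    (hwt : weight v = weight (Pi.single t p + Pi.single t' q)) :
    v = Pi.single t p + Pi.single t' q ∨
      energy (Pi.single t p + Pi.single t' q) < energy v := by
  have hne : t ≠ t' := fun h => by rw [h] at ht; omega
  have hform : ∀ w : Fin N → ℕ, (energy w : ℤ) =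
      ∑ s : Fin N, ((s.1 : ℤ) - t.1) * ((s.1 : ℤ) - t.1 - 1) * w s +
        (2 * t.1 + 3) * (weight w : ℤ) - (t.1 + 1) * (t.1 + 2) * ((∑ s, w s : ℕ) : ℤ) := by
    intro w
    simp only [energy, weight]
    push_cast
    rw [Finset.mul_sum, Finset.mul_sum, ← Finset.sum_add_distrib, ← Finset.sum_sub_distrib]
    exact Finset.sum_congr rfl fun s _ => by ring
  have hsingle : ∑ s : Fin N, ((s.1 : ℤ) - t.1) * ((s.1 : ℤ) - t.1 - 1) *
      ((Pi.single t p + Pi.single t' q : Fin N → ℕ) s : ℤ) = 0 := by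
    refine Finset.sum_eq_zero fun s _ => ?_
    by_cases h1 : s = t
    · simp [h1]
    by_cases h2 : s = t'
    · simp [h2, ht]
    · simp [h1, h2]
  have hnonneg : ∀ s : Fin N, 0 ≤ ((s.1 : ℤ) - t.1) * ((s.1 : ℤ) - t.1 - 1) * v s := by
    intro s
    refine mul_nonneg ?_ (Int.natCast_nonneg _)
    rcases le_or_gt (s.1 : ℤ) t.1 with h | h <;> nlinarith
  have hv := hform v
  have hu := hform (Pi.single t p + Pi.single t' q)
  rw [hsingle, ← hwt, ← hlen] at hu
  rcases (Finset.sum_nonneg fun s (_ : s ∈ univ) => hnonneg s).eq_or_lt with h0 | h0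
  · left
    have hz := (Finset.sum_eq_zero_iff_of_nonneg fun s _ => hnonneg s).1 h0.symm
    have hsupp : ∀ s, s ≠ t → s ≠ t' → v s = 0 := by
      intro s h1 h2
      have h1' : s.1 ≠ t.1 := fun h => h1 (Fin.ext h)
      have h2' : s.1 ≠ t'.1 := fun h => h2 (Fin.ext h)
      rcases mul_eq_zero.1 (hz s (Finset.mem_univ s)) with h | h
      · rcases mul_eq_zero.1 h with h | h <;> omega
      · exact_mod_cast h
    have hv' : v = Pi.single t (v t) + Pi.single t' (v t') := by
      funext s
      by_cases h1 : s = t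
      · simp [h1, hne]
      by_cases h2 : s = t'
      · simp [h2, hne.symm]
      · simp [h1, h2, hsupp s h1 h2]
    have hs : ∀ p q : ℕ, ∑ s, (Pi.single t p + Pi.single t' q : Fin N → ℕ) s = p + q := by
      intro p q
      simp [Finset.sum_add_distrib]
    have hw : ∀ p q : ℕ, weight (Pi.single t p + Pi.single t' q : Fin N → ℕ) =
        (t.1 + 1) * (p + q) + q := by
      intro p q
      simp [weight, mul_add, Finset.sum_add_distrib, Pi.single_apply, ht]
      ring
    rw [hv'] at hlen hwt
    rw [hs, hs] at hlen
    rw [hw, hw, hlen] at hwt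
    have h2 : v t' = q := by omega
    have h1 : v t = p := by omega
    rw [hv', h1, h2]
  · right
    zify
    linarith

lemma exists_content_eq {Y : Type*} [Fintype Y] {u : Fin N → ℕ} (h : ∑ t, u t = Fintype.card Y) :
    ∃ w : Y → Fin N, content w = u := by
  have hcard : Fintype.card Y = Fintype.card (Σ t : Fin N, Fin (u t)) := by simp [h]
  obtain ⟨e⟩ := Fintype.card_eq.1 hcard
  exact ⟨_, (content_comp_equiv _ e).trans (content_sigma_fst u)⟩

lemma weight_add (a b : Fin N → ℕ) : weight (a + b) = weight a + weight b := by
  simp [weight, mul_add, Finset.sum_add_distrib]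

lemma energy_add (a b : Fin N → ℕ) : energy (a + b) = energy a + energy b := by
  simp [energy, mul_add, Finset.sum_add_distrib]

lemma weight_content {Y : Type*} [Fintype Y] (w : Y → Fin N) :
    weight (content w) = ∑ j, ((w j).1 + 1) := sum_mul_content (fun t => t.1 + 1) w

lemma energy_content {Y : Type*} [Fintype Y] (w : Y → Fin N) :
    energy (content w) = ∑ j, ((w j).1 + 1) ^ 2 := sum_mul_content (fun t => (t.1 + 1) ^ 2) w

lemma energy_le (a : Fin N → ℕ) : energy a ≤ N ^ 2 * ∑ t, a t := by
  rw [energy, Finset.mul_sum]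
  exact Finset.sum_le_sum fun t _ => Nat.mul_le_mul_right _ (Nat.pow_le_pow_left t.2 2)

/-- The lattice points of `ASet`, with natural number coordinates. -/
def natPoints (N k l r : ℕ) : Set (Fin N → ℕ) := {a | (fun t => (a t : ℤ)) ∈ ASet N k l r}

lemma mem_natPoints {k l r : ℕ} {a : Fin N → ℕ} : a ∈ natPoints N k l r ↔
    (∀ h : 0 < N, a ⟨0, h⟩ ≤ l) ∧ (∀ h : 0 < N, a ⟨N - 1, Nat.sub_lt h Nat.one_pos⟩ ≤ r) ∧
      ∀ (t : Fin N) (h : t.1 + 1 < N), a t + a ⟨t.1 + 1, h⟩ ≤ k := by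
  simp only [natPoints, ASet, Set.mem_ofPred_eq, Int.natCast_nonneg, implies_true, true_and,
    Nat.cast_le]
  norm_cast

lemma le_of_mem_natPoints {k l r : ℕ} (hN : 2 ≤ N) {a : Fin N → ℕ} (ha : a ∈ natPoints N k l r)
    (t : Fin N) : a t ≤ k := by
  have h := (mem_natPoints.1 ha).2.2
  by_cases ht : t.1 + 1 < N
  · exact (Nat.le_add_right _ _).trans (h t ht)
  · have h1 : t.1 - 1 + 1 < N := by omega
    have h2 := h ⟨t.1 - 1, by omega⟩ h1
    have h3 : (⟨t.1 - 1 + 1, h1⟩ : Fin N) = t := Fin.ext (by simp only; omega)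
    simp only [h3] at h2
    exact (Nat.le_add_left _ _).trans h2

lemma finite_natPoints (k l r : ℕ) (hN : 2 ≤ N) : (natPoints N k l r).Finite :=
  (Set.finite_Iic (fun _ : Fin N => k)).subset fun _ ha => le_of_mem_natPoints hN ha

/-- The image of a monomial in `Dspace`. -/
def mon (k l r : ℕ) (a : Fin N → ℕ) : Dspace N k l r :=
  Ideal.Quotient.mk (IdealN N k l r) (∏ t, X t ^ a t)

lemma prod_pow_add (a b : Fin N → ℕ) : (∏ t, X t ^ (a + b) t : MvPolynomial (Fin N) ℂ) =
    (∏ t, X t ^ a t) * ∏ t, X t ^ b t := by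
  simp [pow_add, Finset.prod_mul_distrib]

lemma prod_pow_single (t : Fin N) (n : ℕ) :
    (∏ s, X s ^ (Pi.single t n : Fin N → ℕ) s : MvPolynomial (Fin N) ℂ) = X t ^ n := by
  rw [Finset.prod_eq_single t] <;> simp +contextual

lemma mon_eq_zero {k l r : ℕ} {a : Fin N → ℕ} {t : Fin N} {n : ℕ} (h : n ≤ a t)
    (hX : (X t ^ n : MvPolynomial (Fin N) ℂ) ∈ genSet N k l r) : mon k l r a = 0 := by
  have ha : a = (a - Pi.single t n) + Pi.single t n := by
    funext s
    by_cases hs : s = t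
    · subst hs; simp [h]
    · simp [hs]
  have hX' : (X t ^ n : MvPolynomial (Fin N) ℂ) ∈ IdealN N k l r := Ideal.subset_span hX
  rw [mon, ha, prod_pow_add, prod_pow_single, map_mul, Ideal.Quotient.eq_zero_iff_mem.2 hX',
    mul_zero]

lemma sum_mon_eq_zero {k l r i : ℕ} (h1 : k + 1 ≤ i) (h2 : i ≤ N * (k + 1)) (m : Fin N → ℕ) :
    ∑ α : Fin (k + 1) → Fin N with ∑ j, ((α j).1 + 1) = i, mon k l r (m + content α) = 0 := by
  have hmem : (∑ α : Fin (k + 1) → Fin N with ∑ j, ((α j).1 + 1) = i, ∏ j, X (α j) :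
      MvPolynomial (Fin N) ℂ) ∈ IdealN N k l r :=
    Ideal.subset_span (Or.inr ⟨i, h1, h2, rfl⟩)
  simp only [mon, prod_pow_add, prod_pow_content, ← map_sum, ← Finset.mul_sum]
  exact Ideal.Quotient.eq_zero_iff_mem.2 (Ideal.mul_mem_left _ _ hmem)

lemma mon_mem_span (k l r : ℕ) (a : Fin N → ℕ) :
    mon k l r a ∈ Submodule.span ℂ (mon k l r ''
      {b ∈ natPoints N k l r | weight b = weight a ∧ ∑ t, b t = ∑ t, a t}) := by
  induction hn : N ^ 2 * (∑ t, a t) - energy a using Nat.strong_induction_on generalizing a with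
  | _ n ih =>
  by_cases ha : a ∈ natPoints N k l r
  · exact Submodule.subset_span ⟨a, ⟨ha, rfl, rfl⟩, rfl⟩
  by_cases h1 : ∀ h : 0 < N, a ⟨0, h⟩ ≤ l
  swap
  · push Not at h1
    obtain ⟨h, h1⟩ := h1
    rw [mon_eq_zero h1 (Or.inl (Or.inl ⟨h, rfl⟩))]
    exact Submodule.zero_mem _
  by_cases h2 : ∀ h : 0 < N, a ⟨N - 1, Nat.sub_lt h Nat.one_pos⟩ ≤ r
  swap
  · push Not at h2
    obtain ⟨h, h2⟩ := h2
    rw [mon_eq_zero h2 (Or.inl (Or.inr ⟨h, rfl⟩))]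
    exact Submodule.zero_mem _
  have h3 : ∃ t t' : Fin N, t'.1 = t.1 + 1 ∧ k + 1 ≤ a t + a t' := by
    by_contra! hcon
    exact ha (mem_natPoints.2 ⟨h1, h2, fun t h => Nat.lt_succ_iff.1 (hcon t _ rfl)⟩)
  obtain ⟨t, t', ht, hk⟩ := h3
  have hne : t ≠ t' := fun h => by rw [h] at ht; omega
  obtain ⟨p, q, hpq, hp, hq⟩ : ∃ p q, p + q = k + 1 ∧ p ≤ a t ∧ q ≤ a t' :=
    ⟨min (a t) (k + 1), k + 1 - min (a t) (k + 1), by omega, by omega, by omega⟩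
  set u : Fin N → ℕ := Pi.single t p + Pi.single t' q with hu
  have hau : a = (a - u) + u := by
    funext s
    by_cases hs : s = t
    · subst hs; simp [hu, hne, hp]
    by_cases hs' : s = t'
    · subst hs'; simp [hu, hs, hq]
    · simp [hu, hs, hs']
  set m := a - u
  have hlen : ∑ s, u s = k + 1 := by simp [hu, Finset.sum_add_distrib, hpq]
  have hcard : ∑ s, u s = Fintype.card (Fin (k + 1)) := by simpa using hlen
  obtain ⟨α₀, hα₀⟩ := exists_content_eq hcard
  have hrel := sum_mon_eq_zero (k := k) (l := l) (r := r) (i := weight u) (N := N) ?_ ?_ m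
  rotate_left
  · rw [← hlen]
    exact Finset.sum_le_sum fun s _ => Nat.le_mul_of_pos_left _ s.1.succ_pos
  · rw [← hlen, Finset.mul_sum]
    exact Finset.sum_le_sum fun s _ => Nat.mul_le_mul_right _ s.2
  rw [← Finset.sum_filter_add_sum_filter_not _ (fun α => content α = u)] at hrel
  have hsame : ∀ α ∈ Finset.filter (fun α : Fin (k + 1) → Fin N => content α = u)
      (Finset.univ.filter fun α => ∑ j, ((α j).1 + 1) = weight u),
      mon k l r (m + content α) = mon k l r a := fun α hα => by
    rw [(Finset.mem_filter.1 hα).2, ← hau]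
  rw [Finset.sum_congr rfl hsame, Finset.sum_const, ← Nat.cast_smul_eq_nsmul ℂ] at hrel
  rw [← Submodule.smul_mem_iff _ (Nat.cast_ne_zero (R := ℂ).2 (Finset.card_ne_zero.2 ⟨α₀, ?_⟩)),
    eq_neg_of_add_eq_zero_left hrel]
  · refine Submodule.neg_mem _ (Submodule.sum_mem _ fun α hα => ?_)
    simp only [Finset.mem_filter, Finset.mem_univ, true_and] at hα
    obtain ⟨hw, hα⟩ := hα
    rw [← weight_content] at hw
    have hlen' : ∑ s, content α s = ∑ s, u s := by rw [sum_content, hcard]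
    have hlt := (eq_or_energy_lt ht p q hlen' hw).resolve_left hα
    have hl : ∑ s, (m + content α) s = ∑ s, a s := by
      rw [hau]
      simp only [Pi.add_apply, Finset.sum_add_distrib, hlen']
    have hwt : weight (m + content α) = weight a := by
      rw [hau, weight_add, weight_add, hw]
    have he : energy a < energy (m + content α) := by
      rw [hau, energy_add m u, energy_add m]
      exact Nat.add_lt_add_left hlt _
    have hle := energy_le (m + content α)
    rw [hl] at hle
    have := ih _ (by rw [hl]; omega) (m + content α) rfl
    rwa [hl, hwt] at this
  · simp only [Finset.mem_filter, Finset.mem_univ, true_and]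
    exact ⟨by rw [← weight_content, hα₀], hα₀⟩

end Spanning

section Independence

variable {N : ℕ}

lemma content_le_content {Y : Type*} [Fintype Y] {v w : Y → Fin N} {t : Fin N}
    (h : ∀ p, v p = t → w p = t) : content v t ≤ content w t :=
  Finset.card_le_card fun p hp => by simpa using h p (by simpa using hp)

section Colouring

/-- The position of a box above the diagram of `b`, counted from `1`. -/
def pos (b : Fin N → ℕ) (x : Σ t : Fin N, Fin (b t)) : ℕ := x.1.1 + 1

/-- Boxes in even columns are coloured from the bottom up, in odd columns from the top down. -/
def colour {k : ℕ} {b : Fin N → ℕ} (hb : ∀ t, b t ≤ k) (x : Σ t : Fin N, Fin (b t)) : Fin k :=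
  if x.1.1 % 2 = 0 then ⟨x.2, x.2.2.trans_le (hb _)⟩
  else ⟨k - 1 - x.2, by have := x.2.2.trans_le (hb _); omega⟩

lemma colour_gap {k l r : ℕ} {b : Fin N → ℕ} (hmem : b ∈ natPoints N k l r)
    (hb : ∀ t, b t ≤ k) (x y : Σ t : Fin N, Fin (b t)) (h : colour hb x = colour hb y) :
    x = y ∨ pos b x + 2 ≤ pos b y ∨ pos b y + 2 ≤ pos b x := by
  have hadj : ∀ s t : Fin N, t.1 = s.1 + 1 → b s + b t ≤ k := fun s t hst => by
    have h1 : s.1 + 1 < N := hst ▸ t.2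
    have h2 : t = ⟨s.1 + 1, h1⟩ := Fin.ext hst
    rw [h2]
    exact (mem_natPoints.1 hmem).2.2 s h1
  obtain ⟨s, i⟩ := x
  obtain ⟨t, j⟩ := y
  have hi := i.2
  have hj := j.2
  have hbs := hb s
  have hbt := hb t
  simp only [colour, pos] at h ⊢
  rcases lt_trichotomy s.1 t.1 with hst | hst | hst
  · refine Or.inr (Or.inl ?_)
    by_contra hcon
    have := hadj s t (by omega)
    split_ifs at h <;> simp only [Fin.mk.injEq] at h <;> omega
  · left
    obtain rfl : s = t := Fin.ext hst
    have : i = j := Fin.ext (by split_ifs at h <;> simp only [Fin.mk.injEq] at h <;> omega)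
    rw [this]
  · refine Or.inr (Or.inr ?_)
    by_contra hcon
    have := hadj t s (by omega)
    split_ifs at h <;> simp only [Fin.mk.injEq] at h <;> omega

end Colouring

/-- A functional on `Dspace` whose leading exponent, with respect to the energy, is `b`. -/
theorem exists_triangular_functional {k l r : ℕ} (hN : 2 ≤ N) {b : Fin N → ℕ}
    (hmem : b ∈ natPoints N k l r) :
    ∃ φ : MvPolynomial (Fin N) ℂ →ₗ[ℂ] ℂ, (∀ p ∈ IdealN N k l r, φ p = 0) ∧
      φ (∏ t, X t ^ b t) ≠ 0 ∧
      ∀ a : Fin N → ℕ, φ (∏ t, X t ^ a t) ≠ 0 → a = b ∨ energy a < energy b := by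
  have hb := le_of_mem_natPoints hN hmem
  have hgap := colour_gap hmem hb
  have hpos : ∀ x, 1 ≤ pos b x := fun x => Nat.le_add_left _ _
  have hposN : ∀ x, pos b x ≤ N := fun x => x.1.2
  let ρ := fun x => pos b x / 2
  let μ := fun x => (pos b x + 1) / 2
  have hbound : ∀ x y, colour hb x = colour hb y → 1 ≤ ρ x + μ y ∧ ρ x + μ y ≤ N := by
    intro x y h
    have h1 := hpos x
    have h2 := hpos y
    have h3 := hposN x
    have h4 := hposN y
    simp only [ρ, μ]
    rcases hgap x y h with rfl | h | h <;> omega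
  have hb_content := content_sigma_fst b
  refine ⟨functional (colour hb) ρ μ N, fun p hp => ?_, ?_, fun a ha => ?_⟩
  · refine functional_eq_zero_of_mem_span _ (fun g hg m => ?_) hp
    rcases hg with (⟨h0, rfl⟩ | ⟨h0, rfl⟩) | ⟨i, -, -, rfl⟩
    · rw [← prod_pow_single, ← prod_pow_add, functional_prod, Int.cast_eq_zero]
      by_contra hne
      obtain ⟨w, σ, τ, hw, hc, hρμ⟩ := exists_of_monSum_ne_zero _ _ _ hne
      have h1 : content w ⟨0, h0⟩ ≤ content ((fun x => x.1) ∘ σ) ⟨0, h0⟩ :=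
        content_le_content fun p hp => Fin.ext <| by
          have h2 := hρμ p
          have h3 := hpos (τ p)
          simp only [hp, ρ, μ, pos, Function.comp_apply] at h2 h3 ⊢
          omega
      rw [content_comp_equiv, hb_content, hw] at h1
      have h2 := (mem_natPoints.1 hmem).1 h0
      simp at h1
      omega
    · rw [← prod_pow_single, ← prod_pow_add, functional_prod, Int.cast_eq_zero]
      by_contra hne
      obtain ⟨w, σ, τ, hw, hc, hρμ⟩ := exists_of_monSum_ne_zero _ _ _ hne
      have h1 : content w ⟨N - 1, Nat.sub_lt h0 Nat.one_pos⟩ ≤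
          content ((fun x => x.1) ∘ (if N % 2 = 0 then σ else τ : Equiv.Perm _))
            ⟨N - 1, Nat.sub_lt h0 Nat.one_pos⟩ :=
        content_le_content fun p hp => Fin.ext <| by
          have h2 := hρμ p
          have h3 := hposN (τ p)
          have h4 := hposN (σ p)
          simp only [hp, ρ, μ, pos, Function.comp_apply] at h2 h3 h4 ⊢
          split_ifs <;> omega
      rw [content_comp_equiv, hb_content, hw] at h1
      have h2 := (mem_natPoints.1 hmem).2.1 h0
      simp at h1
      omega
    · simp only [Finset.mul_sum, map_sum, ← prod_pow_content, ← prod_pow_add, functional_prod]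
      rw [← Int.cast_sum, sum_monSum_eq_zero (by simp) hbound, Int.cast_zero]
  · have hsum := monSum_content (colour hb) ρ μ fun x => x.1
    rw [hb_content] at hsum
    rw [functional_prod, Int.cast_ne_zero, hsum]
    refine ne_of_gt (Finset.sum_pos' (fun s _ => ?_) ⟨1, Finset.mem_univ _, ?_⟩)
    · split_ifs with h
      · obtain heq | hlt := eq_or_sum_sq_lt hpos hgap h.1
        · rw [heq, ← Units.val_mul, Int.units_mul_self, Units.val_one]
          exact zero_le_one
        · refine absurd hlt (not_lt_of_ge (le_of_eq ?_))
          exact Finset.sum_congr rfl fun p _ => congrArg (· ^ 2) (h.2 p).symm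
      · exact le_rfl
    · rw [if_pos]
      · simp
      · refine ⟨fun p => rfl, fun p => ?_⟩
        simp only [ρ, μ, pos, Prod.fst_one, Prod.snd_one, Equiv.Perm.one_apply]
        omega
  · rw [functional_prod, Int.cast_ne_zero] at ha
    obtain ⟨w, σ, τ, hw, hc, hρμ⟩ := exists_of_monSum_ne_zero _ _ _ ha
    refine (eq_or_sum_sq_lt hpos hgap hc).imp (fun h => ?_) fun h => ?_
    · have hwσ : w = (fun x => x.1) ∘ σ := funext fun p => Fin.ext <| by
        have := hρμ p
        simp only [← h, ρ, μ, pos, Function.comp_apply] at this ⊢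
        omega
      rw [← hw, hwσ, content_comp_equiv, hb_content]
    · have henergy := energy_content fun x : Σ t : Fin N, Fin (b t) => x.1
      rw [hb_content] at henergy
      rw [← hw, henergy, energy_content]
      calc _ = ∑ p, (pos b (σ p) / 2 + (pos b (τ p) + 1) / 2) ^ 2 :=
            Finset.sum_congr rfl fun p _ => congrArg (· ^ 2) (hρμ p).symm
        _ < _ := h

lemma linearIndepOn_mon (k l r : ℕ) (hN : 2 ≤ N) :
    LinearIndepOn ℂ (mon k l r) (natPoints N k l r) := by
  refine linearIndependent_iff'.2 fun s g hg => ?_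
  by_contra! hne
  obtain ⟨b, hb, hmin⟩ := Finset.exists_min_image (s.filter fun i => g i ≠ 0)
    (fun i => energy i.1) (hne.imp fun i hi => Finset.mem_filter.2 hi)
  obtain ⟨φ, hφ, hφb, hφa⟩ := exists_triangular_functional hN b.2
  obtain ⟨hbs, hgb⟩ := Finset.mem_filter.1 hb
  have hI : ∑ i ∈ s, g i • (∏ t, X t ^ i.1 t : MvPolynomial (Fin N) ℂ) ∈ IdealN N k l r := by
    rw [← Ideal.Quotient.eq_zero_iff_mem, map_sum]
    exact hg
  have h0 := hφ _ hI
  rw [map_sum, Finset.sum_eq_single_of_mem b hbs] at h0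
  · rw [map_smul, smul_eq_mul] at h0
    exact (mul_ne_zero hgb hφb) h0
  · intro a has hab
    rw [map_smul, smul_eq_mul]
    by_contra hne
    obtain ⟨h1, h2⟩ := mul_ne_zero_iff.1 hne
    rcases hφa _ h2 with h | h
    · exact hab (Subtype.ext h)
    · exact absurd h (not_lt_of_ge (hmin a (Finset.mem_filter.2 ⟨has, h1⟩)))

lemma finrank_span_mon {k l r : ℕ} (hN : 2 ≤ N) {S : Set (Fin N → ℕ)}
    (hS : S ⊆ natPoints N k l r) :
    Module.finrank ℂ (Submodule.span ℂ (mon k l r '' S)) = S.ncard := by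
  have : Fintype S := ((finite_natPoints k l r hN).subset hS).fintype
  rw [Set.image_eq_range, finrank_span_eq_card ((linearIndepOn_mon k l r hN).mono hS),
    Set.ncard_eq_toFinset_card', Set.toFinset_card]

lemma span_mon_natPoints (k l r : ℕ) :
    Submodule.span ℂ (mon k l r '' natPoints N k l r) = ⊤ := by
  rw [eq_top_iff]
  rintro x -
  obtain ⟨p, rfl⟩ := Ideal.Quotient.mk_surjective x
  induction p using MvPolynomial.induction_on' with
  | monomial u a =>
    rw [monomial_eq, Finsupp.prod_fintype _ _ fun _ => pow_zero _, ← smul_eq_C_mul]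
    exact Submodule.smul_mem _ a
      (Submodule.span_mono (Set.image_mono (Set.sep_subset _ _)) (mon_mem_span k l r u))
  | add p q hp hq => rw [map_add]; exact Submodule.add_mem _ hp hq

lemma Dcomp_eq_span (k l r i j : ℕ) : Dcomp N k l r i j = Submodule.span ℂ (mon k l r ''
    {b ∈ natPoints N k l r | weight b = i ∧ ∑ t, b t = j}) := by
  refine le_antisymm (Submodule.span_le.2 ?_) (Submodule.span_mono ?_)
  · rintro x ⟨a, rfl, rfl, rfl⟩
    exact mon_mem_span k l r a
  · rintro x ⟨a, ⟨-, hi, hj⟩, rfl⟩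
    exact ⟨a, hi, hj, rfl⟩

lemma ncard_natPoints_sep (k l r : ℕ) {P : (Fin N → ℕ) → Prop} {Q : (Fin N → ℤ) → Prop}
    (hPQ : ∀ a : Fin N → ℕ, P a ↔ Q fun t => a t) :
    {a ∈ natPoints N k l r | P a}.ncard = {a ∈ ASet N k l r | Q a}.ncard := by
  have hinj : Function.Injective fun (a : Fin N → ℕ) (t : Fin N) => (a t : ℤ) :=
    fun a b h => funext fun t => Nat.cast_injective (congrFun h t)
  rw [← Set.ncard_image_of_injective _ hinj]
  congr 1
  ext a
  constructor
  · rintro ⟨a, ⟨ha, hP⟩, rfl⟩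
    exact ⟨ha, (hPQ a).1 hP⟩
  · rintro ⟨ha, hQ⟩
    obtain ⟨a, rfl⟩ : ∃ a' : Fin N → ℕ, (fun t => (a' t : ℤ)) = a :=
      ⟨fun t => (a t).toNat, funext fun t => Int.toNat_of_nonneg (ha.1 t)⟩
    exact ⟨a, ⟨ha, (hPQ a).2 hQ⟩, rfl⟩

end Independence

end LatticePoints

theorem dim_and_hilbert_series_eq_lattice_points (N k l r : ℕ)
    (hN : 2 ≤ N) (hk : 1 ≤ k) (hl : l ≤ k) (hr : r ≤ k) :
    FiniteDimensional ℂ (Dspace N k l r) ∧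
    Module.finrank ℂ (Dspace N k l r) = (ASet N k l r).ncard ∧
    hilb N k l r = PowerSeries.mk fun j => PowerSeries.mk fun i =>
      ({a ∈ ASet N (k : ℤ) l r | phiQ N a = (i : ℤ) ∧ phiZ N a = (j : ℤ)}.ncard : ℤ) := by
  have hfin := LatticePoints.finite_natPoints k l r hN
  have htop := LatticePoints.span_mon_natPoints (N := N) k l r
  refine ⟨⟨htop ▸ Submodule.fg_span (hfin.image _)⟩, ?_, ?_⟩
  · rw [← finrank_top ℂ, ← htop, LatticePoints.finrank_span_mon hN subset_rfl]
    simpa using LatticePoints.ncard_natPoints_sep k l r (P := fun _ => True) (Q := fun _ => True)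
      fun _ => Iff.rfl
  · unfold hilb
    congr! 5 with j i
    rw [LatticePoints.Dcomp_eq_span, LatticePoints.finrank_span_mon hN (Set.sep_subset _ _)]
    refine LatticePoints.ncard_natPoints_sep k l r fun a => ?_
    simp only [LatticePoints.weight, phiQ, phiZ]
    norm_cast

end
end

section
/- Let N ≥ 2, k ≥ 1, 0 ≤ l ≤ k, 0 ≤ r ≤ k be integers. Let Q be the k×k integer matrix with entries Q_{ij} = min(i,j), and let L, R ∈ ℤ^k with L_i = max(i−l, 0) and R_i = max(i−r, 0). Then, as an identity of formal power series in q and z, d_N(k,l,r;q,z) = ∑_{v ∈ ℤ_{≥0}^k} q^{vᵀQv + Lᵀv} z^{∑_{i=1}^k i·v_i} ∏_{i=1}^k [ (N+1)i − (2Qv + L + R − v)_i choose v_i ]_q, where the sum is a well-defined formal power series because for each fixed exponent of z only finitely many v contribute a nonzero term. -/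
/-!
STATEMENT 2: the fermionic (Gordon-type) formula for the bigraded Hilbert series
d_N(k,l,r;q,z), with Q_{ij} = min(i,j), L_i = max(i-l,0), R_i = max(i-r,0).
The Hilbert series lives in ℤ[[q]][[z]] (outer variable z, inner variable q);
the coefficient of z^j is the (finite) sum over the vectors v ∈ ℤ_{≥0}^k with
∑ i v_i = j of the corresponding q-series.
-/

open MvPolynomial

noncomputable section

/-- `(1 - q^i)⁻¹ = ∑_{d≥0} q^{di}` in `ℤ[[q]]` (for `i ≥ 1`). -/
def geomInv (i : ℕ) : PowerSeries ℤ := PowerSeries.mk fun d => if i ∣ d then 1 else 0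

/-- The Gaussian binomial `[n choose m]_q = ∏_{i=1}^n (1-q^i) /
(∏_{i=1}^m (1-q^i) ∏_{i=1}^{n-m} (1-q^i))`, as an element of `ℤ[[q]]` (it is a polynomial). -/
def qbinom (n m : ℕ) : PowerSeries ℤ :=
  (∏ i ∈ Finset.Icc 1 n, (1 - (PowerSeries.X : PowerSeries ℤ) ^ i)) *
  (∏ i ∈ Finset.Icc 1 m, geomInv i) * (∏ i ∈ Finset.Icc 1 (n - m), geomInv i)

/-- The Gaussian binomial for integer arguments: `0` unless `0 ≤ m ≤ n`. -/
def qbinomZ (n m : ℤ) : PowerSeries ℤ :=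
  if 0 ≤ m ∧ m ≤ n then qbinom n.toNat m.toNat else 0

/-- The (finite) set of `v ∈ ℤ_{≥0}^k` with `∑_{i=1}^k i·v_i = j`. -/
def Vset (k j : ℕ) : Finset (Fin k → ℕ) :=
  (Fintype.piFinset fun _ : Fin k => Finset.range (j + 1)).filter
    (fun v => (∑ i : Fin k, (i.1 + 1) * v i) = j)

/-- The Gaussian binomial `[P + v choose v]` at a point `q`, by the `q`-Pascal rule. -/
def gaussNat {K : Type*} [Field K] (q : K) : ℕ → ℕ → K
  | _, 0 => 1
  | 0, _ + 1 => 1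
  | P + 1, v + 1 => gaussNat q P (v + 1) + q ^ (P + 1) * gaussNat q (P + 1) v

/-- The extension of `gaussNat` by zero to negative `P`. -/
def gaussInt {K : Type*} [Field K] (q : K) (P : ℤ) (v : ℕ) : K :=
  if 0 ≤ P then gaussNat q P.toNat v else 0

/-- The fermionic sum (coefficient of `z ^ J`), organised as a recursion on the level `k`. -/
def fermi {K : Type*} [Field K] (q : K) : ℕ → ℤ → ℤ → ℤ → ℤ → K
  | 0, _, _, r, J => if J = 0 ∧ 0 ≤ r then 1 else 0
  | k + 1, N, l, r, J => ∑ v ∈ Finset.range (J.toNat + 1),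
      q ^ ((k + 1 : ℤ) * v * v + max ((k + 1 : ℤ) - l) 0 * v + 2 * (J - (k + 1 : ℤ) * v) * v) *
        gaussInt q ((N + 1) * (k + 1 : ℤ) - max ((k + 1 : ℤ) - l) 0 - max ((k + 1 : ℤ) - r) 0
          - 2 * J) v *
        fermi q k (N - 2 * v) l r (J - (k + 1 : ℤ) * v)

section Fermi

variable {K : Type*} [Field K] (q : K)

lemma gaussNat_zero_right (P : ℕ) : gaussNat q P 0 = 1 := by
  cases P <;> simp [gaussNat]

lemma gaussNat_zero_left (v : ℕ) : gaussNat q 0 v = 1 := by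
  cases v <;> simp [gaussNat]

lemma gaussInt_of_neg {P : ℤ} (hP : P < 0) (v : ℕ) : gaussInt q P v = 0 := by
  simp [gaussInt, hP]

lemma gaussInt_zero_right {P : ℤ} (hP : 0 ≤ P) : gaussInt q P 0 = 1 := by
  simp [gaussInt, hP, gaussNat_zero_right]

lemma gaussInt_succ (P : ℤ) (v : ℕ) :
    gaussInt q P (v + 1) = gaussInt q (P - 1) (v + 1) + q ^ P * gaussInt q P v := by
  rcases lt_or_ge P 0 with h | h
  · rw [gaussInt_of_neg q h, gaussInt_of_neg q h, gaussInt_of_neg q (by omega)]; simp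
  · obtain ⟨n, rfl⟩ := Int.eq_ofNat_of_zero_le h
    rcases n with _ | n
    · rw [gaussInt_of_neg q (P := ((0 : ℕ) : ℤ) - 1) (by simp)]
      simp [gaussInt, gaussNat_zero_left]
    · have e : ((n + 1 : ℕ) : ℤ) - 1 = n := by push_cast; ring
      rw [e]
      simp only [gaussInt, Int.natCast_nonneg, if_true, Int.toNat_natCast, zpow_natCast]
      rw [gaussNat]

lemma fermi_of_neg (k : ℕ) : ∀ (N l r : ℤ) {J : ℤ}, J < 0 → fermi q k N l r J = 0 := by
  induction k with
  | zero => intro N l r J hJ; simp [fermi, hJ.ne]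
  | succ k ih =>
    intro N l r J hJ
    rw [fermi]
    refine Finset.sum_eq_zero fun v _ => ?_
    rw [ih, mul_zero]
    have : 0 ≤ (k + 1 : ℤ) * v := by positivity
    omega

lemma fermi_succ {k : ℕ} {J : ℤ} {M : ℕ} (hM : J.toNat < M) (N l r : ℤ) :
    fermi q (k + 1) N l r J = ∑ v ∈ Finset.range M,
      q ^ ((k + 1 : ℤ) * v * v + max ((k + 1 : ℤ) - l) 0 * v + 2 * (J - (k + 1 : ℤ) * v) * v) *
        gaussInt q ((N + 1) * (k + 1 : ℤ) - max ((k + 1 : ℤ) - l) 0 - max ((k + 1 : ℤ) - r) 0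
          - 2 * J) v *
        fermi q k (N - 2 * v) l r (J - (k + 1 : ℤ) * v) := by
  rw [fermi]
  refine Finset.sum_subset (Finset.range_mono hM) fun v _ hv => ?_
  rw [fermi_of_neg, mul_zero]
  simp only [Finset.mem_range, not_lt] at hv
  have : (0 : ℤ) ≤ k * v := by positivity
  have : (k + 1 : ℤ) * v = k * v + v := by ring
  omega

lemma fermi_neg_right (k : ℕ) : ∀ (N l J : ℤ) {r : ℤ}, r < 0 → fermi q k N l r J = 0 := by
  induction k with
  | zero => intro N l J r hr; simp [fermi, hr]
  | succ k ih =>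
    intro N l J r hr
    rw [fermi]
    exact Finset.sum_eq_zero fun v _ => by rw [ih _ _ _ hr, mul_zero]

/-- The right boundary parameter only matters up to the level. -/
lemma fermi_right_saturate (k : ℕ) :
    ∀ (N l J : ℤ) {r r' : ℤ}, k ≤ r → k ≤ r' → fermi q k N l r J = fermi q k N l r' J := by
  induction k with
  | zero => intro N l J r r' hr hr'; simp at hr hr'; simp [fermi, hr, hr']
  | succ k ih =>
    intro N l J r r' hr hr'
    push_cast at hr hr'
    rw [fermi, fermi]
    refine Finset.sum_congr rfl fun v _ => ?_
    rw [ih _ _ _ (r := r) (r' := r') (by omega) (by omega),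
      max_eq_right (b := 0) (a := (k + 1 : ℤ) - r) (by omega),
      max_eq_right (b := 0) (a := (k + 1 : ℤ) - r') (by omega)]

lemma fermi_eq_zero_of_nonpos (k : ℕ) :
    ∀ {N : ℤ} (l r : ℤ) {J : ℤ}, N ≤ 0 → J ≠ 0 → fermi q k N l r J = 0 := by
  induction k with
  | zero => intro N l r J _ hJ; simp [fermi, hJ]
  | succ k ih =>
    intro N l r J hN hJ
    rw [fermi]
    refine Finset.sum_eq_zero fun v _ => ?_
    by_cases hj : J - (k + 1 : ℤ) * v = 0
    · rw [gaussInt_of_neg]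
      · simp
      · have hv : (1 : ℤ) ≤ v := by
          rcases v with _ | v
          · simp at hj; exact absurd hj hJ
          · push_cast; omega
        have h1 : (N + 1) * (k + 1 : ℤ) ≤ 1 * (k + 1) :=
          mul_le_mul_of_nonneg_right (by omega) (by positivity)
        have h2 : (k + 1 : ℤ) * 1 ≤ (k + 1) * v :=
          mul_le_mul_of_nonneg_left hv (by positivity)
        omega
    · rw [ih _ _ (by omega) hj, mul_zero]

lemma fermi_zero_eq_one (k : ℕ) :
    ∀ {N l r : ℤ}, 0 ≤ r →
      (∀ i : ℕ, i ≤ k → 0 ≤ (N + 1) * i - max ((i : ℤ) - l) 0 - max ((i : ℤ) - r) 0) →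
      fermi q k N l r 0 = 1 := by
  induction k with
  | zero => intro N l r hr _; simp [fermi, hr]
  | succ k ih =>
    intro N l r hr h
    have h1 := h (k + 1) le_rfl
    push_cast at h1
    rw [fermi]
    simp only [Int.toNat_zero, zero_add, Finset.range_one, Finset.sum_singleton]
    rw [gaussInt_zero_right q (by omega)]
    simpa using ih hr fun i hi => h i (by omega)

lemma fermi_eq_zero_of_vacancy_neg {k : ℕ} {N l r J : ℤ} (hk : 1 ≤ k)
    (h : (N + 1) * k - max ((k : ℤ) - l) 0 - max ((k : ℤ) - r) 0 - 2 * J < 0) :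
    fermi q k N l r J = 0 := by
  obtain ⟨k, rfl⟩ := Nat.exists_eq_add_of_le' hk
  rw [fermi]
  push_cast at h
  exact Finset.sum_eq_zero fun v _ => by rw [gaussInt_of_neg q h]; simp

/-- The boundary recursion of the fermionic sums at level `k`. -/
def FermiRec (k : ℕ) (N l r J : ℤ) : Prop :=
  fermi q k N l r J =
    fermi q k N l (r - 1) J + q ^ (N * r) * fermi q k (N - 1) l (k - r) (J - r)

lemma fermiRec_saturated (k : ℕ) (N l J : ℤ) : FermiRec q k N l (k + 1) J := by
  rw [FermiRec, fermi_neg_right q k (N - 1) _ _ (r := k - (k + 1)) (by omega), mul_zero, add_zero]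
  exact fermi_right_saturate q k _ _ _ (by omega) (by omega)

/-- If the next vacancy number is nonnegative, the recursion extends to all `N`. -/
lemma FermiRec.of_vacancy_nonneg {k : ℕ} {l : ℤ} (hl : 0 ≤ l)
    (ih : ∀ N r J : ℤ, 1 ≤ N → 0 ≤ r → r ≤ k + 1 → FermiRec q k N l r J)
    {N r J : ℤ} (hr : 0 ≤ r) (hrk : r ≤ k + 1)
    (hP : 0 ≤ (N + 1) * (k + 1 : ℤ) - max ((k + 1 : ℤ) - l) 0 - max ((k + 1 : ℤ) - r) 0 - 2 * J) :
    FermiRec q k N l r J := by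
  rcases lt_or_ge 0 N with hN | hN
  · exact ih N r J hN hr hrk
  rcases hrk.lt_or_eq with hrk' | rfl
  swap
  · exact fermiRec_saturated q k N l J
  rcases lt_or_ge J 0 with hJ | hJ
  · rw [FermiRec, fermi_of_neg q k _ _ _ hJ, fermi_of_neg q k _ _ _ hJ, fermi_of_neg]
    · simp
    · omega
  have hN0 : N = 0 := by
    by_contra hne
    have : (N + 1) * (k + 1 : ℤ) ≤ 0 * (k + 1) :=
      mul_le_mul_of_nonneg_right (by omega) (by positivity)
    omega
  subst hN0
  rw [FermiRec]
  rcases hr.lt_or_eq with hr0 | rfl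
  · rw [fermi_of_neg q k (0 - 1) _ _ (J := J - r) (by omega), mul_zero, add_zero]
    by_cases hJ0 : J = 0
    · subst hJ0
      rw [fermi_zero_eq_one q k hr, fermi_zero_eq_one q k (by omega)]
      · intro i hi; omega
      · intro i hi; omega
    · rw [fermi_eq_zero_of_nonpos q k _ _ le_rfl hJ0, fermi_eq_zero_of_nonpos q k _ _ le_rfl hJ0]
  · have hJ0 : J = 0 := by omega
    subst hJ0
    rw [fermi_neg_right q k 0 _ _ (r := 0 - 1) (by omega)]
    simp only [mul_zero, zpow_zero, one_mul, zero_add, sub_zero]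
    rw [fermi_zero_eq_one q k hr, fermi_zero_eq_one q k (by omega)]
    · intro i hi; simp; omega
    · intro i hi; simp; omega

variable {q}

lemma fermiRec_succ (hq : q ≠ 0) {k : ℕ} {l : ℤ} (hl : 0 ≤ l)
    (ih : ∀ N r J : ℤ, 1 ≤ N → 0 ≤ r → r ≤ k + 1 → FermiRec q k N l r J)
    {N r J : ℤ} (hN : 1 ≤ N) (hr : 0 ≤ r) (hrk : r ≤ k + 1 + 1) :
    FermiRec q (k + 1) N l r J := by
  rcases hrk.lt_or_eq with hrk' | rfl
  swap
  · exact_mod_cast fermiRec_saturated q (k + 1) N l J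
  rcases hr.lt_or_eq with hr0 | rfl
  swap
  · -- the case `r = 0`
    rw [FermiRec, fermi_neg_right q (k + 1) N _ _ (r := 0 - 1) (by omega)]
    simp only [mul_zero, zpow_zero, one_mul, zero_add, sub_zero]
    rw [fermi, fermi]
    refine Finset.sum_congr rfl fun v _ => ?_
    have e : (N + 1) * (k + 1 : ℤ) - max ((k + 1 : ℤ) - l) 0 - max ((k + 1 : ℤ) - 0) 0 - 2 * J
        = (N - 1 + 1) * (k + 1 : ℤ) - max ((k + 1 : ℤ) - l) 0
          - max ((k + 1 : ℤ) - (k + 1 : ℕ)) 0 - 2 * J := by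
      rw [max_eq_left (a := (k + 1 : ℤ) - 0) (by omega),
        max_eq_right (a := (k + 1 : ℤ) - (k + 1 : ℕ)) (by push_cast; omega)]
      ring
    rw [← e]
    rcases lt_or_ge ((N + 1) * (k + 1 : ℤ) - max ((k + 1 : ℤ) - l) 0
      - max ((k + 1 : ℤ) - 0) 0 - 2 * J) 0 with hP | hP
    · rw [gaussInt_of_neg q hP]; simp
    · congr 1
      have := FermiRec.of_vacancy_nonneg q hl ih (N := N - 2 * v) (r := 0)
        (J := J - (k + 1 : ℤ) * v) le_rfl (by omega) (by
          have : (N - 2 * v + 1) * (k + 1 : ℤ) - 2 * (J - (k + 1 : ℤ) * v)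
            = (N + 1) * (k + 1 : ℤ) - 2 * J := by ring
          omega)
      rw [FermiRec, fermi_neg_right q k _ _ _ (r := 0 - 1) (by omega)] at this
      simp only [mul_zero, zpow_zero, one_mul, zero_add, sub_zero] at this
      rw [this, show N - 2 * (v : ℤ) - 1 = N - 1 - 2 * v by ring]
      exact fermi_right_saturate q k _ _ _ (by omega) (by push_cast; omega)
  rw [FermiRec]
  set c : ℤ := max ((k + 1 : ℤ) - l) 0 with hc
  set P : ℤ := N * (k + 1 : ℤ) - c + r - 2 * J with hPdef
  obtain ⟨M, hM⟩ : ∃ M : ℕ, J.toNat < M ∧ (J - r).toNat < M := ⟨J.toNat + 1, by omega, by omega⟩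
  rw [fermi_succ q (M := M + 1) (by omega) N l r, fermi_succ q (M := M + 1) (by omega) N l (r - 1),
    fermi_succ q (M := M) hM.2 (N - 1) l]
  have e1 : (N + 1) * (k + 1 : ℤ) - c - max ((k + 1 : ℤ) - r) 0 - 2 * J = P := by
    rw [max_eq_left (by omega), hPdef]; ring
  have e2 : (N + 1) * (k + 1 : ℤ) - c - max ((k + 1 : ℤ) - (r - 1)) 0 - 2 * J = P - 1 := by
    rw [max_eq_left (by omega), hPdef]; ring
  have e3 : (N - 1 + 1) * (k + 1 : ℤ) - c - max ((k + 1 : ℤ) - (((k + 1 : ℕ) : ℤ) - r)) 0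
      - 2 * (J - r) = P := by
    push_cast
    rw [max_eq_left (by omega), hPdef]; ring
  simp only [← hc, e1, e2, e3]
  set w : ℕ → K := fun v => q ^ ((k + 1 : ℤ) * v * v + c * v + 2 * (J - (k + 1 : ℤ) * v) * v)
    with hw
  set w' : ℕ → K := fun v => q ^ ((k + 1 : ℤ) * v * v + c * v + 2 * (J - r - (k + 1 : ℤ) * v) * v)
    with hw'
  -- expand the difference on the left
  have L1 : ∀ v : ℕ, w v * gaussInt q P v * fermi q k (N - 2 * v) l r (J - (k + 1 : ℤ) * v)
      = w v * gaussInt q P v * fermi q k (N - 2 * v) l (r - 1) (J - (k + 1 : ℤ) * v)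
        + q ^ (N * r) * (w' v * gaussInt q P v *
          fermi q k (N - 1 - 2 * v) l (k - r) (J - r - (k + 1 : ℤ) * v)) := by
    intro v
    rcases lt_or_ge P 0 with hP | hP
    · simp [gaussInt_of_neg q hP]
    · have := FermiRec.of_vacancy_nonneg q hl ih (N := N - 2 * v) (r := r)
        (J := J - (k + 1 : ℤ) * v) hr (by omega) (by
          have : (N - 2 * v + 1) * (k + 1 : ℤ) - 2 * (J - (k + 1 : ℤ) * v)
            = (N + 1) * (k + 1 : ℤ) - 2 * J := by ring
          omega)
      rw [FermiRec] at this
      rw [this, show N - 2 * (v : ℤ) - 1 = N - 1 - 2 * v by ring,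
        show J - (k + 1 : ℤ) * v - r = J - r - (k + 1 : ℤ) * v by ring]
      have ew : w v * q ^ ((N - 2 * (v : ℤ)) * r) = q ^ (N * r) * w' v := by
        rw [hw, hw']
        simp only
        rw [← zpow_add₀ hq, ← zpow_add₀ hq]
        congr 1; ring
      linear_combination (gaussInt q P v *
        fermi q k (N - 1 - 2 * v) l (k - r) (J - r - (k + 1 : ℤ) * v)) * ew
  have R1 : ∀ v : ℕ, q ^ (N * r) * (w' v * gaussInt q P v *
        fermi q k (N - 1 - 2 * v) l (((k + 1 : ℕ) : ℤ) - r) (J - r - (k + 1 : ℤ) * v))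
      = q ^ (N * r) * (w' v * gaussInt q P v *
          fermi q k (N - 1 - 2 * v) l (k - r) (J - r - (k + 1 : ℤ) * v))
        + w (v + 1) * (q ^ P * gaussInt q P v) *
          fermi q k (N - 2 * ((v + 1 : ℕ) : ℤ)) l (r - 1) (J - (k + 1 : ℤ) * ((v + 1 : ℕ) : ℤ)) := by
    intro v
    rcases lt_or_ge P 0 with hP | hP
    · simp [gaussInt_of_neg q hP]
    · have := FermiRec.of_vacancy_nonneg q hl ih (N := N - 1 - 2 * v) (r := ((k + 1 : ℕ) : ℤ) - r)
        (J := J - r - (k + 1 : ℤ) * v) (by push_cast; omega) (by push_cast; omega) (by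
          have : (N - 1 - 2 * v + 1) * (k + 1 : ℤ) - 2 * (J - r - (k + 1 : ℤ) * v)
            = (N - 1 + 1) * (k + 1 : ℤ) - 2 * (J - r) := by ring
          omega)
      rw [FermiRec] at this
      rw [this, show ((k + 1 : ℕ) : ℤ) - r - 1 = k - r by push_cast; ring,
        show (k : ℤ) - (((k + 1 : ℕ) : ℤ) - r) = r - 1 by push_cast; ring,
        show N - 1 - 2 * (v : ℤ) - 1 = N - 2 * ((v + 1 : ℕ) : ℤ) by push_cast; ring,
        show J - r - (k + 1 : ℤ) * v - (((k + 1 : ℕ) : ℤ) - r)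
          = J - (k + 1 : ℤ) * ((v + 1 : ℕ) : ℤ) by push_cast; ring]
      have ew : q ^ (N * r) * w' v * q ^ ((N - 1 - 2 * (v : ℤ)) * (((k + 1 : ℕ) : ℤ) - r))
          = w (v + 1) * q ^ P := by
        rw [hw, hw']
        simp only
        rw [← zpow_add₀ hq, ← zpow_add₀ hq, ← zpow_add₀ hq]
        congr 1
        rw [hPdef]; push_cast; ring
      linear_combination (gaussInt q P v *
        fermi q k (N - 2 * ((v + 1 : ℕ) : ℤ)) l (r - 1)
          (J - (k + 1 : ℤ) * ((v + 1 : ℕ) : ℤ))) * ew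
  -- the term `v = 0` where Pascal's rule may fail
  have Z : gaussInt q P 0 * fermi q k N l (r - 1) J
      = gaussInt q (P - 1) 0 * fermi q k N l (r - 1) J := by
    by_cases hP0 : P = 0
    · have : fermi q k N l (r - 1) J = 0 := by
        have hsplit : N * (k + 1 : ℤ) = N * k + N := by ring
        rcases Nat.eq_zero_or_pos k with hk0 | hk0
        · subst hk0
          have : J ≠ 0 := by
            rintro rfl
            simp at hPdef hc hrk'
            omega
          simp [fermi, this]
        · refine fermi_eq_zero_of_vacancy_neg q hk0 ?_
          have : (N + 1) * (k : ℤ) = N * k + k := by ring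
          omega
      rw [this]; simp
    · rcases lt_or_ge P 0 with hP | hP
      · rw [gaussInt_of_neg q hP, gaussInt_of_neg q (by omega)]
      · rw [gaussInt_zero_right q hP, gaussInt_zero_right q (by omega)]
  have lastZ : fermi q k (N - 1 - 2 * (M : ℤ)) l (k - r) (J - r - (k + 1 : ℤ) * M) = 0 := by
    apply fermi_of_neg
    have : (0 : ℤ) ≤ k * M := by positivity
    have : (k + 1 : ℤ) * M = k * M + M := by ring
    omega
  rw [Finset.sum_congr rfl fun v _ => L1 v, Finset.sum_add_distrib, Finset.mul_sum,
    Finset.sum_congr rfl fun v _ => R1 v, Finset.sum_add_distrib]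
  rw [Finset.sum_range_succ (fun v : ℕ => q ^ (N * r) * (w' v * gaussInt q P v *
          fermi q k (N - 1 - 2 * v) l (k - r) (J - r - (k + 1 : ℤ) * v))) M, lastZ]
  rw [Finset.sum_range_succ', Finset.sum_range_succ' (fun v : ℕ => w v * gaussInt q (P - 1) v * _)]
  simp only [gaussInt_succ q P]
  simp only [mul_add, add_mul, Finset.sum_add_distrib]
  simp only [Nat.cast_zero, mul_zero, sub_zero, add_zero]
  linear_combination (w 0) * Z

/-- The boundary recursion of the fermionic sums. -/
theorem fermiRec (hq : q ≠ 0) (k : ℕ) {l : ℤ} (hl : 0 ≤ l) :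
    ∀ N r J : ℤ, 1 ≤ N → 0 ≤ r → r ≤ k + 1 → FermiRec q k N l r J := by
  induction k with
  | zero =>
    intro N r J hN hr hr1
    obtain rfl | rfl : r = 0 ∨ r = 1 := by push_cast at hr1; omega
    · simp [FermiRec, fermi]
    · simp [FermiRec, fermi]
  | succ k ih =>
    intro N r J hN hr hr1
    exact fermiRec_succ hq hl ih hN hr (by push_cast at hr1; exact hr1)

end Fermi

section ClosedForm

lemma mem_Vset {k j : ℕ} {v : Fin k → ℕ} :
    v ∈ Vset k j ↔ (∑ i : Fin k, (i.1 + 1) * v i) = j := by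
  simp only [Vset, Finset.mem_filter, Fintype.mem_piFinset, Finset.mem_range,
    and_iff_right_iff_imp]
  rintro rfl i
  have h1 : (i.1 + 1) * v i ≤ ∑ i : Fin k, (i.1 + 1) * v i :=
    Finset.single_le_sum (f := fun i : Fin k => (i.1 + 1) * v i) (fun _ _ => Nat.zero_le _)
      (Finset.mem_univ i)
  have h2 : 1 * v i ≤ (i.1 + 1) * v i := Nat.mul_le_mul_right _ (by omega)
  omega

lemma sum_Vset_succ {A : Type*} [AddCommMonoid A] (k j : ℕ) (f : (Fin (k + 1) → ℕ) → A) :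
    ∑ v ∈ Vset (k + 1) j, f v = ∑ w ∈ Finset.range (j + 1),
      if (k + 1) * w ≤ j then
        ∑ u ∈ Vset k (j - (k + 1) * w), f (Fin.snoc (α := fun _ => ℕ) u w) else 0 := by
  have h : ∀ w : ℕ, (if (k + 1) * w ≤ j then
        ∑ u ∈ Vset k (j - (k + 1) * w), f (Fin.snoc (α := fun _ => ℕ) u w) else 0) =
      ∑ u ∈ (if (k + 1) * w ≤ j then Vset k (j - (k + 1) * w) else ∅),
        f (Fin.snoc (α := fun _ => ℕ) u w) := by
    intro w; split_ifs <;> simp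
  simp only [h]
  rw [Finset.sum_sigma']
  refine Finset.sum_bij' (fun v _ => ⟨v (Fin.last k), Fin.init v⟩)
    (fun x _ => Fin.snoc (α := fun _ => ℕ) x.2 x.1) ?_ ?_ ?_ ?_ ?_
  · intro v hv
    rw [mem_Vset, Fin.sum_univ_castSucc] at hv
    simp only [Fin.val_castSucc, Fin.val_last] at hv
    have hw : v (Fin.last k) ≤ (k + 1) * v (Fin.last k) := Nat.le_mul_of_pos_left _ (by omega)
    simp only [Finset.mem_sigma, Finset.mem_range]
    refine ⟨by omega, ?_⟩
    rw [if_pos (by omega), mem_Vset]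
    simp only [Fin.init]
    omega
  · rintro ⟨w, u⟩ hx
    simp only [Finset.mem_sigma, Finset.mem_range] at hx
    obtain ⟨h1, h2⟩ := hx
    split_ifs at h2 with hw
    · rw [mem_Vset] at h2
      rw [mem_Vset, Fin.sum_univ_castSucc]
      simp only [Fin.val_castSucc, Fin.val_last, Fin.snoc_castSucc, Fin.snoc_last]
      omega
    · simp at h2
  · intro v _; simp
  · rintro ⟨w, u⟩ _; simp
  · intro v _; simp

/-- The closed form of the coefficient of `z ^ j` in the fermionic sum. -/
lemma sum_Vset_eq_fermi {K : Type*} [Field K] {q : K} (hq : q ≠ 0) (l r : ℕ) (k : ℕ) :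
    ∀ (N : ℤ) (j : ℕ),
    ∑ v ∈ Vset k j,
        q ^ ((∑ i : Fin k, ∑ i' : Fin k, v i * v i' * min (i.1 + 1) (i'.1 + 1)) +
              ∑ i : Fin k, (i.1 + 1 - l) * v i) *
          ∏ i : Fin k, gaussInt q
            ((N + 1) * (i.1 + 1 : ℤ) - max ((i.1 + 1 : ℤ) - l) 0 - max ((i.1 + 1 : ℤ) - r) 0
              - 2 * ∑ i' : Fin k, (min (i.1 + 1) (i'.1 + 1) : ℤ) * v i') (v i)
      = fermi q k N l r j := by
  induction k with
  | zero =>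
    intro N j
    simp only [Finset.univ_eq_empty, Finset.sum_empty, Finset.prod_empty, add_zero, pow_zero,
      mul_one, fermi]
    by_cases hj : j = 0
    · subst hj
      have : Vset 0 0 = {default} := by
        ext v; simp [mem_Vset, Subsingleton.elim v default]
      rw [this]; simp
    · have : Vset 0 j = ∅ := by
        ext v; simp [mem_Vset, Ne.symm hj]
      rw [this]; simp [hj]
  | succ k ih =>
    intro N j
    rw [sum_Vset_succ, fermi]
    simp only [Int.toNat_natCast]
    refine Finset.sum_congr rfl fun w _ => ?_
    split_ifs with hw
    swap
    · rw [fermi_of_neg, mul_zero]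
      have : ((k + 1 : ℕ) : ℤ) * w > j := by exact_mod_cast not_le.mp hw
      push_cast at this
      omega
    obtain ⟨J, rfl⟩ := Nat.exists_eq_add_of_le hw
    have hJ : ((((k + 1) * w + J : ℕ) : ℤ) - (k + 1 : ℤ) * w) = J := by push_cast; ring
    rw [hJ, ← ih (N - 2 * w) J, Nat.add_sub_cancel_left, Finset.mul_sum]
    refine Finset.sum_congr rfl fun u hu => ?_
    rw [mem_Vset] at hu
    have hu' : ∑ i : Fin k, (i.1 + 1 : ℤ) * u i = J := by exact_mod_cast hu
    rw [Fin.prod_univ_castSucc]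
    simp only [Fin.sum_univ_castSucc, Fin.val_castSucc, Fin.val_last, Fin.snoc_castSucc,
      Fin.snoc_last]
    have m1 : ∀ i : Fin k, min (i.1 + 1) (k + 1) = i.1 + 1 := fun i => by omega
    have m2 : ∀ i : Fin k, min (k + 1) (i.1 + 1) = i.1 + 1 := fun i => by omega
    have m3 : ∀ i : Fin k, min (i.1 + 1 : ℤ) (k + 1) = i.1 + 1 := fun i => by omega
    have m4 : ∀ i : Fin k, min (k + 1 : ℤ) (i.1 + 1) = i.1 + 1 := fun i => by omega
    simp only [m1, m2, m3, m4, min_self, hu']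
    have hexp : ∀ A B : ℕ, q ^ ((k + 1 : ℤ) * w * w + max ((k + 1 : ℤ) - l) 0 * w
        + 2 * (J : ℤ) * w) * q ^ (A + B) =
        q ^ ((A + w * J + (w * J + w * w * (k + 1))) + (B + (k + 1 - l) * w)) := by
      intro A B
      rw [← zpow_natCast q (A + B), ← zpow_natCast q ((A + _ + _) + _), ← zpow_add₀ hq]
      congr 1
      have : max ((k + 1 : ℤ) - l) 0 = ((k + 1 - l : ℕ) : ℤ) := by omega
      rw [this]; push_cast; ring
    have s1 : ∑ i : Fin k, (∑ i' : Fin k, u i * u i' * min (i.1 + 1) (i'.1 + 1)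
        + u i * w * (i.1 + 1)) =
        (∑ i : Fin k, ∑ i' : Fin k, u i * u i' * min (i.1 + 1) (i'.1 + 1)) + w * J := by
      rw [Finset.sum_add_distrib, ← hu, Finset.mul_sum]
      congr 1
      exact Finset.sum_congr rfl fun i _ => by ring
    have s2 : ∑ i : Fin k, w * u i * (i.1 + 1) = w * J := by
      rw [← hu, Finset.mul_sum]
      exact Finset.sum_congr rfl fun i _ => by ring
    rw [s1, s2, ← hexp]
    have gl : (N + 1) * (k + 1 : ℤ) - max ((k + 1 : ℤ) - l) 0 - max ((k + 1 : ℤ) - r) 0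
        - 2 * (((k + 1) * w + J : ℕ) : ℤ) = (N + 1) * (k + 1 : ℤ) - max ((k + 1 : ℤ) - l) 0
          - max ((k + 1 : ℤ) - r) 0 - 2 * ((J : ℤ) + (k + 1 : ℤ) * w) := by
      push_cast; ring
    rw [gl]
    have gi : ∀ i : Fin k, (N - 2 * (w : ℤ) + 1) * (i.1 + 1 : ℤ) - max ((i.1 + 1 : ℤ) - l) 0
          - max ((i.1 + 1 : ℤ) - r) 0 - 2 * ∑ i' : Fin k, (min (i.1 + 1) (i'.1 + 1) : ℤ) * u i'
        = (N + 1) * (i.1 + 1 : ℤ) - max ((i.1 + 1 : ℤ) - l) 0 - max ((i.1 + 1 : ℤ) - r) 0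
          - 2 * (∑ i' : Fin k, (min (i.1 + 1) (i'.1 + 1) : ℤ) * u i' + (i.1 + 1 : ℤ) * w) := by
      intro i; ring
    simp only [gi]
    ring

end ClosedForm

section GaussianBinomial

lemma one_sub_X_pow_mul_geomInv {i : ℕ} (hi : 1 ≤ i) :
    (1 - (PowerSeries.X : PowerSeries ℤ) ^ i) * geomInv i = 1 := by
  ext n
  rw [sub_mul, one_mul, map_sub, PowerSeries.coeff_X_pow_mul', PowerSeries.coeff_one]
  simp only [geomInv, PowerSeries.coeff_mk]
  by_cases hn : n = 0
  · subst hn; simp; omega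
  · rw [if_neg hn]
    by_cases h : i ≤ n
    · obtain ⟨m, rfl⟩ := Nat.exists_eq_add_of_le h
      simp
    · have : ¬ i ∣ n := fun hd => h (Nat.le_of_dvd (Nat.pos_of_ne_zero hn) hd)
      simp [h, this]

lemma qbinom_add_zero (P : ℕ) : qbinom (P + 0) 0 = 1 := by
  have : ∀ n : ℕ, (∏ i ∈ Finset.Icc 1 n, (1 - (PowerSeries.X : PowerSeries ℤ) ^ i)) *
      ∏ i ∈ Finset.Icc 1 n, geomInv i = 1 := by
    intro n
    rw [← Finset.prod_mul_distrib]
    exact Finset.prod_eq_one fun i hi =>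
      one_sub_X_pow_mul_geomInv (Finset.mem_Icc.mp hi).1
  simpa [qbinom] using this P

lemma qbinom_symm (P v : ℕ) : qbinom (P + v) v = qbinom (v + P) P := by
  simp only [qbinom, Nat.add_sub_cancel, Nat.add_comm v P, Nat.add_sub_cancel_left]
  ring

lemma qbinom_succ_succ (P v : ℕ) :
    qbinom (P + 1 + (v + 1)) (v + 1) =
      qbinom (P + (v + 1)) (v + 1) + PowerSeries.X ^ (P + 1) * qbinom (P + 1 + v) v := by
  simp only [qbinom, Nat.add_sub_cancel]
  rw [show P + 1 + v = P + (v + 1) by ring, show P + 1 + (v + 1) = P + (v + 1) + 1 by ring]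
  simp only [Finset.prod_Icc_succ_top (Nat.le_add_left 1 _),
    show P + (v + 1) = P + v + 1 by ring]
  have hP := one_sub_X_pow_mul_geomInv (Nat.le_add_left 1 P)
  have hv := one_sub_X_pow_mul_geomInv (Nat.le_add_left 1 v)
  generalize geomInv (P + 1) = gP at *
  generalize geomInv (v + 1) = gv at *
  generalize (∏ i ∈ Finset.Icc 1 (P + v), (1 - (PowerSeries.X : PowerSeries ℤ) ^ i)) = D
  generalize (∏ i ∈ Finset.Icc 1 P, geomInv i) = GP
  generalize (∏ i ∈ Finset.Icc 1 v, geomInv i) = Gv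
  rw [show (PowerSeries.X : PowerSeries ℤ) ^ (P + v + 1 + 1)
    = PowerSeries.X ^ (P + 1) * PowerSeries.X ^ (v + 1) by ring]
  generalize (PowerSeries.X : PowerSeries ℤ) ^ (P + v + 1) = E
  generalize (PowerSeries.X : PowerSeries ℤ) ^ (v + 1) = x at *
  generalize (PowerSeries.X : PowerSeries ℤ) ^ (P + 1) = y at *
  linear_combination (D * (1 - E) * Gv * GP * gv) * hP
    + (y * D * (1 - E) * Gv * GP * gP) * hv

lemma map_qbinom {K : Type*} [Field K] (φ : PowerSeries ℤ →+* K) (P v : ℕ) :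
    φ (qbinom (P + v) v) = gaussNat (φ PowerSeries.X) P v := by
  induction P generalizing v with
  | zero => rw [qbinom_symm, qbinom_add_zero, gaussNat_zero_left, map_one]
  | succ P ihP =>
    induction v with
    | zero => rw [qbinom_add_zero, gaussNat_zero_right, map_one]
    | succ v ihv =>
      rw [qbinom_succ_succ, map_add, map_mul, map_pow, ihP, ihv, gaussNat]

lemma map_qbinomZ {K : Type*} [Field K] (φ : PowerSeries ℤ →+* K) (P : ℤ) (v : ℕ) :
    φ (qbinomZ (P + v) v) = gaussInt (φ PowerSeries.X) P v := by
  unfold qbinomZ gaussInt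
  by_cases hP : 0 ≤ P
  · obtain ⟨n, rfl⟩ := Int.eq_ofNat_of_zero_le hP
    rw [if_pos ⟨by positivity, by omega⟩, if_pos hP, ← map_qbinom]
    congr 2
  · rw [if_neg (by omega), if_neg hP, map_zero]

end GaussianBinomial

section Chains

/-- Exponent vectors `a` of total degree `J` with `a_t + a_{t+1} ≤ k`, `a_1 ≤ l`, `a_N ≤ r`;
the left boundary condition is encoded by the virtual entry `a_0 = k - l`. -/
def chainSet (N k l r J : ℕ) : Finset (Fin N → ℕ) :=
  (Fintype.piFinset fun _ : Fin N => Finset.range (J + 1)).filter fun a =>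
    (∑ t, a t = J) ∧
    (∀ t : Fin N, Fin.cons (α := fun _ => ℕ) (k - l) a t.castSucc
      + Fin.cons (α := fun _ => ℕ) (k - l) a t.succ ≤ k) ∧
    Fin.cons (α := fun _ => ℕ) (k - l) a (Fin.last N) ≤ r

lemma mem_chainSet {N k l r J : ℕ} {a : Fin N → ℕ} :
    a ∈ chainSet N k l r J ↔ (∑ t, a t = J) ∧
    (∀ t : Fin N, Fin.cons (α := fun _ => ℕ) (k - l) a t.castSucc
      + Fin.cons (α := fun _ => ℕ) (k - l) a t.succ ≤ k) ∧
    Fin.cons (α := fun _ => ℕ) (k - l) a (Fin.last N) ≤ r := by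
  simp only [chainSet, Finset.mem_filter, Fintype.mem_piFinset, Finset.mem_range,
    and_iff_right_iff_imp]
  rintro ⟨rfl, -⟩ t
  exact Nat.lt_succ_of_le (Finset.single_le_sum (fun _ _ => Nat.zero_le _) (Finset.mem_univ t))

lemma snoc_mem_chainSet {N k l r J c : ℕ} (hc : c ≤ k) {a : Fin N → ℕ} :
    Fin.snoc (α := fun _ => ℕ) a c ∈ chainSet (N + 1) k l r J ↔
      c ≤ J ∧ c ≤ r ∧ a ∈ chainSet N k l (k - c) (J - c) := by
  rw [mem_chainSet, mem_chainSet, Fin.cons_snoc_eq_snoc_cons, Fin.forall_fin_succ']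
  simp only [Fin.sum_univ_castSucc, Fin.snoc_castSucc, Fin.snoc_last, ← Fin.castSucc_succ,
    Fin.succ_last]
  constructor
  · rintro ⟨h1, ⟨h2, h3⟩, h4⟩
    exact ⟨by omega, h4, by omega, h2, by omega⟩
  · rintro ⟨h0, h4, h1, h2, h3⟩
    exact ⟨by omega, ⟨h2, by omega⟩, h4⟩

/-- The coefficient of `z ^ J` in the generating function of `chainSet`. -/
def chainSum {R : Type*} [CommRing R] (q : R) (N k l r J : ℕ) : R :=
  ∑ a ∈ chainSet N k l r J, q ^ (∑ t : Fin N, (t.1 + 1) * a t)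

variable {R : Type*} [CommRing R] (q : R)

lemma sum_chainSet_last_eq {N k l r J c : ℕ} (hc : c ≤ k) (hr : c ≤ r) :
    ∑ a ∈ chainSet (N + 1) k l r J with a (Fin.last N) = c, q ^ (∑ t, (t.1 + 1) * a t) =
      if c ≤ J then q ^ ((N + 1) * c) * chainSum q N k l (k - c) (J - c) else 0 := by
  have key : ∀ a ∈ (chainSet (N + 1) k l r J).filter (fun a => a (Fin.last N) = c),
      Fin.snoc (α := fun _ => ℕ) (Fin.init a) c = a ∧ c ≤ J ∧
        Fin.init a ∈ chainSet N k l (k - c) (J - c) := by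
    intro a ha
    obtain ⟨ha, hlast⟩ := Finset.mem_filter.mp ha
    have e : Fin.snoc (α := fun _ => ℕ) (Fin.init a) c = a := by
      rw [← hlast, Fin.snoc_init_self]
    have h := (snoc_mem_chainSet hc).mp (e.symm ▸ ha)
    exact ⟨e, h.1, h.2.2⟩
  split_ifs with hJ
  · rw [chainSum, Finset.mul_sum]
    refine Finset.sum_bij' (fun a _ => Fin.init a)
      (fun a _ => Fin.snoc (α := fun _ => ℕ) a c) ?_ ?_ ?_ ?_ ?_
    · intro a ha
      exact (key a ha).2.2
    · intro a ha
      exact Finset.mem_filter.mpr ⟨(snoc_mem_chainSet hc).mpr ⟨hJ, hr, ha⟩, by simp⟩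
    · intro a ha
      exact (key a ha).1
    · intro a _; simp
    · intro a ha
      rw [← pow_add, Fin.sum_univ_castSucc, (Finset.mem_filter.mp ha).2]
      simp [Fin.init, add_comm]
  · exact Finset.sum_eq_zero fun a ha => absurd (key a ha).2.1 hJ

lemma last_le_of_mem_chainSet {N k l r J : ℕ} {a : Fin (N + 1) → ℕ}
    (ha : a ∈ chainSet (N + 1) k l r J) : a (Fin.last N) ≤ r := by
  have := (mem_chainSet.mp ha).2.2
  rwa [← Fin.succ_last, Fin.cons_succ] at this

lemma chainSum_succ_zero (N k l J : ℕ) :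
    chainSum q (N + 1) k l 0 J = chainSum q N k l k J := by
  have := sum_chainSet_last_eq q (N := N) (k := k) (l := l) (J := J) (Nat.zero_le k) le_rfl
  rw [Finset.filter_true_of_mem fun a ha => Nat.le_zero.mp (last_le_of_mem_chainSet ha)] at this
  rw [chainSum]
  simpa using this

lemma chainSum_succ_succ {N k l r J : ℕ} (hr : r + 1 ≤ k) :
    chainSum q (N + 1) k l (r + 1) J = chainSum q (N + 1) k l r J +
      if r + 1 ≤ J then q ^ ((N + 1) * (r + 1)) *
        chainSum q N k l (k - (r + 1)) (J - (r + 1)) else 0 := by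
  rw [← sum_chainSet_last_eq q hr le_rfl, chainSum,
    ← Finset.sum_filter_add_sum_filter_not _ (fun a => a (Fin.last N) = r + 1), add_comm]
  congr 1
  refine Finset.sum_congr ?_ fun _ _ => rfl
  ext a
  simp only [Finset.mem_filter, mem_chainSet, ← Fin.succ_last, Fin.cons_succ]
  constructor
  · rintro ⟨⟨h1, h2, h3⟩, h4⟩; exact ⟨h1, h2, by omega⟩
  · rintro ⟨h1, h2, h3⟩; exact ⟨⟨h1, h2, by omega⟩, by omega⟩

end Chains

section FermionicRecursion

variable {K : Type*} [Field K] {q : K}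

lemma chainSum_zero_eq_fermi {k l r : ℕ} (hk : 1 ≤ k) (hl : l ≤ k) (hr : r ≤ k) (J : ℕ) :
    chainSum q 0 k l r J = fermi q k (0 : ℕ) l r J := by
  rcases Nat.eq_zero_or_pos J with rfl | hJ
  · by_cases h : k ≤ l + r
    · have : chainSet 0 k l r 0 = {default} := by
        ext a
        rw [mem_chainSet, Finset.mem_singleton]
        simp [Subsingleton.elim a default]
        omega
      rw [chainSum, this]
      simp only [Finset.sum_singleton, Finset.univ_eq_empty, Finset.sum_empty, pow_zero]
      refine (fermi_zero_eq_one q k (by omega) fun i hi => ?_).symm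
      push_cast
      omega
    · have : chainSet 0 k l r 0 = ∅ := by
        ext a
        rw [mem_chainSet]
        simp
        omega
      rw [chainSum, this, Finset.sum_empty]
      refine (fermi_eq_zero_of_vacancy_neg q hk ?_).symm
      push_cast
      omega
  · have : chainSet 0 k l r J = ∅ := by
      ext a
      rw [mem_chainSet]
      simp
      omega
    rw [chainSum, this, Finset.sum_empty]
    exact (fermi_eq_zero_of_nonpos q k _ _ (by simp) (by omega)).symm

/-- The fermionic sum counts the integer points of `chainSet`. -/
theorem chainSum_eq_fermi (hq : q ≠ 0) {k l : ℕ} (hk : 1 ≤ k) (hl : l ≤ k) (N : ℕ) :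
    ∀ {r : ℕ} (J : ℕ), r ≤ k → chainSum q N k l r J = fermi q k N l r J := by
  induction N with
  | zero => exact fun J hr => chainSum_zero_eq_fermi hk hl hr J
  | succ N ih =>
    intro r
    induction r with
    | zero =>
      intro J _
      have h := fermiRec hq k (Int.natCast_nonneg l) ((N + 1 : ℕ) : ℤ) 0 J (by omega) le_rfl
        (by omega)
      rw [FermiRec, fermi_neg_right q k _ _ _ (by omega : (0 : ℤ) - 1 < 0)] at h
      rw [chainSum_succ_zero, ih J le_rfl, Nat.cast_zero, h]
      simp
    | succ r ihr =>
      intro J hr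
      have h := fermiRec hq k (Int.natCast_nonneg l) ((N + 1 : ℕ) : ℤ) ((r + 1 : ℕ) : ℤ) J
        (by omega) (by omega) (by omega)
      rw [FermiRec] at h
      rw [chainSum_succ_succ q hr, ihr J (by omega), h]
      congr 1
      · congr 1; push_cast; ring
      · split_ifs with hJ
        · rw [ih (J - (r + 1)) (Nat.sub_le _ _), Nat.cast_sub hr, Nat.cast_sub hJ, ← zpow_natCast]
          push_cast
          ring_nf
        · rw [fermi_of_neg q k _ _ _ (by omega), mul_zero]

end FermionicRecursion

section Assembly

/-- The generating function of `chainSet` equals the `z ^ j` coefficient of the fermionic sum. -/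
theorem chainSum_X_eq (N k l r j : ℕ) (hk : 1 ≤ k) (hl : l ≤ k) (hr : r ≤ k) :
    chainSum (PowerSeries.X : PowerSeries ℤ) N k l r j =
      ∑ v ∈ Vset k j,
        (PowerSeries.X : PowerSeries ℤ) ^
            ((∑ i : Fin k, ∑ i' : Fin k, v i * v i' * min (i.1 + 1) (i'.1 + 1)) +
              ∑ i : Fin k, (i.1 + 1 - l) * v i) *
          ∏ i : Fin k,
            qbinomZ
              ((N + 1 : ℤ) * (i.1 + 1) -
                (2 * (∑ i' : Fin k, (min (i.1 + 1) (i'.1 + 1) : ℤ) * v i') +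
                  max ((i.1 + 1 : ℤ) - l) 0 + max ((i.1 + 1 : ℤ) - r) 0 - v i))
              (v i) := by
  set φ := algebraMap (PowerSeries ℤ) (FractionRing (PowerSeries ℤ)) with hφ
  have hinj : Function.Injective φ := IsFractionRing.injective _ _
  have hq : φ PowerSeries.X ≠ 0 := by
    rw [Ne, map_eq_zero_iff φ hinj]
    exact PowerSeries.X_ne_zero
  apply hinj
  have h1 : φ (chainSum (PowerSeries.X : PowerSeries ℤ) N k l r j) =
      chainSum (φ PowerSeries.X) N k l r j := by
    simp [chainSum]
  rw [h1, chainSum_eq_fermi hq hk hl N j hr, ← sum_Vset_eq_fermi hq, map_sum]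
  refine Finset.sum_congr rfl fun v _ => ?_
  rw [map_mul, map_pow, map_prod]
  congr 1
  refine Finset.prod_congr rfl fun i _ => ?_
  rw [← map_qbinomZ]
  congr 2
  ring

lemma coeff_chainSum_X (N k l r j i : ℕ) :
    PowerSeries.coeff i (chainSum (PowerSeries.X : PowerSeries ℤ) N k l r j) =
      ((chainSet N k l r j).filter fun a => ∑ t : Fin N, (t.1 + 1) * a t = i).card := by
  rw [chainSum, map_sum, Finset.card_filter, Nat.cast_sum]
  refine Finset.sum_congr rfl fun a _ => ?_
  rw [PowerSeries.coeff_X_pow]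
  simp [eq_comm]

end Assembly

section Spanning

lemma mem_chainSet_succ {M k l r J : ℕ} (hl : l ≤ k) {a : Fin (M + 1) → ℕ} :
    a ∈ chainSet (M + 1) k l r J ↔ (∑ t, a t = J) ∧ a 0 ≤ l ∧
      (∀ t : Fin M, a t.castSucc + a t.succ ≤ k) ∧ a (Fin.last M) ≤ r := by
  rw [mem_chainSet, Fin.forall_fin_succ, ← Fin.succ_last]
  simp only [Fin.cons_succ, Fin.castSucc_zero, Fin.cons_zero, ← Fin.succ_castSucc]
  have : k - l + a 0 ≤ k ↔ a 0 ≤ l := by omega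
  rw [this, and_assoc]

/-- The class of the monomial with exponent vector `a`. -/
def monD (N k l r : ℕ) (a : Fin N → ℕ) : Dspace N k l r :=
  Ideal.Quotient.mk (IdealN N k l r) (∏ t : Fin N, X t ^ a t)

lemma monD_eq_prod (N k l r : ℕ) (a : Fin N → ℕ) :
    monD N k l r a = ∏ t, Ideal.Quotient.mk (IdealN N k l r) (X t) ^ a t := by
  simp [monD]

lemma monD_add (N k l r : ℕ) (a b : Fin N → ℕ) :
    monD N k l r (a + b) = monD N k l r a * monD N k l r b := by
  simp only [monD_eq_prod, Pi.add_apply, pow_add, Finset.prod_mul_distrib]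

lemma X_first_pow_eq_zero (M k l r : ℕ) :
    Ideal.Quotient.mk (IdealN (M + 1) k l r) (X 0) ^ (l + 1) = 0 := by
  rw [← map_pow, Ideal.Quotient.eq_zero_iff_mem]
  exact Ideal.subset_span (Or.inl (Or.inl ⟨M.succ_pos, rfl⟩))

lemma X_last_pow_eq_zero (M k l r : ℕ) :
    Ideal.Quotient.mk (IdealN (M + 1) k l r) (X (Fin.last M)) ^ (r + 1) = 0 := by
  rw [← map_pow, Ideal.Quotient.eq_zero_iff_mem]
  exact Ideal.subset_span (Or.inl (Or.inr ⟨M.succ_pos, rfl⟩))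

lemma sum_prod_X_eq_zero (N k l r : ℕ) {d : ℕ} (h1 : k + 1 ≤ d) (h2 : d ≤ N * (k + 1)) :
    ∑ α ∈ Finset.univ.filter (fun α : Fin (k + 1) → Fin N => (∑ j, ((α j).1 + 1)) = d),
      ∏ j, Ideal.Quotient.mk (IdealN N k l r) (X (α j)) = 0 := by
  simp only [← map_prod, ← map_sum]
  rw [Ideal.Quotient.eq_zero_iff_mem]
  exact Ideal.subset_span (Or.inr ⟨d, h1, h2, rfl⟩)

lemma monD_eq_zero_of_lt {N k l r m : ℕ} {t : Fin N} {a : Fin N → ℕ}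
    (h : Ideal.Quotient.mk (IdealN N k l r) (X t) ^ m = 0) (hm : m ≤ a t) :
    monD N k l r a = 0 := by
  rw [monD_eq_prod]
  exact Finset.prod_eq_zero (Finset.mem_univ t) (pow_eq_zero_of_le hm h)

/-- The number of times each value is taken by `α`. -/
def fiberCard {ι : Type*} [Fintype ι] {N : ℕ} (α : ι → Fin N) (u : Fin N) : ℕ :=
  (Finset.univ.filter fun j => α j = u).card

lemma sum_mul_fiberCard {ι : Type*} [Fintype ι] {N : ℕ} (f : Fin N → ℕ) (α : ι → Fin N) :
    ∑ u, f u * fiberCard α u = ∑ j, f (α j) := by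
  rw [← Finset.sum_fiberwise (s := Finset.univ) (g := α)]
  refine Finset.sum_congr rfl fun u _ => ?_
  rw [Finset.sum_congr rfl (g := fun _ => f u), Finset.sum_const, smul_eq_mul, mul_comm, fiberCard]
  intro j hj
  rw [(Finset.mem_filter.mp hj).2]

lemma monD_fiberCard {ι : Type*} [Fintype ι] (N k l r : ℕ) (α : ι → Fin N) :
    monD N k l r (fiberCard α) = ∏ j, Ideal.Quotient.mk (IdealN N k l r) (X (α j)) := by
  rw [monD_eq_prod, ← Finset.prod_fiberwise (s := Finset.univ) (g := α)]
  refine Finset.prod_congr rfl fun u _ => ?_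
  rw [Finset.prod_congr rfl (g := fun _ => Ideal.Quotient.mk (IdealN N k l r) (X u)),
    Finset.prod_const, fiberCard]
  intro j hj
  rw [(Finset.mem_filter.mp hj).2]

/-- Convexity: spreading out `b` copies of `τ` and `c` copies of `τ + 1` increases the sum of
squares. -/
lemma sum_sq_lt_of_sum_eq {ι : Type*} [Fintype ι] {b c τ : ℕ} (hcard : Fintype.card ι = b + c)
    {x : ι → ℕ} (hsum : ∑ j, x j = b * τ + c * (τ + 1))
    (hx : ¬ ∀ j, x j = τ ∨ x j = τ + 1) :
    b * τ ^ 2 + c * (τ + 1) ^ 2 < ∑ j, x j ^ 2 := by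
  zify at hsum ⊢
  have hpos : ∀ j, 0 ≤ ((x j : ℤ) - τ) * ((x j : ℤ) - (τ + 1)) := by
    intro j
    rcases le_or_gt (x j : ℤ) τ with h | h
    · nlinarith
    · exact mul_nonneg (by omega) (by omega)
  have hlt : 0 < ∑ j, ((x j : ℤ) - τ) * ((x j : ℤ) - (τ + 1)) := by
    push Not at hx
    obtain ⟨j, hj1, hj2⟩ := hx
    refine Finset.sum_pos' (fun j _ => hpos j) ⟨j, Finset.mem_univ j, ?_⟩
    refine lt_of_le_of_ne (hpos j) (Ne.symm (mul_ne_zero ?_ ?_)) <;> omega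
  have e : ∑ j, ((x j : ℤ) - τ) * ((x j : ℤ) - (τ + 1)) =
      ∑ j, (x j : ℤ) ^ 2 - (2 * τ + 1) * ∑ j, (x j : ℤ) + (b + c) * (τ * (τ + 1)) := by
    have : ((b : ℤ) + c) * (τ * (τ + 1)) = ∑ _j : ι, ((τ : ℤ) * (τ + 1)) := by
      rw [Finset.sum_const, Finset.card_univ, hcard]; simp
    rw [this, Finset.mul_sum, ← Finset.sum_sub_distrib, ← Finset.sum_add_distrib]
    exact Finset.sum_congr rfl fun j _ => by ring
  rw [e, hsum] at hlt
  linarith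

lemma prod_two_values {ι A : Type*} [Fintype ι] [CommMonoid A] {M b c : ℕ}
    (hcard : Fintype.card ι = b + c) (t : Fin M) {α : ι → Fin (M + 1)}
    (hsum : ∑ j, ((α j).1 + 1) = b * (t.1 + 1) + c * (t.1 + 1 + 1))
    (hα : ∀ j, (α j).1 + 1 = t.1 + 1 ∨ (α j).1 + 1 = t.1 + 1 + 1) (f : Fin (M + 1) → A) :
    ∏ j, f (α j) = f t.castSucc ^ b * f t.succ ^ c := by
  let y : ι → ℕ := fun j => (α j).1 - t.1
  have hy : ∑ j, (α j).1 + ∑ _j : ι, 1 = ∑ j, y j + ∑ _j : ι, (t.1 + 1) := by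
    rw [← Finset.sum_add_distrib, ← Finset.sum_add_distrib]
    refine Finset.sum_congr rfl fun j _ => ?_
    have := hα j
    simp only [y]; omega
  rw [← Finset.sum_add_distrib, hsum, Finset.sum_const, Finset.card_univ, hcard, smul_eq_mul] at hy
  have hc : ∑ j, y j = c := by linarith
  have hb : ∑ j, (1 - y j) = b := by
    have : ∑ j, (1 - y j) + ∑ j, y j = ∑ _j : ι, 1 := by
      rw [← Finset.sum_add_distrib]
      refine Finset.sum_congr rfl fun j _ => ?_
      have := hα j
      simp only [y]; omega
    rw [hc, Finset.sum_const, Finset.card_univ, hcard] at this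
    simpa using this
  rw [← hb, ← hc, ← Finset.prod_pow_eq_pow_sum, ← Finset.prod_pow_eq_pow_sum,
    ← Finset.prod_mul_distrib]
  refine Finset.prod_congr rfl fun j _ => ?_
  rcases hα j with h | h
  · have h1 : α j = t.castSucc := Fin.ext (by simpa using h)
    simp [y, h1]
  · have h1 : α j = t.succ := Fin.ext (by simpa using h)
    simp [y, h1]

lemma exists_two_values {M b c k : ℕ} (hk : b + c = k) (t : Fin M) :
    ∃ α : Fin k → Fin (M + 1),
      (∑ j, ((α j).1 + 1)) = b * (t.1 + 1) + c * (t.1 + 1 + 1) ∧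
      ∀ j, (α j).1 + 1 = t.1 + 1 ∨ (α j).1 + 1 = t.1 + 1 + 1 := by
  subst hk
  refine ⟨Fin.append (fun _ => t.castSucc) (fun _ => t.succ), ?_, ?_⟩
  · rw [Fin.sum_univ_add]
    simp
  · intro j
    induction j using Fin.addCases <;> simp

/-- Admissible monomials span: rewriting step. -/
lemma monD_mem_span_of_adjacent {M k l r : ℕ} {a : Fin (M + 1) → ℕ} {t : Fin M}
    (ht : k < a t.castSucc + a t.succ) (S : Submodule ℂ (Dspace (M + 1) k l r))
    (hS : ∀ a' : Fin (M + 1) → ℕ, ∑ u, a' u = ∑ u, a u →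
      ∑ u, (u.1 + 1) * a' u = ∑ u, (u.1 + 1) * a u →
      ∑ u, (u.1 + 1) ^ 2 * a u < ∑ u, (u.1 + 1) ^ 2 * a' u → monD (M + 1) k l r a' ∈ S) :
    monD (M + 1) k l r a ∈ S := by
  obtain ⟨b, c, hbc, hb, hc⟩ : ∃ b c, b + c = k + 1 ∧ b ≤ a t.castSucc ∧ c ≤ a t.succ :=
    ⟨min (a t.castSucc) (k + 1), k + 1 - min (a t.castSucc) (k + 1), by omega, by omega, by omega⟩
  have hne : t.castSucc ≠ t.succ := (Fin.castSucc_lt_succ).ne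
  let p : Fin (M + 1) → ℕ := Pi.single t.castSucc b + Pi.single t.succ c
  let a₀ : Fin (M + 1) → ℕ := a - p
  have ha : a = a₀ + p := by
    refine (tsub_add_cancel_of_le fun u => ?_).symm
    by_cases h1 : u = t.castSucc
    · subst h1; simpa [p, hne] using hb
    · by_cases h2 : u = t.succ
      · subst h2; simpa [p, hne.symm] using hc
      · simp [p, h1, h2]
  have hsump : ∀ f : Fin (M + 1) → ℕ, ∑ u, f u * p u = b * f t.castSucc + c * f t.succ := by
    intro f
    simp [p, mul_add, Finset.sum_add_distrib, Pi.single_apply, mul_comm]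
  have hmonp : monD (M + 1) k l r p =
      Ideal.Quotient.mk (IdealN (M + 1) k l r) (X t.castSucc) ^ b *
        Ideal.Quotient.mk (IdealN (M + 1) k l r) (X t.succ) ^ c := by
    rw [show p = Pi.single t.castSucc b + Pi.single t.succ c from rfl, monD_add,
      monD_eq_prod, monD_eq_prod]
    congr 1 <;> simp [Pi.single_apply, pow_ite]
  set d := b * (t.1 + 1) + c * (t.1 + 1 + 1) with hd
  have hd1 : k + 1 ≤ d := by rw [hd, ← hbc]; nlinarith
  have hd2 : d ≤ (M + 1) * (k + 1) := by
    rw [hd, ← hbc]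
    have := t.2
    nlinarith [Nat.mul_le_mul_left b (by omega : t.1 + 1 ≤ M + 1),
      Nat.mul_le_mul_left c (by omega : t.1 + 1 + 1 ≤ M + 1)]
  have hrel := sum_prod_X_eq_zero (M + 1) k l r hd1 hd2
  rw [← Finset.sum_filter_add_sum_filter_not _
    (fun α : Fin (k + 1) → Fin (M + 1) =>
      ∀ j, (α j).1 + 1 = t.1 + 1 ∨ (α j).1 + 1 = t.1 + 1 + 1)] at hrel
  have hcard : Fintype.card (Fin (k + 1)) = b + c := by rw [Fintype.card_fin, hbc]
  rw [Finset.sum_congr rfl (g := fun _ => monD (M + 1) k l r p), Finset.sum_const] at hrel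
  swap
  · intro α hα
    obtain ⟨h1, h2⟩ := Finset.mem_filter.mp hα
    rw [hmonp]
    exact prod_two_values hcard t (Finset.mem_filter.mp h1).2 h2
      fun u => Ideal.Quotient.mk (IdealN (M + 1) k l r) (X u)
  set n := Finset.card _ with hn
  have hn0 : n ≠ 0 := by
    obtain ⟨α, h1, h2⟩ := exists_two_values hbc t
    exact Finset.card_ne_zero_of_mem
      (Finset.mem_filter.mpr ⟨Finset.mem_filter.mpr ⟨Finset.mem_univ α, h1⟩, h2⟩)
  have hmem : (n : ℂ) • monD (M + 1) k l r a ∈ S := by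
    have h := congrArg (monD (M + 1) k l r a₀ * ·) hrel
    simp only [mul_add, mul_zero, mul_smul_comm, ← monD_add, ← ha] at h
    rw [Nat.cast_smul_eq_nsmul, eq_neg_of_add_eq_zero_left h]
    refine S.neg_mem ?_
    rw [Finset.mul_sum]
    refine S.sum_mem fun α hα => ?_
    obtain ⟨h1, h2⟩ := Finset.mem_filter.mp hα
    replace h1 := (Finset.mem_filter.mp h1).2
    rw [← monD_fiberCard, ← monD_add]
    have key : ∀ f : Fin (M + 1) → ℕ, ∑ u, f u * (a₀ + fiberCard α) u =
        ∑ u, f u * a₀ u + ∑ j, f (α j) := by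
      intro f
      rw [← sum_mul_fiberCard]
      simp [mul_add, Finset.sum_add_distrib]
    have key' : ∀ f : Fin (M + 1) → ℕ, ∑ u, f u * a u =
        ∑ u, f u * a₀ u + (b * f t.castSucc + c * f t.succ) := by
      intro f
      rw [← hsump]
      conv_lhs => rw [ha]
      simp [mul_add, Finset.sum_add_distrib]
    refine hS _ ?_ ?_ ?_
    · have e1 := key 1
      have e2 := key' 1
      simp only [Pi.one_apply, one_mul, mul_one, Finset.sum_const, Finset.card_univ, hcard,
        smul_eq_mul] at e1 e2
      rw [e1, e2]
    · rw [key, key', h1]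
      simp [hd]
    · rw [key, key' (fun u => (u.1 + 1) ^ 2)]
      exact Nat.add_lt_add_left
        (sum_sq_lt_of_sum_eq hcard (x := fun j => (α j).1 + 1) h1 h2) _
  rwa [Submodule.smul_mem_iff S (Nat.cast_ne_zero.mpr hn0)] at hmem

/-- The exponent vectors indexing a basis of the component of bidegree `(i, j)`. -/
def basisSet (N k l r i j : ℕ) : Finset (Fin N → ℕ) :=
  (chainSet N k l r j).filter fun a => ∑ t : Fin N, (t.1 + 1) * a t = i

lemma monD_mem_span_basisSet {M k l r i j : ℕ} (hl : l ≤ k) (m : ℕ) :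
    ∀ a : Fin (M + 1) → ℕ, ∑ u, (u.1 + 1) * a u = i → ∑ u, a u = j →
      (M + 1) ^ 2 * j - ∑ u, (u.1 + 1) ^ 2 * a u = m →
      monD (M + 1) k l r a ∈
        Submodule.span ℂ (monD (M + 1) k l r '' (basisSet (M + 1) k l r i j)) := by
  induction m using Nat.strong_induction_on with
  | _ m ih =>
  intro a hi hj hm
  by_cases hA : a ∈ basisSet (M + 1) k l r i j
  · exact Submodule.subset_span ⟨a, hA, rfl⟩
  rw [basisSet, Finset.mem_filter, mem_chainSet_succ hl] at hA
  by_cases h0 : a 0 ≤ l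
  swap
  · rw [monD_eq_zero_of_lt (X_first_pow_eq_zero M k l r) (by omega)]
    exact Submodule.zero_mem _
  by_cases hlast : a (Fin.last M) ≤ r
  swap
  · rw [monD_eq_zero_of_lt (X_last_pow_eq_zero M k l r) (by omega)]
    exact Submodule.zero_mem _
  obtain ⟨t, ht⟩ : ∃ t : Fin M, k < a t.castSucc + a t.succ := by
    by_contra! h
    exact hA ⟨⟨hj, h0, h, hlast⟩, hi⟩
  refine monD_mem_span_of_adjacent ht _ fun a' h1 h2 h3 => ?_
  refine ih _ ?_ a' (h2.trans hi) (h1.trans hj) rfl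
  have hle : ∑ u, (u.1 + 1) ^ 2 * a' u ≤ (M + 1) ^ 2 * j := by
    rw [← hj, ← h1, Finset.mul_sum]
    refine Finset.sum_le_sum fun u _ => Nat.mul_le_mul_right _ (Nat.pow_le_pow_left ?_ 2)
    have := u.2
    omega
  omega

lemma Dcomp_eq_span_basisSet {M k l r i j : ℕ} (hl : l ≤ k) :
    Dcomp (M + 1) k l r i j =
      Submodule.span ℂ (monD (M + 1) k l r '' (basisSet (M + 1) k l r i j)) := by
  refine le_antisymm (Submodule.span_le.mpr ?_) (Submodule.span_mono ?_)
  · rintro x ⟨a, h1, h2, rfl⟩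
    exact monD_mem_span_basisSet hl _ a h1 h2 rfl
  · rintro x ⟨a, ha, rfl⟩
    rw [Finset.mem_coe, basisSet, Finset.mem_filter, mem_chainSet] at ha
    exact ⟨a, ha.2, ha.1.1, rfl⟩

end Spanning

section Fermionic

variable {P : Type*}

variable (P) in
/-- The ideal making the variables `Y (p, p')` behave as products of fermions `ξ p * η p'`. -/
def fermionIdeal : Ideal (MvPolynomial (P × P) ℂ) :=
  Ideal.span {g | ∃ p p' q q' : P, g = X (p, p') * X (q, q') + X (p, q') * X (q, p')}

/-- A sum of `m` commuting square-zero elements has vanishing `m + 1`-st power. -/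
lemma sum_pow_eq_zero_of_sq_eq_zero {ι A : Type*} [CommRing A] (S : Finset ι) (f : ι → A)
    (hf : ∀ x ∈ S, f x ^ 2 = 0) {n : ℕ} (hn : S.card ≤ n) : (∑ x ∈ S, f x) ^ (n + 1) = 0 := by
  classical
  refine pow_eq_zero_of_le (Nat.succ_le_succ hn) ?_
  clear hn
  induction S using Finset.induction_on with
  | empty => simp
  | insert x S hx ih =>
    rw [Finset.sum_insert hx, Finset.card_insert_of_notMem hx]
    refine (Commute.all _ _).add_pow_eq_zero_of_add_le_succ_of_pow_eq_zero
      (hf x (Finset.mem_insert_self x S))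
      (ih fun y hy => hf y (Finset.mem_insert_of_mem hy)) ?_
    omega

/-- The class of `Y (p, p')` modulo `fermionIdeal`. -/
def fermionPair (x : P × P) : MvPolynomial (P × P) ℂ ⧸ fermionIdeal P :=
  Ideal.Quotient.mk _ (X x)

lemma fermionPair_mul (p p' q q' : P) :
    fermionPair (p, p') * fermionPair (q, q') = -(fermionPair (p, q') * fermionPair (q, p')) := by
  rw [eq_neg_iff_add_eq_zero]
  simp only [fermionPair, ← map_mul, ← map_add]
  exact Ideal.Quotient.eq_zero_iff_mem.mpr (Ideal.subset_span ⟨p, p', q, q', rfl⟩)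

lemma eq_zero_of_eq_neg {A : Type*} [CommRing A] [Algebra ℂ A] {x : A} (h : x = -x) : x = 0 := by
  have h2 : (2 : ℂ) • x = 0 := by
    rw [two_smul]
    nth_rewrite 1 [h]
    simp
  have : x = (2 : ℂ)⁻¹ • ((2 : ℂ) • x) := by rw [smul_smul]; norm_num
  rw [this, h2, smul_zero]

lemma fermionPair_sq (p : P) : fermionPair (p, p) ^ 2 = 0 := by
  rw [sq]
  exact eq_zero_of_eq_neg (fermionPair_mul p p p p)

/-- The generating polynomial of the pairs of fermions in one slot squares to zero. -/
lemma slot_sum_sq_eq_zero {A : Type*} [CommRing A] [Algebra ℂ A] {y : P × P → A}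
    (hy : ∀ p p' q q', y (p, p') * y (q, q') = -(y (p, q') * y (q, p')))
    (S : Finset P) (e : P → P → ℕ)
    (he : ∀ p ∈ S, ∀ p' ∈ S, ∀ q ∈ S, ∀ q' ∈ S, e p p' + e q q' = e p q' + e q p') :
    (∑ p ∈ S, ∑ p' ∈ S, Polynomial.monomial (e p p') (y (p, p'))) ^ 2 = 0 := by
  rw [sq]
  apply eq_zero_of_eq_neg
  simp only [Finset.sum_mul_sum, ← Finset.sum_neg_distrib]
  refine Finset.sum_congr rfl fun p hp => Finset.sum_congr rfl fun q hq => ?_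
  conv_rhs => rw [Finset.sum_comm]
  refine Finset.sum_congr rfl fun p' hp' => Finset.sum_congr rfl fun q' hq' => ?_
  rw [Polynomial.monomial_mul_monomial, Polynomial.monomial_mul_monomial, hy,
    he p hp p' hp' q hq q' hq', map_neg]

variable [Fintype P]

/-- The current `E_t = ∑ y (p, p')`, over pairs in a common slot with `e p p' = t`. -/
def currentOf {A : Type*} [AddCommMonoid A] (s : P → ℕ) (e : P → P → ℕ) (y : P × P → A)
    (t : ℕ) : A :=
  ∑ x : P × P with s x.1 = s x.2 ∧ e x.1 x.2 = t, y x

/-- The current with polynomial variables as coefficients. -/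
def current (s : P → ℕ) (e : P → P → ℕ) (t : ℕ) : MvPolynomial (P × P) ℂ :=
  currentOf s e X t

variable {s : P → ℕ} {e : P → P → ℕ}

lemma mk_current (t : ℕ) :
    Ideal.Quotient.mk (fermionIdeal P) (current s e t) = currentOf s e fermionPair t := by
  simp only [current, currentOf, map_sum, fermionPair]

lemma sum_slots_eq_sum_currents {A : Type*} [CommRing A] (y : P × P → A) {k N : ℕ}
    (hs : ∀ p, s p < k) (heN : ∀ p p', s p = s p' → 1 ≤ e p p' ∧ e p p' ≤ N) :
    ∑ σ ∈ Finset.range k, ∑ p with s p = σ, ∑ p' with s p' = σ,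
        Polynomial.monomial (e p p') (y (p, p')) =
      ∑ t : Fin N, Polynomial.monomial (t.1 + 1) (currentOf s e y (t.1 + 1)) := by
  trans ∑ x : P × P with s x.1 = s x.2, Polynomial.monomial (e x.1 x.2) (y x)
  · rw [← Finset.sum_fiberwise_of_maps_to (t := Finset.range k) (g := fun x : P × P => s x.1)
      (fun x _ => Finset.mem_range.mpr (hs x.1))]
    refine Finset.sum_congr rfl fun σ _ => ?_
    rw [Finset.sum_sigma', Finset.filter_filter]
    refine Finset.sum_bij' (fun x _ => (x.1, x.2)) (fun x _ => ⟨x.1, x.2⟩) ?_ ?_ ?_ ?_ ?_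
    · rintro ⟨p, p'⟩ hx
      simp only [Finset.mem_sigma, Finset.mem_filter, Finset.mem_univ, true_and] at hx ⊢
      exact ⟨hx.1.trans hx.2.symm, hx.1⟩
    · rintro ⟨p, p'⟩ hx
      simp only [Finset.mem_sigma, Finset.mem_filter, Finset.mem_univ, true_and] at hx ⊢
      exact ⟨hx.2, hx.1.symm.trans hx.2⟩
    · intros; rfl
    · intros; rfl
    · intros; rfl
  · rw [← Finset.sum_fiberwise_of_maps_to (t := Finset.range N)
      (g := fun x : P × P => e x.1 x.2 - 1) (fun x hx => Finset.mem_range.mpr (by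
        have := heN x.1 x.2 (Finset.mem_filter.mp hx).2
        omega)),
      ← Fin.sum_univ_eq_sum_range (fun n => ∑ x ∈ Finset.univ.filter
        (fun x : P × P => s x.1 = s x.2) with e x.1 x.2 - 1 = n,
          Polynomial.monomial (e x.1 x.2) (y x))]
    refine Finset.sum_congr rfl fun t _ => ?_
    rw [currentOf, map_sum, Finset.filter_filter]
    refine Finset.sum_congr (Finset.filter_congr fun x _ => and_congr_right fun hx => ?_)
      fun x hx => ?_
    · have := heN x.1 x.2 hx
      omega
    · rw [(Finset.mem_filter.mp hx).2.2]

/-- Currents built from anticommuting pairs satisfy the defining relations. -/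
lemma sum_prod_currentOf_eq_zero {A : Type*} [CommRing A] [Algebra ℂ A] {y : P × P → A}
    (hy : ∀ p p' q q', y (p, p') * y (q, q') = -(y (p, q') * y (q, p')))
    {k N : ℕ} (hs : ∀ p, s p < k)
    (heN : ∀ p p', s p = s p' → 1 ≤ e p p' ∧ e p p' ≤ N)
    (he : ∀ p p' q q', s p = s p' → s p' = s q → s q = s q' →
      e p p' + e q q' = e p q' + e q p') (d : ℕ) :
    ∑ α ∈ Finset.univ.filter
        (fun α : Fin (k + 1) → Fin N => (∑ j, ((α j).1 + 1)) = d),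
        ∏ j, currentOf s e y ((α j).1 + 1) = 0 := by
  have h0 : (∑ σ ∈ Finset.range k, ∑ p with s p = σ, ∑ p' with s p' = σ,
      Polynomial.monomial (e p p') (y (p, p'))) ^ (k + 1) = 0 := by
    refine sum_pow_eq_zero_of_sq_eq_zero _ _ (fun σ _ => ?_) (Finset.card_range k).le
    refine slot_sum_sq_eq_zero hy _ e fun p hp p' hp' q hq q' hq' => ?_
    simp only [Finset.mem_filter, Finset.mem_univ, true_and] at hp hp' hq hq'
    exact he p p' q q' (hp.trans hp'.symm) (hp'.trans hq.symm) (hq.trans hq'.symm)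
  rw [sum_slots_eq_sum_currents y hs heN, Fintype.sum_pow] at h0
  have h1 := congrArg (fun F => Polynomial.coeff F d) h0
  have hm : ∀ α : Fin (k + 1) → Fin N, ∏ j, Polynomial.monomial ((α j).1 + 1)
      (currentOf s e y ((α j).1 + 1)) =
      Polynomial.monomial (∑ j, ((α j).1 + 1)) (∏ j, currentOf s e y ((α j).1 + 1)) := by
    intro α
    simp only [← Polynomial.C_mul_X_pow_eq_monomial]
    rw [Finset.prod_mul_distrib, Finset.prod_pow_eq_pow_sum, map_prod]
  simp only [hm, Polynomial.finsetSum_coeff, Polynomial.coeff_monomial, Polynomial.coeff_zero]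
    at h1
  rw [← Finset.sum_filter] at h1
  exact h1

/-- The currents satisfy the defining relations modulo `fermionIdeal`. -/
lemma sum_prod_current_eq_zero {k N : ℕ} (hs : ∀ p, s p < k)
    (heN : ∀ p p', s p = s p' → 1 ≤ e p p' ∧ e p p' ≤ N)
    (he : ∀ p p' q q', s p = s p' → s p' = s q → s q = s q' →
      e p p' + e q q' = e p q' + e q p') (d : ℕ) :
    Ideal.Quotient.mk (fermionIdeal P)
      (∑ α ∈ Finset.univ.filter
        (fun α : Fin (k + 1) → Fin N => (∑ j, ((α j).1 + 1)) = d),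
        ∏ j, current s e ((α j).1 + 1)) = 0 := by
  simp only [map_sum, map_prod, mk_current]
  exact sum_prod_currentOf_eq_zero fermionPair_mul hs heN he d

/-- A current supported on at most `n` diagonal pairs has vanishing `n + 1`-st power. -/
lemma current_pow_eq_zero {t n : ℕ}
    (hdiag : ∀ p p', s p = s p' → e p p' = t → p = p')
    (hn : (Finset.univ.filter fun p => e p p = t).card ≤ n) :
    Ideal.Quotient.mk (fermionIdeal P) (current s e t ^ (n + 1)) = 0 := by
  rw [map_pow, mk_current, currentOf]
  refine sum_pow_eq_zero_of_sq_eq_zero _ _ (fun x hx => ?_) (le_trans ?_ hn)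
  · obtain ⟨-, h1, h2⟩ := Finset.mem_filter.mp hx
    obtain ⟨p, p'⟩ := x
    obtain rfl := hdiag p p' h1 h2
    exact fermionPair_sq p
  · refine Finset.card_le_card_of_injOn Prod.fst ?_ ?_
    · rintro ⟨p, p'⟩ hx
      obtain ⟨-, h1, h2⟩ := Finset.mem_filter.mp (Finset.mem_coe.mp hx)
      obtain rfl := hdiag p p' h1 h2
      simpa using h2
    · rintro ⟨p, p'⟩ hx ⟨q, q'⟩ hy hxy
      obtain ⟨-, h1, h2⟩ := Finset.mem_filter.mp (Finset.mem_coe.mp hx)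
      obtain ⟨-, h3, h4⟩ := Finset.mem_filter.mp (Finset.mem_coe.mp hy)
      obtain rfl := hdiag p p' h1 h2
      obtain rfl := hdiag q q' h3 h4
      obtain rfl : p = q := hxy
      rfl

variable [DecidableEq P]

/-- The exponent of the monomial `∏ p, Y (p, ρ p)`. -/
def permExponent (ρ : Equiv.Perm P) : (P × P) →₀ ℕ :=
  Finsupp.equivFunOnFinite.symm fun x => if ρ x.1 = x.2 then 1 else 0

lemma permExponent_apply (ρ : Equiv.Perm P) (p p' : P) :
    permExponent ρ (p, p') = if ρ p = p' then 1 else 0 := rfl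

/-- The alternating sum of the coefficients of the monomials `∏ p, Y (p, ρ p)`. -/
def altCoeff (F : MvPolynomial (P × P) ℂ) : ℂ :=
  ∑ ρ : Equiv.Perm P, ((Equiv.Perm.sign ρ : ℤ) : ℂ) * coeff (permExponent ρ) F

lemma eq_of_add_eq_permExponent {ρ : Equiv.Perm P} {m : (P × P) →₀ ℕ} {p p' q q' : P}
    (h : m + Finsupp.single (p, p') 1 + Finsupp.single (q, q') 1 = permExponent ρ) :
    ρ p = p' ∧ ρ q = q' ∧ p ≠ q := by
  have h1 := DFunLike.congr_fun h (p, p')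
  have h2 := DFunLike.congr_fun h (q, q')
  simp only [Finsupp.add_apply, Finsupp.single_eq_same, permExponent_apply] at h1 h2
  have e1 : ρ p = p' := by
    by_contra hne
    rw [if_neg hne] at h1
    omega
  have e2 : ρ q = q' := by
    by_contra hne
    rw [if_neg hne] at h2
    omega
  refine ⟨e1, e2, ?_⟩
  rintro rfl
  obtain rfl := e1.symm.trans e2
  rw [if_pos e1, Finsupp.single_eq_same] at h1
  omega

lemma add_eq_permExponent_swap {ρ : Equiv.Perm P} {m : (P × P) →₀ ℕ} {p p' q q' : P}
    (h : m + Finsupp.single (p, p') 1 + Finsupp.single (q, q') 1 = permExponent ρ) :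
    m + Finsupp.single (p, q') 1 + Finsupp.single (q, p') 1 =
      permExponent (Equiv.swap p' q' * ρ) := by
  obtain ⟨rfl, rfl, hne⟩ := eq_of_add_eq_permExponent h
  ext ⟨x, y⟩
  have hxy := DFunLike.congr_fun h (x, y)
  simp only [Finsupp.add_apply, permExponent_apply, Finsupp.single_apply, Prod.mk.injEq,
    Equiv.Perm.mul_apply] at hxy ⊢
  by_cases hx : p = x
  · subst hx
    simp only [true_and, hne.symm, false_and, if_false, add_zero, Equiv.swap_apply_left] at hxy ⊢
    omega
  · by_cases hx' : q = x
    · subst hx'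
      simp only [true_and, hne, false_and, if_false, add_zero, Equiv.swap_apply_right] at hxy ⊢
      omega
    · have e := Equiv.swap_apply_of_ne_of_ne (ρ.injective.ne (Ne.symm hx))
        (ρ.injective.ne (Ne.symm hx'))
      simpa [hx, hx', e] using hxy

lemma altCoeff_monomial (m : (P × P) →₀ ℕ) (c : ℂ) :
    altCoeff (monomial m c) =
      ∑ ρ : Equiv.Perm P, ((Equiv.Perm.sign ρ : ℤ) : ℂ) * if m = permExponent ρ then c else 0 := by
  simp [altCoeff, coeff_monomial]

lemma altCoeff_add (F G : MvPolynomial (P × P) ℂ) :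
    altCoeff (F + G) = altCoeff F + altCoeff G := by
  simp [altCoeff, mul_add, Finset.sum_add_distrib]

lemma altCoeff_monomial_mul (m : (P × P) →₀ ℕ) (c : ℂ) (p p' q q' : P) :
    altCoeff (monomial m c * (X (p, p') * X (q, q') + X (p, q') * X (q, p'))) = 0 := by
  have e : ∀ x y : P × P, monomial m c * (X x * X y) =
      monomial (m + Finsupp.single x 1 + Finsupp.single y 1) c := by
    intro x y
    rw [X, X, monomial_mul, monomial_mul, mul_one, mul_one, add_assoc]
  rw [mul_add, e, e, altCoeff_add, altCoeff_monomial, altCoeff_monomial]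
  by_cases hpq : p' = q'
  · have h0 : ∀ x y : P, ∑ ρ : Equiv.Perm P, ((Equiv.Perm.sign ρ : ℤ) : ℂ) *
        (if m + Finsupp.single (x, q') 1 + Finsupp.single (y, q') 1 = permExponent ρ
          then c else 0) = 0 := by
      intro x y
      refine Finset.sum_eq_zero fun ρ _ => ?_
      rw [if_neg, mul_zero]
      intro h
      obtain ⟨h1, h2, h3⟩ := eq_of_add_eq_permExponent h
      exact h3 (ρ.injective (h1.trans h2.symm))
    subst hpq
    rw [h0, add_zero]
  · rw [← Equiv.sum_comp (Equiv.mulLeft (Equiv.swap p' q'))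
      (fun ρ => ((Equiv.Perm.sign ρ : ℤ) : ℂ) *
        if m + Finsupp.single (p, q') 1 + Finsupp.single (q, p') 1 = permExponent ρ
          then c else 0), ← Finset.sum_add_distrib]
    refine Finset.sum_eq_zero fun ρ _ => ?_
    have hiff : m + Finsupp.single (p, q') 1 + Finsupp.single (q, p') 1 =
        permExponent (Equiv.swap p' q' * ρ) ↔
        m + Finsupp.single (p, p') 1 + Finsupp.single (q, q') 1 = permExponent ρ := by
      refine ⟨fun h => ?_, add_eq_permExponent_swap⟩
      have := add_eq_permExponent_swap h
      rwa [← mul_assoc, Equiv.swap_comm q' p', Equiv.swap_mul_self, one_mul] at this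
    simp only [Equiv.coe_mulLeft, hiff, Equiv.Perm.sign_mul, Equiv.Perm.sign_swap hpq]
    push_cast
    ring

lemma altCoeff_eq_zero_of_mem {F : MvPolynomial (P × P) ℂ} (hF : F ∈ fermionIdeal P) :
    altCoeff F = 0 := by
  suffices h : ∀ G, altCoeff (G * F) = 0 by simpa using h 1
  refine Submodule.span_induction (p := fun F _ => ∀ G, altCoeff (G * F) = 0)
    ?_ ?_ ?_ ?_ hF
  · rintro _ ⟨p, p', q, q', rfl⟩ G
    induction G using MvPolynomial.induction_on' with
    | monomial m c => exact altCoeff_monomial_mul m c p p' q q'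
    | add G₁ G₂ h₁ h₂ => rw [add_mul, altCoeff_add, h₁, h₂, add_zero]
  · intro G; simp [altCoeff]
  · intro F₁ F₂ _ _ h₁ h₂ G
    rw [mul_add, altCoeff_add, h₁, h₂, add_zero]
  · intro H F _ h G
    rw [smul_eq_mul, ← mul_assoc, h]

lemma weight_permExponent (w : P × P → ℕ) (ρ : Equiv.Perm P) :
    Finsupp.weight w (permExponent ρ) = ∑ p, w (p, ρ p) := by
  rw [Finsupp.weight_apply, Finsupp.sum_fintype _ _ (by simp), Fintype.sum_prod_type]
  refine Finset.sum_congr rfl fun p _ => ?_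
  simp [permExponent_apply]

lemma sum_weight_eq_of_coeff_ne_zero {N : ℕ} {a : Fin N → ℕ} {ρ : Equiv.Perm P}
    (h : coeff (permExponent ρ) (∏ t : Fin N, current s e (t.1 + 1) ^ a t) ≠ 0)
    {w : P × P → ℕ} {g : Fin N → ℕ}
    (hw : ∀ x : P × P, s x.1 = s x.2 → ∀ t : Fin N, e x.1 x.2 = t.1 + 1 → w x = g t) :
    ∑ p, w (p, ρ p) = ∑ t, a t * g t := by
  have hhom : IsWeightedHomogeneous w (∏ t : Fin N, current s e (t.1 + 1) ^ a t)
      (∑ t, a t * g t) := by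
    refine IsWeightedHomogeneous.prod _ _ _ fun t _ => ?_
    rw [← smul_eq_mul]
    refine IsWeightedHomogeneous.pow ?_ _
    refine IsWeightedHomogeneous.sum _ _ _ fun x hx => ?_
    obtain ⟨-, h1, h2⟩ := Finset.mem_filter.mp hx
    rw [← hw x h1 t h2]
    exact isWeightedHomogeneous_X _ _ _
  rw [← weight_permExponent]
  exact hhom h

lemma coeff_prod_current_diag_ne_zero :
    coeff (permExponent 1) (∏ p : P, current s e (e p p)) ≠ 0 := by
  simp only [current, currentOf]
  rw [Finset.prod_univ_sum, coeff_sum]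
  have hm : ∀ g : P → P × P, ∏ p, (X (g p) : MvPolynomial (P × P) ℂ) =
      monomial (∑ p, Finsupp.single (g p) 1) 1 := by
    intro g
    simp only [X]
    rw [monomial_sum_one]
  simp only [hm, coeff_monomial]
  rw [Finset.sum_boole, Nat.cast_ne_zero]
  refine Finset.card_ne_zero_of_mem (a := fun p => (p, p)) ?_
  rw [Finset.mem_filter, Fintype.mem_piFinset]
  refine ⟨by simp, ?_⟩
  ext ⟨x, y⟩
  have h1 : permExponent 1 (x, y) = if x = y then 1 else 0 := rfl
  rw [Finsupp.finsetSum_apply, h1]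
  simp only [Finsupp.single_apply, Prod.mk.injEq]
  by_cases hxy : x = y
  · subst hxy; simp
  · rw [if_neg hxy]
    refine Finset.sum_eq_zero fun p _ => if_neg ?_
    rintro ⟨rfl, rfl⟩
    exact hxy rfl

end Fermionic

section Rearrangement

variable {P : Type*} [Fintype P]

/-- Rearrangement inequality inside the classes of `s`, with an explicit defect. -/
lemma sum_mul_perm_le_of_slots (s f g : P → ℤ)
    (hfg : ∀ p q, s p = s q → f p < f q → g p ≤ g q) (ρ : Equiv.Perm P)
    (hρ : ∀ p, s (ρ p) = s p) :
    ∑ p, f p * g (ρ p) ≤ ∑ p, f p * g p := by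
  classical
  set B : ℤ := 2 * ∑ p, |f p| + 2 * ∑ p, |g p| with hB
  have hf : ∀ p, |f p| ≤ ∑ p, |f p| := fun p =>
    Finset.single_le_sum (f := fun p => |f p|) (fun _ _ => abs_nonneg _) (Finset.mem_univ p)
  have hg : ∀ p, |g p| ≤ ∑ p, |g p| := fun p =>
    Finset.single_le_sum (f := fun p => |g p|) (fun _ _ => abs_nonneg _) (Finset.mem_univ p)
  have hf0 : 0 ≤ ∑ p, |f p| := Finset.sum_nonneg fun _ _ => abs_nonneg _
  have hg0 : 0 ≤ ∑ p, |g p| := Finset.sum_nonneg fun _ _ => abs_nonneg _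
  have hmono : Monovary (fun p => f p + B * s p) (fun p => g p + B * s p) := by
    intro p q hpq
    have hfp := abs_le.mp (hf p)
    have hfq := abs_le.mp (hf q)
    have hgp := abs_le.mp (hg p)
    have hgq := abs_le.mp (hg q)
    simp only at hpq ⊢
    rcases lt_trichotomy (s p) (s q) with h | h | h
    · nlinarith
    · rw [h] at hpq ⊢
      by_contra! hlt
      have := hfg q p h.symm (by linarith)
      linarith
    · nlinarith
  have h := hmono.sum_mul_comp_perm_le_sum_mul (σ := ρ)
  have e1 : ∀ p, (f p + B * s p) * (g (ρ p) + B * s (ρ p)) =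
      f p * g (ρ p) + B * (s (ρ p) * g (ρ p)) + (B * (s p * f p) + B ^ 2 * s p ^ 2) := by
    intro p; rw [hρ]; ring
  have e2 : ∀ p, (f p + B * s p) * (g p + B * s p) =
      f p * g p + B * (s p * g p) + (B * (s p * f p) + B ^ 2 * s p ^ 2) := by
    intro p; ring
  simp only [e1, e2, Finset.sum_add_distrib] at h
  have e3 : ∑ p, B * (s (ρ p) * g (ρ p)) = ∑ p, B * (s p * g p) :=
    Equiv.sum_comp ρ fun p => B * (s p * g p)
  rw [e3] at h
  linarith

/-- If `i` grows at least twice as fast as `h` inside each class, then permuting `i - h` inside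
the classes does not increase the sum of the squares of `i`; the defect is explicit. -/
lemma sum_sq_perm_le_of_slots (s h i : P → ℤ)
    (hi : ∀ p q, s p = s q → h p < h q → i p + 2 * (h q - h p) ≤ i q) (ρ : Equiv.Perm P)
    (hρ : ∀ p, s (ρ p) = s p) :
    ∑ p, (h p + i (ρ p) - h (ρ p)) ^ 2 + ∑ p, (h p - h (ρ p)) ^ 2 ≤ ∑ p, i p ^ 2 := by
  have h1 := sum_mul_perm_le_of_slots s h (fun p => i p - 2 * h p)
    (fun p q hs hlt => by have := hi p q hs hlt; linarith) ρ hρ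
  have e1 : ∀ p, (h p + i (ρ p) - h (ρ p)) ^ 2 + (h p - h (ρ p)) ^ 2 =
      2 * (h p * (i (ρ p) - 2 * h (ρ p))) + 2 * h p ^ 2
        + (i (ρ p) ^ 2 - 2 * i (ρ p) * h (ρ p) + 2 * h (ρ p) ^ 2) := by
    intro p; ring
  have e2 : ∀ p, i p ^ 2 = 2 * (h p * (i p - 2 * h p)) + 2 * h p ^ 2
        + (i p ^ 2 - 2 * i p * h p + 2 * h p ^ 2) := by
    intro p; ring
  rw [← Finset.sum_add_distrib, Finset.sum_congr rfl fun p _ => e1 p,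
    Finset.sum_congr rfl fun p _ => e2 p]
  simp only [Finset.sum_add_distrib, ← Finset.mul_sum] at h1 ⊢
  have e3 : ∑ p, (i (ρ p) ^ 2 - 2 * i (ρ p) * h (ρ p) + 2 * h (ρ p) ^ 2) =
      ∑ p, (i p ^ 2 - 2 * i p * h p + 2 * h p ^ 2) :=
    Equiv.sum_comp ρ fun p => i p ^ 2 - 2 * i p * h p + 2 * h p ^ 2
  simp only [Finset.sum_add_distrib, Finset.sum_sub_distrib, ← Finset.mul_sum] at e3 ⊢
  linarith

end Rearrangement

section Particles

variable {N : ℕ} (a : Fin N → ℕ)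

/-- Partial sums of `a`, extended by zero. -/
def prefixSum (n : ℕ) : ℕ :=
  ∑ i ∈ Finset.range n, if h : i < N then a ⟨i, h⟩ else 0

lemma prefixSum_succ (t : Fin N) : prefixSum a (t.1 + 1) = prefixSum a t.1 + a t := by
  rw [prefixSum, Finset.sum_range_succ, dif_pos t.2]
  rfl

lemma prefixSum_mono : Monotone (prefixSum a) := fun _ _ h =>
  Finset.sum_le_sum_of_subset (Finset.range_mono h)

lemma prefixSum_add_two_le {M k : ℕ} {a : Fin (M + 1) → ℕ}
    (hadj : ∀ t : Fin M, a t.castSucc + a t.succ ≤ k) (hlast : a (Fin.last M) ≤ k) (n : ℕ) :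
    prefixSum a (n + 2) ≤ prefixSum a n + k := by
  rw [prefixSum, Finset.sum_range_succ, Finset.sum_range_succ, ← prefixSum, add_assoc]
  refine Nat.add_le_add_left ?_ _
  rcases lt_trichotomy n M with h | h | h
  · rw [dif_pos (by omega), dif_pos (by omega)]
    exact hadj ⟨n, h⟩
  · subst h
    rw [dif_pos (by omega), dif_neg (by omega)]
    exact hlast
  · rw [dif_neg (by omega), dif_neg (by omega)]
    exact Nat.zero_le _

/-- One particle for each unit of each exponent. -/
abbrev Particle : Type := Σ t : Fin N, Fin (a t)

variable {a}

/-- The position of a particle when they are listed in increasing order. -/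
def position (p : Particle a) : ℕ := prefixSum a p.1 + p.2

lemma position_lt (p : Particle a) : position p < prefixSum a (p.1.1 + 1) := by
  rw [prefixSum_succ]
  exact Nat.add_lt_add_left p.2.2 _

lemma position_injective : Function.Injective (position (a := a)) := by
  have key : ∀ p q : Particle a, position p = position q → p.1 ≤ q.1 := by
    intro p q h
    by_contra! hlt
    have h1 := position_lt q
    have h2 : prefixSum a (q.1.1 + 1) ≤ prefixSum a p.1.1 := prefixSum_mono a hlt
    rw [position] at h
    omega
  intro p q h
  have h1 := le_antisymm (key p q h) (key q p h.symm)
  obtain ⟨t, c⟩ := p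
  obtain ⟨t', c'⟩ := q
  obtain rfl : t = t' := h1
  have : c = c' := Fin.ext (by simpa [position] using h)
  rw [this]

lemma add_two_mul_le_of_position {k d : ℕ} (h2 : ∀ n, prefixSum a (n + 2) ≤ prefixSum a n + k)
    {p q : Particle a} (h : position p + k * d ≤ position q) : p.1.1 + 2 * d ≤ q.1.1 := by
  have hd : ∀ d n, prefixSum a (n + 2 * d) ≤ prefixSum a n + k * d := by
    intro d
    induction d with
    | zero => intro n; simp
    | succ d ih =>
      intro n
      have e1 := ih n
      have e2 := h2 (n + 2 * d)
      rw [show n + 2 * (d + 1) = n + 2 * d + 2 by ring, mul_add, mul_one]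
      omega
  by_contra! hlt
  have e1 := position_lt q
  have e2 := prefixSum_mono a hlt
  have e3 := hd d p.1.1
  have e4 : prefixSum a p.1.1 ≤ position p := Nat.le_add_right _ _
  rw [Nat.succ_eq_add_one] at e2
  omega

/-- The slot of a particle. -/
def slot (k : ℕ) (p : Particle a) : ℕ := position p % k

/-- The number of particles preceding a particle in its slot. -/
def height (k : ℕ) (p : Particle a) : ℕ := position p / k

/-- The energy of the pair of fermions attached to two particles. -/
def energy (k : ℕ) (p p' : Particle a) : ℕ := height k p + (p'.1.1 + 1) - height k p'

lemma energy_self (k : ℕ) (p : Particle a) : energy k p p = p.1.1 + 1 := by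
  simp [energy]

section

variable {k : ℕ} (h2 : ∀ n, prefixSum a (n + 2) ≤ prefixSum a n + k) {p q : Particle a}

include h2 in
lemma add_two_mul_le_of_height (hs : slot k p = slot k q) (hh : height k p ≤ height k q) :
    p.1.1 + 2 * (height k q - height k p) ≤ q.1.1 := by
  apply add_two_mul_le_of_position h2
  rw [← Nat.mod_add_div (position p) k, ← Nat.mod_add_div (position q) k]
  change slot k p + k * height k p + _ ≤ slot k q + k * height k q
  rw [hs, add_assoc, ← mul_add, Nat.add_sub_cancel' hh]

lemma eq_of_slot_eq_of_height_eq (hs : slot k p = slot k q) (hh : height k p = height k q) :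
    p = q := by
  apply position_injective
  rw [← Nat.mod_add_div (position p) k, ← Nat.mod_add_div (position q) k]
  change slot k p + k * height k p = slot k q + k * height k q
  rw [hs, hh]

include h2 in
lemma energy_add_height (hs : slot k p = slot k q) :
    energy k p q + height k q = height k p + (q.1.1 + 1) := by
  rw [energy]
  rcases le_total (height k p) (height k q) with h | h
  · have := add_two_mul_le_of_height h2 hs h
    omega
  · omega

include h2 in
lemma energy_bounds (hs : slot k p = slot k q) : 1 ≤ energy k p q ∧ energy k p q ≤ N := by
  have e := energy_add_height h2 hs
  have hp := p.1.2
  have hq := q.1.2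
  rcases le_total (height k p) (height k q) with h | h
  · have := add_two_mul_le_of_height h2 hs h
    omega
  · have := add_two_mul_le_of_height h2 hs.symm h
    omega

include h2 in
lemma eq_of_energy_extreme (hs : slot k p = slot k q)
    (he : energy k p q = 1 ∨ energy k p q = N) : p = q := by
  refine eq_of_slot_eq_of_height_eq hs ?_
  have e := energy_add_height h2 hs
  have hp := p.1.2
  have hq := q.1.2
  rcases le_total (height k p) (height k q) with h | h
  · have := add_two_mul_le_of_height h2 hs h
    omega
  · have := add_two_mul_le_of_height h2 hs.symm h
    omega

end

lemma sum_particles (f : ℕ → ℕ) :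
    ∑ p : Particle a, f p.1.1 = ∑ t : Fin N, a t * f t.1 := by
  rw [Fintype.sum_sigma]
  simp

lemma card_filter_energy_self (k : ℕ) (t : Fin N) :
    (Finset.univ.filter fun p : Particle a => energy k p p = t.1 + 1).card = a t := by
  simp only [energy_self, Nat.add_right_cancel_iff]
  rw [Finset.card_filter, sum_particles fun n => if n = t.1 then 1 else 0]
  simp [Fin.val_inj]

variable (a) in
/-- The linear functional dual to the monomial with exponent vector `a`. -/
def dualFunctional (k : ℕ) (F : MvPolynomial (Fin N) ℂ) : ℂ :=
  altCoeff (aeval (fun t : Fin N => current (slot (a := a) k) (energy k) (t.1 + 1)) F)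

lemma dualFunctional_sum_smul {ι : Type*} (S : Finset ι) (g : ι → ℂ)
    (F : ι → MvPolynomial (Fin N) ℂ) (k : ℕ) :
    dualFunctional a k (∑ i ∈ S, g i • F i) = ∑ i ∈ S, g i * dualFunctional a k (F i) := by
  simp only [dualFunctional, altCoeff, map_sum, map_smul, coeff_sum, coeff_smul, smul_eq_mul,
    Finset.mul_sum]
  rw [Finset.sum_comm]
  exact Finset.sum_congr rfl fun _ _ => Finset.sum_congr rfl fun _ _ => by ring

lemma dualFunctional_monomial (k : ℕ) (a' : Fin N → ℕ) :
    dualFunctional a k (∏ t, X t ^ a' t) =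
      altCoeff (∏ t : Fin N, current (slot (a := a) k) (energy k) (t.1 + 1) ^ a' t) := by
  simp [dualFunctional]

lemma dualFunctional_eq_zero_of_mem {M k l r J : ℕ} (hk : 1 ≤ k) (hl : l ≤ k) (hr : r ≤ k)
    {a : Fin (M + 1) → ℕ} (ha : a ∈ chainSet (M + 1) k l r J)
    {F : MvPolynomial (Fin (M + 1)) ℂ} (hF : F ∈ IdealN (M + 1) k l r) :
    dualFunctional a k F = 0 := by
  rw [mem_chainSet_succ hl] at ha
  obtain ⟨-, h0, hadj, hlast⟩ := ha
  have h2 := prefixSum_add_two_le hadj (hlast.trans hr)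
  apply altCoeff_eq_zero_of_mem
  suffices h : IdealN (M + 1) k l r ≤ (fermionIdeal (Particle a)).comap
      (aeval (fun t : Fin (M + 1) => current (slot (a := a) k) (energy k) (t.1 + 1))) from h hF
  rw [IdealN, Ideal.span_le]
  rintro G ((⟨_, rfl⟩ | ⟨_, rfl⟩) | ⟨d, -, -, rfl⟩)
  · rw [SetLike.mem_coe, Ideal.mem_comap, map_pow, aeval_X, ← Ideal.Quotient.eq_zero_iff_mem]
    refine current_pow_eq_zero (fun p p' hs he => eq_of_energy_extreme h2 hs (Or.inl he)) ?_
    exact (card_filter_energy_self k 0).le.trans h0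
  · rw [SetLike.mem_coe, Ideal.mem_comap, map_pow, aeval_X, ← Ideal.Quotient.eq_zero_iff_mem]
    refine current_pow_eq_zero (fun p p' hs he => eq_of_energy_extreme h2 hs (Or.inr he)) ?_
    exact (card_filter_energy_self k (Fin.last M)).le.trans hlast
  · have e : aeval (fun t : Fin (M + 1) => current (slot (a := a) k) (energy k) (t.1 + 1))
        (∑ α ∈ Finset.univ.filter
          (fun α : Fin (k + 1) → Fin (M + 1) => (∑ j, ((α j).1 + 1)) = d),
          ∏ j, (X (α j) : MvPolynomial (Fin (M + 1)) ℂ)) =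
        ∑ α ∈ Finset.univ.filter
          (fun α : Fin (k + 1) → Fin (M + 1) => (∑ j, ((α j).1 + 1)) = d),
          ∏ j, current (slot k) (energy k) ((α j).1 + 1) := by
      simp only [map_sum, map_prod, aeval_X]
    rw [SetLike.mem_coe, Ideal.mem_comap, e, ← Ideal.Quotient.eq_zero_iff_mem]
    have hlt : ∀ p : Particle a, slot k p < k := fun p => Nat.mod_lt _ hk
    refine sum_prod_current_eq_zero (s := slot (a := a) k) (e := energy k) (k := k) (N := M + 1)
      hlt (fun p p' hs => energy_bounds h2 hs) (fun p p' q q' h1 h3 h4 => ?_) d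
    have e1 := energy_add_height h2 h1
    have e2 := energy_add_height h2 h4
    have e3 := energy_add_height h2 (h1.trans (h3.trans h4))
    have e4 := energy_add_height h2 h3.symm
    omega

section

variable {k : ℕ} (h2 : ∀ n, prefixSum a (n + 2) ≤ prefixSum a n + k) {a' : Fin N → ℕ}
  {ρ : Equiv.Perm (Particle a)}
  (hρ : coeff (permExponent ρ)
    (∏ t : Fin N, current (slot (a := a) k) (energy k) (t.1 + 1) ^ a' t) ≠ 0)

include hρ in
lemma slot_perm_eq (p : Particle a) : slot k (ρ p) = slot k p := by
  have h := sum_weight_eq_of_coeff_ne_zero hρ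
    (w := fun x => if slot k x.1 = slot k x.2 then 0 else 1) (g := 0)
    (fun x hx _ _ => if_pos hx)
  simp only [Pi.zero_apply, mul_zero, Finset.sum_const_zero, Finset.sum_eq_zero_iff,
    Finset.mem_univ, true_imp_iff] at h
  by_contra hne
  have := h p
  rw [if_neg (Ne.symm hne)] at this
  exact one_ne_zero this

include h2 hρ in
lemma weight_add_defect_le :
    (∑ t, a' t * (t.1 + 1) ^ 2 : ℕ) + ∑ p, ((height k p : ℤ) - height k (ρ p)) ^ 2 ≤
      (∑ t, a t * (t.1 + 1) ^ 2 : ℕ) := by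
  have hs := slot_perm_eq hρ
  have h := sum_weight_eq_of_coeff_ne_zero hρ
    (w := fun x => energy k x.1 x.2 ^ 2) (g := fun t => (t.1 + 1) ^ 2)
    (fun x _ t ht => by rw [ht])
  have hle := sum_sq_perm_le_of_slots (fun p : Particle a => (slot k p : ℤ))
    (fun p => (height k p : ℤ)) (fun p => (p.1.1 + 1 : ℤ)) (fun p q h1 h3 => by
      have := add_two_mul_le_of_height h2 (Int.natCast_inj.mp h1) (Int.ofNat_lt.mp h3).le
      omega) ρ (fun p => by rw [hs p])
  rw [← h, ← sum_particles fun n => (n + 1) ^ 2]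
  push_cast
  refine le_trans (le_of_eq ?_) hle
  congr 1
  refine Finset.sum_congr rfl fun p _ => ?_
  have := energy_add_height h2 (hs p).symm
  have e : (energy k p (ρ p) : ℤ) = height k p + ((ρ p).1.1 + 1) - height k (ρ p) := by omega
  rw [e]

include h2 hρ in
lemma perm_eq_one (hw : ∑ t, a t * (t.1 + 1) ^ 2 ≤ ∑ t, a' t * (t.1 + 1) ^ 2) : ρ = 1 := by
  have h := weight_add_defect_le h2 hρ
  have hsum : ∑ p, ((height k p : ℤ) - height k (ρ p)) ^ 2 = 0 := by
    refine le_antisymm ?_ (Finset.sum_nonneg fun _ _ => sq_nonneg _)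
    zify at hw
    push_cast at h
    linarith
  rw [Finset.sum_eq_zero_iff_of_nonneg fun _ _ => sq_nonneg _] at hsum
  ext1 p
  have hp := pow_eq_zero_iff (two_ne_zero) |>.mp (hsum p (Finset.mem_univ p))
  have hh : height k (ρ p) = height k p := by omega
  exact eq_of_slot_eq_of_height_eq (slot_perm_eq hρ p) hh

end

lemma exists_coeff_ne_zero {k : ℕ} {a' : Fin N → ℕ}
    (h : dualFunctional a k (∏ t, X t ^ a' t) ≠ 0) :
    ∃ ρ : Equiv.Perm (Particle a), coeff (permExponent ρ)
      (∏ t : Fin N, current (slot (a := a) k) (energy k) (t.1 + 1) ^ a' t) ≠ 0 := by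
  rw [dualFunctional_monomial] at h
  obtain ⟨ρ, -, hρ⟩ := Finset.exists_ne_zero_of_sum_ne_zero h
  exact ⟨ρ, right_ne_zero_of_mul hρ⟩

lemma eq_or_weight_lt {k : ℕ} (h2 : ∀ n, prefixSum a (n + 2) ≤ prefixSum a n + k)
    {a' : Fin N → ℕ} (h : dualFunctional a k (∏ t, X t ^ a' t) ≠ 0) :
    a' = a ∨ ∑ t, a' t * (t.1 + 1) ^ 2 < ∑ t, a t * (t.1 + 1) ^ 2 := by
  obtain ⟨ρ, hρ⟩ := exists_coeff_ne_zero h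
  refine or_iff_not_imp_right.mpr fun hw => ?_
  obtain rfl := perm_eq_one h2 hρ (not_lt.mp hw)
  ext t
  have hsum : ∑ p : Particle a, (if energy k p p = t.1 + 1 then 1 else 0) =
      ∑ u, a' u * (if u = t then 1 else 0) := sum_weight_eq_of_coeff_ne_zero hρ
    (w := fun x => if energy k x.1 x.2 = t.1 + 1 then 1 else 0)
    (g := fun u => if u = t then 1 else 0)
    (fun x _ u hu => by simp [hu, Fin.ext_iff])
  rw [← Finset.card_filter, card_filter_energy_self] at hsum
  simpa using hsum.symm

lemma dualFunctional_self_ne_zero {k : ℕ} (h2 : ∀ n, prefixSum a (n + 2) ≤ prefixSum a n + k) :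
    dualFunctional a k (∏ t, X t ^ a t) ≠ 0 := by
  rw [dualFunctional_monomial, altCoeff, Finset.sum_eq_single 1]
  · have : ∏ t : Fin N, current (slot (a := a) k) (energy k) (t.1 + 1) ^ a t =
        ∏ p : Particle a, current (slot k) (energy k) (energy k p p) := by
      simp only [energy_self]
      rw [Fintype.prod_sigma]
      simp
    rw [this]
    simpa using coeff_prod_current_diag_ne_zero
  · intro ρ _ hne
    by_contra h
    exact hne (perm_eq_one h2 (right_ne_zero_of_mul h) le_rfl)
  · simp

end Particles

section Basis

lemma linearIndependent_monD {M k l r i j : ℕ} (hk : 1 ≤ k) (hl : l ≤ k) (hr : r ≤ k) :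
    LinearIndependent ℂ
      (fun a : (basisSet (M + 1) k l r i j) => monD (M + 1) k l r a.1) := by
  rw [Fintype.linearIndependent_iff]
  intro g hg
  have hchain : ∀ a : (basisSet (M + 1) k l r i j), a.1 ∈ chainSet (M + 1) k l r j :=
    fun a => (Finset.mem_filter.mp a.2).1
  have hmem : ∑ a : (basisSet (M + 1) k l r i j), g a • ∏ t, (X t : MvPolynomial _ ℂ) ^ a.1 t ∈
      IdealN (M + 1) k l r := by
    rw [← Ideal.Quotient.eq_zero_iff_mem, map_sum, ← hg]
    rfl
  suffices h : ∀ (m : ℕ) (a : (basisSet (M + 1) k l r i j)),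
      ∑ t, a.1 t * (t.1 + 1) ^ 2 = m → g a = 0 from fun a => h _ a rfl
  intro m
  induction m using Nat.strong_induction_on with
  | _ m ih =>
  intro a ham
  have h2 : ∀ n, prefixSum a.1 (n + 2) ≤ prefixSum a.1 n + k := by
    obtain ⟨-, -, hadj, hlast⟩ := (mem_chainSet_succ hl).mp (hchain a)
    exact prefixSum_add_two_le hadj (hlast.trans hr)
  have h := dualFunctional_eq_zero_of_mem hk hl hr (hchain a) hmem
  rw [dualFunctional_sum_smul, Finset.sum_eq_single a] at h
  · exact (mul_eq_zero.mp h).resolve_right (dualFunctional_self_ne_zero h2)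
  · intro a' _ hne
    by_contra hcon
    rcases eq_or_weight_lt h2 (right_ne_zero_of_mul hcon) with h' | h'
    · exact hne (Subtype.ext h')
    · exact left_ne_zero_of_mul hcon (ih _ (ham ▸ h') a' rfl)
  · simp

theorem finrank_Dcomp {N k l r : ℕ} (hN : 1 ≤ N) (hk : 1 ≤ k) (hl : l ≤ k) (hr : r ≤ k)
    (i j : ℕ) : Module.finrank ℂ (Dcomp N k l r i j) = (basisSet N k l r i j).card := by
  obtain ⟨M, rfl⟩ := Nat.exists_eq_add_of_le' hN
  rw [Dcomp_eq_span_basisSet hl]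
  have h := finrank_span_eq_card (linearIndependent_monD (M := M) (i := i) (j := j) hk hl hr)
  rw [Fintype.card_coe] at h
  rw [← h]
  rw [Set.image_eq_range]
  rfl

end Basis

theorem hilbert_series_fermionic_formula (N k l r : ℕ)
    (hN : 2 ≤ N) (hk : 1 ≤ k) (hl : l ≤ k) (hr : r ≤ k) :
    hilb N k l r = PowerSeries.mk fun j =>
      ∑ v ∈ Vset k j,
        (PowerSeries.X : PowerSeries ℤ) ^
            ((∑ i : Fin k, ∑ i' : Fin k, v i * v i' * min (i.1 + 1) (i'.1 + 1)) +
              ∑ i : Fin k, (i.1 + 1 - l) * v i) *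
          ∏ i : Fin k,
            qbinomZ
              ((N + 1 : ℤ) * (i.1 + 1) -
                (2 * (∑ i' : Fin k, (min (i.1 + 1) (i'.1 + 1) : ℤ) * v i') +
                  max ((i.1 + 1 : ℤ) - l) 0 + max ((i.1 + 1 : ℤ) - r) 0 - v i))
              (v i) := by
  rw [hilb]
  congr 1
  funext j
  rw [← chainSum_X_eq N k l r j hk hl hr]
  ext i
  rw [PowerSeries.coeff_mk, coeff_chainSum_X, finrank_Dcomp (by omega) hk hl hr]
  rfl

end
end

section
/- Let N ≥ 3, k ≥ 1, 0 ≤ l ≤ k, 1 ≤ r ≤ k be integers. Then the number of integer points satisfies |A_N(k,l,r)| = |A_N(k,l,r−1)| + |A_{N−1}(k,l,k−r)|. -/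
/-!
STATEMENT 3: For N ≥ 3, k ≥ 1, 0 ≤ l ≤ k, 1 ≤ r ≤ k,
|A_N(k,l,r)| = |A_N(k,l,r-1)| + |A_{N-1}(k,l,k-r)|.
-/

noncomputable section

theorem ASet_finite (N : ℕ) (hN : 2 ≤ N) (k l r : ℤ) : (ASet N k l r).Finite := by
  refine (Set.finite_Icc (0 : Fin N → ℤ) (fun _ => k)).subset ?_
  rintro a ⟨h0, -, -, h3⟩
  refine ⟨h0, fun i => ?_⟩
  by_cases hi : i.1 + 1 < N
  · have h := h3 i hi
    have h' := h0 ⟨i.1 + 1, hi⟩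
    show a i ≤ k
    linarith
  · have hlt : i.1 - 1 + 1 < N := by omega
    have h := h3 ⟨i.1 - 1, by omega⟩ hlt
    have h' := h0 ⟨i.1 - 1, by omega⟩
    have hi' : (⟨i.1 - 1 + 1, hlt⟩ : Fin N) = i := Fin.ext (by simp only; omega)
    rw [hi'] at h
    show a i ≤ k
    linarith

theorem snoc_mem_ASet_iff (M : ℕ) (hM : 1 ≤ M) (k l r s : ℤ) (hs : 0 ≤ s) (b : Fin M → ℤ) :
    (Fin.snoc b s : Fin (M + 1) → ℤ) ∈ ASet (M + 1) k l r ↔ s ≤ r ∧ b ∈ ASet M k l (k - s) := by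
  have hlast : ∀ h : M < M + 1, (Fin.snoc b s : Fin (M + 1) → ℤ) ⟨M, h⟩ = s :=
    fun _ => Fin.snoc_last (α := fun _ => ℤ) s b
  have hinit : ∀ (i : ℕ) (hi : i < M) (h : i < M + 1),
      (Fin.snoc b s : Fin (M + 1) → ℤ) ⟨i, h⟩ = b ⟨i, hi⟩ :=
    fun i hi _ => Fin.snoc_castSucc (α := fun _ => ℤ) s b ⟨i, hi⟩
  constructor
  · rintro ⟨h0, h1, h2, h3⟩
    refine ⟨(hlast _).symm.trans_le (h2 M.succ_pos), fun i => ?_, fun h => ?_, fun h => ?_,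
      fun t ht => ?_⟩
    · rw [← hinit i i.2 (by omega)]
      exact h0 _
    · rw [← hinit 0 h (by omega)]
      exact h1 _
    · have h' := h3 ⟨M - 1, by omega⟩ (by simp only; omega)
      rw [hinit (M - 1) (by omega)] at h'
      simp only [Nat.sub_add_cancel hM, hlast] at h'
      linarith
    · have h' := h3 ⟨t, by omega⟩ (by simp only; omega)
      rwa [hinit t t.2, hinit (t + 1) ht] at h'
  · rintro ⟨hsr, h0, h1, h2, h3⟩
    refine ⟨fun i => ?_, fun h => ?_, fun h => (hlast _).trans_le hsr, ?_⟩
    · refine Fin.lastCases ?_ (fun j => ?_) i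
      · simpa using hs
      · simpa using h0 j
    · rw [hinit 0 hM]
      exact h1 hM
    · rintro ⟨t, ht⟩ h
      have htM : t < M := by simpa using h
      rw [hinit t htM]
      by_cases h' : t + 1 < M
      · rw [hinit (t + 1) h']
        exact h3 ⟨t, htM⟩ h'
      · obtain rfl : M = t + 1 := by omega
        rw [hlast]
        have := h2 hM
        simp only [Nat.add_sub_cancel] at this
        linarith

theorem card_lattice_points_recursion (N : ℕ) (hN : 3 ≤ N) (k l r : ℤ)
    (hk : 1 ≤ k) (hl0 : 0 ≤ l) (hl : l ≤ k) (hr1 : 1 ≤ r) (hr : r ≤ k) :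
    (ASet N k l r).ncard = (ASet N k l (r - 1)).ncard + (ASet (N - 1) k l (k - r)).ncard := by
  obtain ⟨M, rfl⟩ : ∃ M, N = M + 1 := ⟨N - 1, by omega⟩
  rw [Nat.add_sub_cancel]
  let f : (Fin M → ℤ) → (Fin (M + 1) → ℤ) := fun b => Fin.snoc b r
  have hf : Function.Injective f := fun b c h => (Fin.snoc_injective2 h).1
  have hunion : ASet (M + 1) k l r = ASet (M + 1) k l (r - 1) ∪ f '' ASet M k l (k - r) := by
    ext a
    obtain ⟨b, s, rfl⟩ : ∃ (b : Fin M → ℤ) (s : ℤ), a = Fin.snoc b s :=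
      ⟨Fin.init a, a (Fin.last M), (Fin.snoc_init_self a).symm⟩
    constructor
    · intro h
      have hs : 0 ≤ s := by simpa using h.1 (Fin.last M)
      rw [snoc_mem_ASet_iff M (by omega) _ _ _ _ hs] at h
      rcases h.1.eq_or_lt with rfl | hlt
      · exact Or.inr ⟨b, h.2, rfl⟩
      · exact Or.inl ((snoc_mem_ASet_iff M (by omega) _ _ _ _ hs b).2 ⟨by omega, h.2⟩)
    · rintro (⟨h0, h1, h2, h3⟩ | ⟨c, hc, hcb⟩)
      · exact ⟨h0, h1, fun h => (h2 h).trans (by omega), h3⟩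
      · rw [← hcb]
        exact (snoc_mem_ASet_iff M (by omega) _ _ _ _ (by omega) c).2 ⟨le_rfl, hc⟩
  have hdisj : Disjoint (ASet (M + 1) k l (r - 1)) (f '' ASet M k l (k - r)) := by
    rw [Set.disjoint_left]
    rintro _ h ⟨c, -, rfl⟩
    have := ((snoc_mem_ASet_iff M (by omega) _ _ _ _ (by omega) c).1 h).1
    omega
  rw [hunion, Set.ncard_union_eq hdisj (ASet_finite _ (by omega) _ _ _)
    ((ASet_finite _ (by omega) _ _ _).image f), Set.ncard_image_of_injective _ hf]

end
end
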